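/- Let G be a group satisfying hypothesis (H) that contains no element of order 6, and let Ω(G) be the subgroup of G generated by the set of elements g with g^2 = 1 or g^3 = 1 (the elements of prime order together with the identity). Then Ω(G) is locally finite and every element w of Ω(G) satisfies w^72 = 1. Moreover the quotient group G/Ω(G) is a 3-group, or a locally cyclic 2-group, or isomorphic to the Klein four-group C2 × C2, or isomorphic to the dihedral group of order 8, or isomorphic to the symmetric group on three letters. -/

import Mathlib

/-- A group `K` is a locally cyclic 2-group: every element has order a power of 2
and every finitely generated subgroup is cyclic. -/
def IsLocallyCyclic2Group (K : Type*) [Group K] : Prop :=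
  (∀ k : K, ∃ n : ℕ, orderOf k = 2 ^ n) ∧
  ∀ S : Subgroup K, S.FG → IsCyclic S

/-- Hypothesis (H): `G` is periodic, `π(G) = {2, 3}`, and the order of the product of
any two elements of order at most 4 does not exceed 9. -/
def HypH (G : Type*) [Group G] : Prop :=
  (∀ g : G, IsOfFinOrder g) ∧
  (∀ p : ℕ, p.Prime → ((∃ g : G, p ∣ orderOf g) ↔ p = 2 ∨ p = 3)) ∧
  ∀ x y : G, orderOf x ≤ 4 → orderOf y ≤ 4 → orderOf (x * y) ≤ 9

/-- Hypothesis (H*): `G` satisfies (H) and the centralizer of every involution of `G`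
is a locally cyclic 2-group. -/
def HypHStar (G : Type*) [Group G] : Prop :=
  HypH G ∧ ∀ a : G, a ≠ 1 → a ^ 2 = 1 →
    IsLocallyCyclic2Group (Subgroup.centralizer {a})

/-- `Ω(G)`: the subgroup of `G` generated by the elements of prime order
(together with the identity). -/
def Omega (G : Type*) [Group G] : Subgroup G :=
  Subgroup.closure {g : G | g ^ 2 = 1 ∨ g ^ 3 = 1}

instance Omega.normal (G : Type*) [Group G] : (Omega G).Normal := by
  constructor
  intro n hn g
  induction hn using Subgroup.closure_induction with
  | mem x hx =>
    refine Subgroup.subset_closure ?_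
    rcases hx with h | h
    · exact Or.inl (by rw [conj_pow, h, mul_one, mul_inv_cancel])
    · exact Or.inr (by rw [conj_pow, h, mul_one, mul_inv_cancel])
  | one => simpa using Subgroup.one_mem _
  | mul x y _ _ hx hy =>
    have h : g * (x * y) * g⁻¹ = (g * x * g⁻¹) * (g * y * g⁻¹) := by group
    rw [h]; exact Subgroup.mul_mem _ hx hy
  | inv x _ hx =>
    have h : g * x⁻¹ * g⁻¹ = (g * x * g⁻¹)⁻¹ := by group
    rw [h]; exact Subgroup.inv_mem _ hx

namespace TC

/-- Binary tries used as finite maps from `ℕ` to `ℕ` (value `0` means undefined). -/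
inductive Tr where
  | leaf : Tr
  | node : ℕ → Tr → Tr → Tr

def Tr.get : Tr → ℕ → ℕ
  | .leaf, _ => 0
  | .node v l r, k =>
    bif Nat.beq k 0 then v
    else bif Nat.beq (k % 2) 1 then l.get (k / 2) else r.get (k / 2 - 1)

def Tr.set : ℕ → Tr → ℕ → ℕ → Tr
  | 0, t, _, _ => t
  | f + 1, .leaf, k, v =>
    bif Nat.beq k 0 then .node v .leaf .leaf
    else bif Nat.beq (k % 2) 1 then .node 0 (Tr.set f .leaf (k / 2) v) .leaf
    else .node 0 .leaf (Tr.set f .leaf (k / 2 - 1) v)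
  | f + 1, .node w l r, k, v =>
    bif Nat.beq k 0 then .node v l r
    else bif Nat.beq (k % 2) 1 then .node w (Tr.set f l (k / 2) v) r
    else .node w l (Tr.set f r (k / 2 - 1) v)

theorem Tr.get_set (f : ℕ) : ∀ (t : Tr) (k v k' : ℕ),
    (k' = k ∧ (Tr.set f t k v).get k' = v) ∨ (Tr.set f t k v).get k' = t.get k' := by
  induction f with
  | zero => intro t k v k'; right; rfl
  | succ f ih =>
    intro t k v k'
    cases t with
    | leaf =>
      simp only [Tr.set, Bool.cond_eq_ite, Nat.beq_eq]
      split_ifs with h1 h2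
      · simp only [Tr.get, Bool.cond_eq_ite, Nat.beq_eq]
        split_ifs with h3 <;> simp_all
      · simp only [Tr.get, Bool.cond_eq_ite, Nat.beq_eq]
        split_ifs with h3 h4 <;> try simp
        rcases ih .leaf (k / 2) v (k' / 2) with ⟨ha, hb⟩ | hb
        · left; exact ⟨by omega, hb⟩
        · right; rw [hb]; rfl
      · simp only [Tr.get, Bool.cond_eq_ite, Nat.beq_eq]
        split_ifs with h3 h4 <;> try simp
        rcases ih .leaf (k / 2 - 1) v (k' / 2 - 1) with ⟨ha, hb⟩ | hb
        · left; exact ⟨by omega, hb⟩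
        · right; rw [hb]; rfl
    | node w l r =>
      simp only [Tr.set, Bool.cond_eq_ite, Nat.beq_eq]
      split_ifs with h1 h2
      · simp only [Tr.get, Bool.cond_eq_ite, Nat.beq_eq]
        split_ifs with h3 <;> simp_all
      · simp only [Tr.get, Bool.cond_eq_ite, Nat.beq_eq]
        split_ifs with h3 h4 <;> try simp
        rcases ih l (k / 2) v (k' / 2) with ⟨ha, hb⟩ | hb
        · left; exact ⟨by omega, hb⟩
        · right; rw [hb]
      · simp only [Tr.get, Bool.cond_eq_ite, Nat.beq_eq]
        split_ifs with h3 h4 <;> try simp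
        rcases ih r (k / 2 - 1) v (k' / 2 - 1) with ⟨ha, hb⟩ | hb
        · left; exact ⟨by omega, hb⟩
        · right; rw [hb]

/-- State of a (partial) coset enumeration. -/
structure St where
  T : Tr
  P : Tr
  n : ℕ

def find (P : Tr) : ℕ → ℕ → ℕ
  | 0, i => i
  | f + 1, i => Nat.rec i (fun p _ => find P f p) (P.get i)

/-- `0` if undefined, `j + 1` if the image is `j`. -/
def look (S : St) (i s : ℕ) : ℕ :=
  Nat.rec 0 (fun j _ => find S.P 60 j + 1) (S.T.get (i * 8 + s % 8))

def merge (S : St) (f b : ℕ) : St :=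
  bif Nat.beq f b then S
  else bif Nat.blt f b then ⟨S.T, S.P.set 40 b (f + 1), S.n⟩
  else ⟨S.T, S.P.set 40 f (b + 1), S.n⟩

def edge (S : St) (i s j : ℕ) : St := ⟨S.T.set 40 (i * 8 + s % 8) (j + 1), S.P, S.n⟩

def fwd (S : St) : ℕ → List ℕ → ℕ × List ℕ
  | f, [] => (f, [])
  | f, s :: w => Nat.rec (f, s :: w) (fun j _ => fwd S j w) (look S f s)

def bwd (S : St) (inv : ℕ → ℕ) : ℕ → List ℕ → ℕ × List ℕ
  | b, [] => (b, [])
  | b, s :: w => Nat.rec (b, s :: w) (fun j _ => bwd S inv j w) (look S b (inv s))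

def scanFin (S : St) (inv : ℕ → ℕ) (f : ℕ) : ℕ × List ℕ → St
  | (b, []) => merge S f b
  | (b, [s]) => edge (edge S f s b) b (inv s) f
  | (_, _ :: _ :: _) => S

def scanMid (S : St) (inv : ℕ → ℕ) (i : ℕ) : ℕ × List ℕ → St
  | (f, w) => scanFin S inv f (bwd S inv i w.reverse)

def scan (S : St) (inv : ℕ → ℕ) (i : ℕ) (w : List ℕ) : St :=
  scanMid S inv i (fwd S i w)

def defn (S : St) (inv : ℕ → ℕ) (i c : ℕ) : St :=
  edge (edge ⟨S.T, S.P, S.n + 1⟩ i c S.n) S.n (inv c) i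

def xferMid (S : St) (e c k l : ℕ) : St :=
  Nat.rec (edge S e c k) (fun l' _ => merge S k (find S.P 60 l')) l

def xfer (S : St) (i c : ℕ) : St :=
  Nat.rec S (fun k _ => xferMid S (find S.P 60 i) c (find S.P 60 k)
    (S.T.get (find S.P 60 i * 8 + c % 8))) (S.T.get (i * 8 + c % 8))

def step (rels subs : List (List ℕ)) (inv : ℕ → ℕ) (S : St) (k : ℕ) : St :=
  bif Nat.blt (k / 64) S.n then
    bif Nat.beq (k % 4) 0 then defn S inv (k / 64) (k / 4 % 16)
    else bif Nat.beq (k % 4) 1 then scan S inv (k / 64) (rels.getD (k / 4 % 16) [])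
    else bif Nat.beq (k % 4) 2 then xfer S (k / 64) (k / 4 % 16)
    else scan S inv 0 (subs.getD (k / 4 % 16) [])
  else S

def run (rels subs : List (List ℕ)) (inv : ℕ → ℕ) : List ℕ → St → St
  | [], S => S
  | k :: l, S => run rels subs inv l (step rels subs inv S k)

def goalOK : ℕ × List ℕ → Bool
  | (f, []) => Nat.beq f 0
  | (_, _ :: _) => false

def expand (r : List ℕ × ℕ) : List ℕ := (List.replicate r.2 r.1).flatten

/-- The checker for coset enumeration certificates. -/
def check (iv : List ℕ) (rels : List (List ℕ × ℕ)) (subs : List (List ℕ)) (goal : List ℕ)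
    (cert : List ℕ) : Bool :=
  goalOK (fwd (run (rels.map expand) subs (fun s => iv.getD (s % 8) 7) cert
    ⟨.leaf, .leaf, 1⟩) 0 goal)

section soundness
variable {G : Type*} [Group G]

def wd (val : ℕ → G) (w : List ℕ) : G := (w.map val).prod

theorem wd_expand (val : ℕ → G) (r : List ℕ × ℕ) : wd val (expand r) = wd val r.1 ^ r.2 := by
  obtain ⟨w, e⟩ := r
  simp only [wd, expand]
  induction e with
  | zero => simp
  | succ e ih => simp only [List.replicate_succ, List.flatten_cons, List.map_append,
      List.prod_append, ih]; rw [pow_succ']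

def R (H : Subgroup G) (φ : ℕ → G) (i : ℕ) (g : G) (j : ℕ) : Prop :=
  φ i * g * (φ j)⁻¹ ∈ H

theorem R.trans {H : Subgroup G} {φ : ℕ → G} {i j k : ℕ} {g h : G}
    (a : R H φ i g j) (b : R H φ j h k) : R H φ i (g * h) k := by
  have := H.mul_mem a b
  simp only [R] at *
  convert this using 1
  group

theorem R.symm {H : Subgroup G} {φ : ℕ → G} {i j : ℕ} {g : G}
    (a : R H φ i g j) : R H φ j g⁻¹ i := by
  have := H.inv_mem a
  simp only [R] at *
  convert this using 1
  group

structure Inv (H : Subgroup G) (val : ℕ → G) (S : St) (φ : ℕ → G) : Prop where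
  zero : φ 0 = 1
  pos : 0 < S.n
  edges : ∀ k j, S.T.get k = j + 1 → k / 8 < S.n ∧ j < S.n ∧ R H φ (k / 8) (val (k % 8)) j
  par : ∀ k j, S.P.get k = j + 1 → k < S.n ∧ j < S.n ∧ R H φ k 1 j

variable {H : Subgroup G} {val : ℕ → G} {S : St} {φ : ℕ → G} {inv : ℕ → ℕ}

theorem R.refl (i : ℕ) : R H φ i 1 i := by simp [R]

theorem Inv.find (h : Inv H val S φ) (f : ℕ) : ∀ i, i < S.n →
    find S.P f i < S.n ∧ R H φ i 1 (find S.P f i) := by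
  induction f with
  | zero => intro i hi; exact ⟨hi, R.refl i⟩
  | succ f ih =>
    intro i hi
    simp only [TC.find]
    rcases hp : S.P.get i with _ | p
    · exact ⟨hi, R.refl i⟩
    · obtain ⟨_, h2, h3⟩ := h.par i p hp
      obtain ⟨h4, h5⟩ := ih p h2
      refine ⟨h4, ?_⟩
      have := h3.trans h5
      rwa [one_mul] at this

theorem Inv.get (h : Inv H val S φ) (hv : ∀ s, val (s % 8) = val s) {i s k : ℕ}
    (e : S.T.get (i * 8 + s % 8) = k + 1) : i < S.n ∧ k < S.n ∧ R H φ i (val s) k := by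
  obtain ⟨h1, h2, h3⟩ := h.edges _ _ e
  have e1 : (i * 8 + s % 8) / 8 = i := by omega
  have e2 : (i * 8 + s % 8) % 8 = s % 8 := by omega
  rw [e1] at h1 h3
  rw [e2, hv] at h3
  exact ⟨h1, h2, h3⟩

theorem Inv.look (h : Inv H val S φ) (hv : ∀ s, val (s % 8) = val s) {i s j : ℕ}
    (e : look S i s = j + 1) : j < S.n ∧ R H φ i (val s) j := by
  simp only [TC.look] at e
  rcases hp : S.T.get (i * 8 + s % 8) with _ | p
  · rw [hp] at e; simp at e
  · rw [hp] at e
    obtain ⟨_, h2, h3⟩ := h.get hv hp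
    obtain ⟨h4, h5⟩ := h.find 60 p h2
    have e' : TC.find S.P 60 p + 1 = j + 1 := e
    have e'' : TC.find S.P 60 p = j := by omega
    rw [e''] at h4 h5
    have := h3.trans h5
    rw [mul_one] at this
    exact ⟨h4, this⟩

theorem Inv.edge (h : Inv H val S φ) (hv : ∀ s, val (s % 8) = val s) {i s j : ℕ}
    (hi : i < S.n) (hj : j < S.n) (r : R H φ i (val s) j) : Inv H val (edge S i s j) φ := by
  refine ⟨h.zero, h.pos, ?_, h.par⟩
  intro k l e
  simp only [TC.edge] at e ⊢
  rcases Tr.get_set 40 S.T (i * 8 + s % 8) (j + 1) k with ⟨h1, h2⟩ | h2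
  · rw [h2] at e
    have e1 : k / 8 = i := by omega
    have e2 : k % 8 = s % 8 := by omega
    have e3 : j = l := by omega
    rw [e1, e2, hv, ← e3]
    exact ⟨hi, hj, r⟩
  · rw [h2] at e
    exact h.edges k l e

theorem Inv.setP (h : Inv H val S φ) {i j : ℕ}
    (hi : i < S.n) (hj : j < S.n) (r : R H φ i 1 j) :
    Inv H val ⟨S.T, S.P.set 40 i (j + 1), S.n⟩ φ := by
  refine ⟨h.zero, h.pos, h.edges, ?_⟩
  intro k l e
  dsimp only at e ⊢
  rcases Tr.get_set 40 S.P i (j + 1) k with ⟨h1, h2⟩ | h2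
  · rw [h2] at e
    have e3 : j = l := by omega
    rw [h1, ← e3]
    exact ⟨hi, hj, r⟩
  · rw [h2] at e
    exact h.par k l e

theorem Inv.merge (h : Inv H val S φ) {i j : ℕ}
    (hi : i < S.n) (hj : j < S.n) (r : R H φ i 1 j) : Inv H val (merge S i j) φ := by
  simp only [TC.merge, Bool.cond_eq_ite]
  split_ifs
  · exact h
  · refine h.setP hj hi ?_
    have := r.symm
    rwa [inv_one] at this
  · exact h.setP hi hj r

theorem Inv.fwd (h : Inv H val S φ) (hv : ∀ s, val (s % 8) = val s) (w : List ℕ) :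
    ∀ i, i < S.n → (fwd S i w).1 < S.n ∧
      ∃ g, R H φ i g (fwd S i w).1 ∧ wd val w = g * wd val (fwd S i w).2 := by
  induction w with
  | nil => intro i hi; exact ⟨hi, 1, R.refl i, by simp [TC.fwd]⟩
  | cons s w ih =>
    intro i hi
    simp only [TC.fwd]
    rcases hp : TC.look S i s with _ | p
    · exact ⟨hi, 1, R.refl i, by simp⟩
    · obtain ⟨h1, h2⟩ := h.look hv hp
      obtain ⟨h3, g, h4, h5⟩ := ih p h1
      refine ⟨h3, val s * g, h2.trans h4, ?_⟩
      rw [mul_assoc]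
      change _ = val s * (g * wd val (TC.fwd S p w).2)
      rw [← h5]; simp [wd]

theorem Inv.bwd (h : Inv H val S φ) (hv : ∀ s, val (s % 8) = val s)
    (hinv : ∀ s, val (inv s) = (val s)⁻¹) (f : ℕ) (w : List ℕ) :
    ∀ b, b < S.n → R H φ f (wd val w.reverse) b → (bwd S inv b w).1 < S.n ∧
      R H φ f (wd val (bwd S inv b w).2.reverse) (bwd S inv b w).1 := by
  induction w with
  | nil => intro b hb r; exact ⟨hb, r⟩
  | cons s w ih =>
    intro b hb r
    simp only [TC.bwd]
    rcases hp : TC.look S b (inv s) with _ | p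
    · exact ⟨hb, r⟩
    · obtain ⟨h1, h2⟩ := h.look hv hp
      refine ih p h1 ?_
      have := r.trans h2
      rw [hinv] at this
      simpa [wd] using this

theorem Inv.scan (h : Inv H val S φ) (hv : ∀ s, val (s % 8) = val s)
    (hinv : ∀ s, val (inv s) = (val s)⁻¹) {i : ℕ} (hi : i < S.n) {w : List ℕ}
    (r : R H φ i (wd val w) i) : Inv H val (scan S inv i w) φ := by
  obtain ⟨h1, g, h2, h3⟩ := h.fwd hv w i hi
  simp only [TC.scan]
  generalize TC.fwd S i w = q at *
  obtain ⟨f, w'⟩ := q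
  dsimp only at h1 h2 h3
  simp only [TC.scanMid]
  have h4 : R H φ f (wd val w'.reverse.reverse) i := by
    have := h2.symm.trans r
    rw [h3] at this
    simpa using this
  obtain ⟨h5, h6⟩ := h.bwd hv hinv f w'.reverse i hi h4
  generalize TC.bwd S inv i w'.reverse = q at *
  obtain ⟨b, _ | ⟨s, _ | ⟨s', w''⟩⟩⟩ := q
  · exact h.merge h1 h5 (by simpa [wd] using h6)
  · have h7 : R H φ f (val s) b := by simpa [wd] using h6
    refine (h.edge hv h1 h5 h7).edge hv h5 h1 ?_
    rw [hinv]; exact h7.symm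
  · exact h

theorem Inv.defn (h : Inv H val S φ) (hv : ∀ s, val (s % 8) = val s)
    (hinv : ∀ s, val (inv s) = (val s)⁻¹) {i c : ℕ} (hi : i < S.n) :
    ∃ φ', Inv H val (defn S inv i c) φ' := by
  have hne : ∀ k, k < S.n → Function.update φ S.n (φ i * val c) k = φ k := fun k hk =>
    Function.update_of_ne (by omega) _ _
  have hn : Function.update φ S.n (φ i * val c) S.n = φ i * val c := Function.update_self _ _ _
  refine ⟨Function.update φ S.n (φ i * val c), ?_⟩
  have h0 : Inv H val ⟨S.T, S.P, S.n + 1⟩ (Function.update φ S.n (φ i * val c)) := by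
    refine ⟨?_, Nat.succ_pos _, ?_, ?_⟩
    · rw [hne 0 h.pos]; exact h.zero
    · intro k j e
      obtain ⟨h1, h2, h3⟩ := h.edges k j e
      refine ⟨Nat.lt_succ_of_lt h1, Nat.lt_succ_of_lt h2, ?_⟩
      rw [R, hne _ h1, hne _ h2]; exact h3
    · intro k j e
      obtain ⟨h1, h2, h3⟩ := h.par k j e
      refine ⟨Nat.lt_succ_of_lt h1, Nat.lt_succ_of_lt h2, ?_⟩
      rw [R, hne _ h1, hne _ h2]; exact h3
  have hr : R H (Function.update φ S.n (φ i * val c)) i (val c) S.n := by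
    rw [R, hne _ hi, hn]; simp
  refine (h0.edge hv (Nat.lt_succ_of_lt hi) (Nat.lt_succ_self _) hr).edge hv
    (Nat.lt_succ_self _) (Nat.lt_succ_of_lt hi) ?_
  rw [hinv]; exact hr.symm

theorem Inv.xfer (h : Inv H val S φ) (hv : ∀ s, val (s % 8) = val s) {i c : ℕ} :
    Inv H val (xfer S i c) φ := by
  simp only [TC.xfer]
  rcases hk : S.T.get (i * 8 + c % 8) with _ | k
  · exact h
  · obtain ⟨h1, h2, h3⟩ := h.get hv hk
    obtain ⟨h4, h5⟩ := h.find 60 i h1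
    obtain ⟨h6, h7⟩ := h.find 60 k h2
    simp only [TC.xferMid]
    have h8 : R H φ (TC.find S.P 60 i) (val c) (TC.find S.P 60 k) := by
      have := (h5.symm.trans h3).trans h7
      simpa using this
    rcases hl : S.T.get (TC.find S.P 60 i * 8 + c % 8) with _ | l
    · exact h.edge hv h4 h6 h8
    · obtain ⟨_, h9, h10⟩ := h.get hv hl
      obtain ⟨h11, h12⟩ := h.find 60 l h9
      refine h.merge h6 h11 ?_
      have := (h8.symm.trans h10).trans h12
      simpa using this

theorem Inv.step (h : Inv H val S φ) (hv : ∀ s, val (s % 8) = val s)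
    (hinv : ∀ s, val (inv s) = (val s)⁻¹) {rels subs : List (List ℕ)}
    (hr : ∀ w ∈ rels, wd val w = 1) (hs : ∀ w ∈ subs, wd val w ∈ H) (k : ℕ) :
    ∃ φ', Inv H val (step rels subs inv S k) φ' := by
  simp only [TC.step, Bool.cond_eq_ite, Nat.beq_eq]
  split_ifs with h1 h2 h3 h4
  · exact h.defn hv hinv (Nat.blt_eq.mp h1)
  · refine ⟨φ, h.scan hv hinv (Nat.blt_eq.mp h1) ?_⟩
    have : wd val (rels.getD (k / 4 % 16) []) = 1 := by
      rw [List.getD_eq_getElem?_getD]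
      rcases hx : rels[k / 4 % 16]? with _ | w
      · simp [wd]
      · exact hr _ (List.mem_of_getElem? hx)
    rw [this]; exact R.refl _
  · exact ⟨φ, h.xfer hv⟩
  · refine ⟨φ, h.scan hv hinv h.pos ?_⟩
    have : wd val (subs.getD (k / 4 % 16) []) ∈ H := by
      rw [List.getD_eq_getElem?_getD]
      rcases hx : subs[k / 4 % 16]? with _ | w
      · simp [wd]
      · exact hs _ (List.mem_of_getElem? hx)
    rw [R, h.zero]; simpa using this
  · exact ⟨φ, h⟩

theorem Inv.run (hv : ∀ s, val (s % 8) = val s)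
    (hinv : ∀ s, val (inv s) = (val s)⁻¹) {rels subs : List (List ℕ)}
    (hr : ∀ w ∈ rels, wd val w = 1) (hs : ∀ w ∈ subs, wd val w ∈ H) (l : List ℕ) :
    ∀ S φ, Inv H val S φ → ∃ φ', Inv H val (run rels subs inv l S) φ' := by
  induction l with
  | nil => intro S φ h; exact ⟨φ, h⟩
  | cons k l ih =>
    intro S φ h
    obtain ⟨φ', h'⟩ := h.step hv hinv hr hs k
    exact ih _ _ h'

theorem sound (H : Subgroup G) (L : List G) (iv : List ℕ) (rels : List (List ℕ × ℕ))
    (subs : List (List ℕ)) (goal : List ℕ) (cert : List ℕ)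
    (hc : check iv rels subs goal cert = true)
    (hinv : ∀ s < 8, L.getD (iv.getD s 7 % 8) 1 = (L.getD s 1)⁻¹)
    (hr : ∀ r ∈ rels, wd (fun s => L.getD (s % 8) 1) r.1 ^ r.2 = 1)
    (hs : ∀ w ∈ subs, wd (fun s => L.getD (s % 8) 1) w ∈ H) :
    wd (fun s => L.getD (s % 8) 1) goal ∈ H := by
  have hv : ∀ s : ℕ, (fun s => L.getD (s % 8) 1) (s % 8) = (fun s => L.getD (s % 8) 1) s := by
    intro s; simp
  have h0 : Inv H (fun s => L.getD (s % 8) 1) ⟨.leaf, .leaf, 1⟩ (fun _ => (1 : G)) :=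
    ⟨rfl, Nat.one_pos, by intro k j e; simp [Tr.get] at e, by intro k j e; simp [Tr.get] at e⟩
  obtain ⟨φ, h⟩ := Inv.run hv (inv := fun s => iv.getD (s % 8) 7)
    (fun s => hinv (s % 8) (Nat.mod_lt _ (by norm_num)))
    (rels := rels.map expand) (subs := subs) (H := H)
    (by intro w hw
        obtain ⟨r, hr', rfl⟩ := List.mem_map.mp hw
        rw [wd_expand]; exact hr r hr') hs cert _ _ h0
  obtain ⟨_, g, h2, h3⟩ := h.fwd hv goal 0 h.pos
  simp only [check] at hc
  generalize hq : TC.fwd (TC.run (rels.map expand) subs (fun s => iv.getD (s % 8) 7) cert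
    ⟨.leaf, .leaf, 1⟩) 0 goal = q at *
  obtain ⟨f, _ | ⟨a, l⟩⟩ := q
  · simp only [goalOK, Nat.beq_eq] at hc
    subst hc
    rw [h3]
    rw [R, h.zero] at h2
    simpa [wd] using h2
  · simp [goalOK] at hc

end soundness
end TC

theorem cert_P84_8 : TC.check [1, 0, 2]
    [([0], 3), ([0, 2], 8), ([0, 2, 1, 2], 4), ([0, 2, 1, 2, 0, 2], 8)] [[0, 2]] [0]
    [0, 3, 64, 1, 136, 192, 264, 324, 392, 448, 520, 580, 648, 9, 705, 320, 776, 832, 904, 960,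
    1032, 69, 1089, 321, 1024, 1160, 1220, 1288, 1344, 1416, 1476, 1544, 265, 1601, 1025, 1165,
    1158, 1162, 1034, 1222, 1090, 1094, 1290, 650, 586, 1346, 706, 522, 1414] = true := by
  decide +kernel

theorem cert_P84_9 : TC.check [1, 0, 2]
    [([0], 3), ([0, 2], 8), ([0, 2, 1, 2], 4), ([0, 2, 1, 2, 0, 2], 9)] [[0, 2]] [0]
    [0, 3, 64, 1, 136, 192, 264, 324, 392, 448, 520, 580, 648, 9, 705, 320, 776, 832, 904, 960,
    1032, 69, 1089, 321, 1024, 1160, 1220, 1288, 1344, 1416, 1476, 1544, 265, 1601, 1025, 1165,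
    1154, 1158, 1162, 970, 1034, 1222, 898, 902, 1090, 1098, 1290, 1610, 842, 706, 710, 1346, 1538,
    770, 774, 778, 1418, 514] = true := by
  decide +kernel

theorem cert_P44 : TC.check [1, 0, 2]
    [([0], 3), ([0, 2], 4), ([0, 2, 1, 2], 8)] [[0, 2]] [0]
    [0, 3, 4, 1, 136, 192, 196, 193, 133, 137, 258, 262, 266] = true := by
  decide +kernel

theorem cert_P94 : TC.check [1, 0, 2]
    [([0], 3), ([0, 2], 9), ([0, 2, 1, 2], 4)] [] [0, 2, 0, 2, 0, 2]
    [0, 64, 1, 72, 192, 264, 320, 392, 448, 520, 576, 648, 704, 776, 832, 904, 960, 1032, 1088, 5,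
    196, 1224, 1280, 1352, 1412, 1480, 1536, 1608, 1668, 1736, 1792, 1864, 9, 1921, 193, 136, 1984,
    2056, 2112, 2184, 2240, 2312, 2368, 2440, 2496, 2568, 2624, 2696, 69, 2753, 1988, 2824, 2880,
    2952, 3012, 3080, 3136, 3208, 3268, 3336, 73, 3393, 1985, 1856, 3464, 3520, 3592, 3648, 3720,
    3776, 3848, 3904, 3976, 133, 4033, 1024, 4104, 4164, 4232, 4288, 4360, 4420, 4488, 137, 4545,
    1025, 1408, 4616, 4672, 4744, 4800, 4872, 4928, 5000, 5056, 5128, 261, 5185, 1409, 2688, 5256,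
    5316, 5384, 5440, 5512, 5572, 5640, 265, 5697, 3200, 5768, 5824, 5896, 5952, 6024, 6080, 6152,
    6208, 6280, 389, 6337, 3201, 5120, 6408, 6468, 6536, 6592, 6664, 6724, 6792, 393, 6849, 6272,
    6920, 6980, 7048, 7104, 7176, 7236, 7304, 521, 7361, 6273, 6656, 7432, 7488, 7560, 7616, 7688,
    7744, 7816, 7872, 7944, 645, 8001, 7936, 8072, 8132, 8200, 8256, 8328, 777, 8385, 8320, 8456,
    8512, 8584, 8640, 8712, 8768, 8840, 1029, 8897, 5312, 8968, 9024, 9096, 9152, 9224, 9280, 9352,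
    9408, 9480, 1349, 2560, 9608, 9668, 9736, 9792, 9864, 9924, 9992, 1353, 10049, 2561, 8832,
    10120, 10176, 10248, 10304, 10376, 10432, 10504, 1541, 10561, 9472, 10632, 3008, 10760, 10816,
    10888, 10944, 11016, 11072, 11144, 11200, 11272, 2053, 11329, 3009, 3968, 11400, 11264, 11528,
    11588, 11656, 11712, 11784, 11844, 11912, 2185, 11969, 11776, 12040, 12096, 12168, 12224,
    12296, 12352, 12424, 2437, 12481, 11777, 11456, 12552, 12608, 12680, 12736, 12808, 12864,
    12936, 2949, 12993, 12928, 13064, 13124, 13192, 13248, 13320, 3209, 13377, 11584, 13448, 13504,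
    13576, 13632, 13704, 4293, 13761, 11585, 10692, 13832, 13888, 13960, 14020, 14088, 4617, 14145,
    10496, 14216, 14276, 14344, 14400, 14472, 4745, 14529, 13952, 14600, 14656, 14728, 14784,
    14856, 14912, 14984, 4869, 15041, 6976, 15112, 6977, 10948, 15240, 15296, 15368, 15428, 15496,
    5769, 15553, 14976, 15624, 15680, 15752, 15808, 15880, 15936, 16008, 5893, 16000, 16136, 16196,
    16264, 6025, 16001, 13696, 16392, 16448, 16520, 7109, 16577, 13697, 16393, 15938, 15946, 16010,
    15878, 16066, 15818, 15498, 15750, 15558, 15690, 9866, 15622, 9922, 14986, 10570, 15042, 10498,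
    13194, 14218, 13254, 14278, 14538, 14470, 14410, 5574, 5642, 5698] = true := by
  decide +kernel

theorem cert_P88c : TC.check [1, 0, 2]
    [([0], 3), ([0, 2], 8), ([0, 2, 1, 2], 8), ([0, 0, 2, 0, 2, 0, 2, 0, 2], 3), ([0, 2, 0, 2, 0, 2, 0, 2, 2], 4)] [[0, 2]] [0]
    [0, 3, 64, 1, 136, 192, 264, 320, 392, 448, 520, 576, 648, 704, 776, 69, 833, 589, 650, 706,
    385, 777, 770, 778, 330, 834, 838, 258] = true := by
  decide +kernel

theorem cert_L88_8 : TC.check [0, 1, 2]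
    [([0, 1], 3), ([1, 2], 2), ([0, 2], 8), ([0, 1, 2], 8), ([0, 2, 0, 2, 1], 8)] [[0, 2]] [0, 1]
    [0, 3, 68, 128, 196, 256, 1, 325, 264, 388, 197, 384, 516, 576, 644, 385, 584, 772, 517, 712,
    900, 645, 768, 1028, 1088, 1156, 769, 896, 1284, 1344, 1412, 897, 1096, 1540, 1029, 1224, 1668,
    1157, 1352, 1796, 1285, 1480, 1924, 1413, 1997, 1920, 2052, 1537, 1664, 2180, 2240, 2308, 1665,
    1792, 2436, 2496, 2564, 1793, 2633, 2245, 1681, 2509, 2050, 2054, 2630, 2634, 2562, 2570, 2178,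
    2506, 2242, 1670, 1674, 2306, 1350, 1354, 1738, 1218, 1410, 1414, 1418, 1290, 838, 1098, 1474,
    1482, 1986, 1858, 1026, 518, 194] = true := by
  decide +kernel

theorem cert_L88_9 : TC.check [0, 1, 2]
    [([0, 1], 3), ([1, 2], 2), ([0, 2], 8), ([0, 1, 2], 8), ([0, 2, 0, 2, 1], 9)] [[0, 1, 2]] [0, 1]
    [0, 68, 3, 4, 5, 128, 192, 193, 264, 328, 261, 384, 448, 516, 520, 580, 449, 584, 648, 517,
    704, 776, 581, 832, 896, 964, 968, 1024, 1092, 1096, 841, 1156, 897, 1160, 1224, 965, 1348,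
    1025, 1352, 1416, 1093, 1544, 1157, 1600, 1664, 1736, 1349, 1792, 1856, 1857, 1920, 1988, 1992,
    2112, 2180, 2184, 2308, 1921, 1933, 2312, 2693, 2561, 2432, 2568, 2181, 2624, 2641, 2953, 2946,
    2954, 2630, 2634, 2818, 2890, 2178, 2442, 2562, 1798, 1802, 1986, 2762, 2122, 1346, 1606, 2306,
    1730, 1030, 1034, 1930, 2246, 1418, 842, 1858, 1538, 710, 1226, 1666] = true := by
  decide +kernel

theorem cert_L99_8 : TC.check [0, 1, 2]
    [([0, 1], 3), ([1, 2], 2), ([0, 2], 9), ([0, 1, 2], 9), ([0, 2, 0, 2, 1], 8)] [[0, 2]] [0, 1, 0]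
    [0, 3, 4, 68, 69, 128, 192, 193, 264, 328, 261, 384, 448, 516, 520, 580, 449, 584, 648, 517,
    704, 776, 581, 832, 896, 964, 968, 1024, 1092, 1096, 1156, 897, 1224, 965, 1280, 1348, 1025,
    1352, 1416, 1093, 1472, 1544, 1600, 1668, 1672, 1736, 1349, 1856, 1924, 1928, 1481, 1984, 2052,
    1601, 2056, 2120, 1669, 2240, 2308, 1857, 2312, 2376, 1925, 2500, 1997, 2504, 3013, 2568, 2053,
    2624, 2688, 2824, 2309, 2880, 2944, 2945, 3136, 3204, 3272, 3328, 3396, 3400, 3464, 3269, 3524,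
    3137, 3528, 3592, 3648, 3716, 3329, 3720, 3784, 3397, 3904, 3976, 3525, 4032, 4096, 4164, 4168,
    4232, 3717, 4288, 4352, 4420, 3905, 4424, 4480, 4548, 4552, 4612, 4616, 4680, 4165, 4800, 4932,
    4936, 5000, 4421, 5056, 5124, 4481, 4493, 5128, 5829, 4497, 5257, 5386, 4742, 5450, 4109, 5765,
    5889, 5261, 5830, 5834, 5122, 5506, 4490, 4810, 3970, 4226, 3594, 3786, 4098, 4354, 4614, 4618,
    4934, 5322, 4162, 5578, 4674, 3654, 5762, 4998, 5002, 5062, 5066, 4418, 4422, 5702, 2946, 3274,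
    2370, 2434, 3458, 3462, 1290, 2826, 2570, 1670, 1674, 1474, 1410, 3330, 3338, 3138, 2114, 2182,
    2186, 1922, 1930, 1734, 3718, 1026, 1034, 3522, 582, 586, 834] = true := by
  decide +kernel

theorem cert_L99_9 : TC.check [0, 1, 2]
    [([0, 1], 3), ([1, 2], 2), ([0, 2], 9), ([0, 1, 2], 9), ([0, 2, 0, 2, 1], 9)] [[0, 2]] [0, 1, 0]
    [0, 3, 4, 68, 69, 128, 192, 193, 264, 328, 261, 384, 448, 516, 520, 580, 449, 584, 648, 517,
    704, 776, 581, 832, 896, 964, 968, 1024, 1092, 1096, 1156, 897, 1160, 1224, 965, 1280, 1348,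
    1025, 1352, 1416, 1093, 1472, 1544, 1600, 1664, 1732, 1736, 1800, 1349, 1920, 1988, 1992, 1481,
    2048, 2120, 2180, 1665, 2248, 1733, 2368, 2436, 1921, 2440, 2504, 1989, 2628, 2061, 2632, 3141,
    2760, 2816, 2952, 2437, 3072, 3073, 3264, 3336, 3392, 3464, 3333, 3524, 3528, 3652, 3656, 3784,
    3525, 3840, 3912, 3653, 3968, 4032, 4100, 4104, 4160, 4228, 4232, 4292, 4033, 4045, 4296, 4677,
    4545, 4416, 4552, 4229, 4608, 4625, 4937, 3718, 3722, 3594, 3458, 3330, 3082, 2826, 2498, 2242,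
    2954, 2762, 3394, 3266, 3654, 3526, 3914, 3786, 4162, 4034, 4486, 4490, 4294, 4298, 1026, 898,
    1350, 1158, 1162, 1802, 1546, 1602, 2370, 2050, 2122, 2890, 2630, 2698] = true := by
  decide +kernel

theorem cert_L89 : TC.check [0, 1, 2]
    [([0, 1], 3), ([1, 2], 2), ([0, 2], 8), ([0, 1, 2], 9)] [] [0, 1, 2, 0, 1, 2, 0, 1, 2]
    [0, 4, 8, 68, 72, 128, 136, 5, 192, 256, 257, 264, 69, 320, 392, 448, 516, 520, 584, 389, 640,
    708, 712, 768, 836, 449, 840, 904, 517, 960, 1092, 641, 1096, 1160, 709, 1216, 1284, 1288,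
    1352, 837, 1408, 1472, 1540, 1544, 1608, 1093, 1664, 1728, 1796, 1800, 1864, 1285, 1920, 1984,
    2052, 2056, 2116, 1473, 2120, 2184, 1541, 2240, 2304, 2372, 2376, 2436, 1729, 2440, 2504, 1797,
    2560, 2624, 2692, 2696, 2756, 1985, 2760, 2824, 2053, 2880, 2952, 2117, 3008, 3072, 3140, 3144,
    3204, 2305, 3208, 3272, 2373, 3400, 2437, 3456, 3520, 3588, 3592, 2569, 3652, 2625, 3656, 3720,
    3776, 3848, 2757, 3904, 3968, 4036, 4040, 4164, 4168, 4228, 3073, 4232, 4296, 3141, 4424, 3205,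
    4480, 4544, 4608, 4676, 4680, 4740, 3521, 4744, 4808, 3589, 4936, 3653, 4992, 5056, 5124, 5128,
    3785, 5184, 5252, 5256, 5316, 3969, 5320, 5384, 4037, 5512, 4165, 5568, 5640, 4229, 5696, 5760,
    5824, 5892, 5896, 5956, 5960, 6020, 4609, 6024, 6088, 4677, 6144, 6216, 4741, 6272, 6336, 6337,
    6400, 6468, 6472, 6536, 6600, 5125, 6724, 5185, 6728, 6792, 5253, 6848, 6920, 5317, 6976, 7040,
    7104, 7172, 7176, 7232, 7300, 7368, 7428, 5825, 7432, 7496, 5893, 7552, 7624, 5957, 7752, 6021,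
    7808, 7872, 7940, 7944, 8000, 8068, 8072, 8136, 7365, 8196, 8200, 8264, 6469, 8384, 8448, 8449,
    8520, 6725, 8576, 8640, 8708, 8712, 6857, 8768, 8836, 8904, 8964, 7105, 8968, 9032, 7173, 9156,
    7233, 9160, 9224, 9280, 9352, 7429, 9472, 9540, 9544, 7561, 9600, 9664, 9732, 9736, 9796, 7873,
    9800, 9864, 7941, 9988, 9992, 10056, 8069, 10112, 10176, 10248, 8197, 10304, 10368, 10440,
    10504, 8901, 10560, 10628, 10632, 10692, 8641, 10696, 10884, 8769, 10888, 11008, 11080, 8965,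
    11136, 11272, 9157, 11328, 11392, 11460, 11464, 11520, 11588, 9473, 11592, 11780, 11784, 11844,
    9665, 11848, 11968, 12040, 9797, 12096, 12232, 9989, 12288, 12352, 12420, 12424, 12484, 10177,
    12488, 12544, 12557, 8205, 12612, 10305, 12616, 12676, 12680, 12736, 12800, 12868, 10561,
    10573, 12936, 10629, 13064, 10693, 13120, 13192, 10885, 13248, 13316, 13320, 13376, 13444,
    13504, 13572, 13576, 13636, 13640, 13704, 11461, 13760, 13896, 11589, 13952, 14024, 11781,
    14080, 14276, 14280, 11977, 14336, 14404, 14408, 14464, 14532, 14536, 14596, 12353, 14600,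
    14664, 12421, 14792, 12485, 14848, 14984, 12613, 15040, 15112, 12677, 15236, 15240, 15300,
    12801, 15424, 15488, 15556, 15560, 15616, 15684, 15688, 15752, 13317, 15808, 15876, 13377,
    15880, 15944, 16004, 13505, 13517, 16008, 18693, 18241, 16072, 13573, 16128, 16200, 13637,
    16256, 16320, 16388, 16392, 16516, 16520, 16576, 16644, 16712, 14277, 16836, 14337, 16840,
    16904, 14405, 16960, 17028, 14465, 14477, 17032, 19845, 19457, 17096, 14533, 17152, 17224,
    14597, 17344, 17408, 17476, 17480, 17536, 17604, 17608, 15049, 17664, 17736, 15237, 17864,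
    17928, 17988, 15489, 17992, 18056, 15557, 18248, 15685, 18304, 18368, 18436, 18440, 18504,
    15877, 18560, 18624, 18888, 16137, 18944, 19012, 19016, 19076, 16321, 19080, 19272, 16517,
    19328, 19520, 19521, 19592, 16837, 19648, 19712, 19780, 19784, 20036, 20040, 17161, 20096,
    20168, 20228, 17409, 20232, 20296, 17477, 20420, 17537, 20424, 17545, 20488, 17605, 20612,
    20616, 20672, 20736, 20800, 20809, 20872, 17989, 20992, 21056, 21124, 21128, 18313, 21188,
    18369, 21192, 21256, 18437, 21376, 21389, 15885, 21444, 18561, 21448, 21508, 21512, 21636,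
    18945, 18957, 21704, 19013, 21760, 21832, 19077, 16333, 21888, 21889, 21952, 22020, 22276,
    19713, 22344, 19781, 22472, 20037, 22656, 22848, 22920, 20421, 23040, 23041, 23112, 20613,
    23168, 23240, 23300, 23424, 17997, 23492, 23496, 23556, 21057, 23560, 23752, 21189, 18381,
    23808, 23809, 24008, 21445, 24136, 21509, 24192, 24320, 24388, 24392, 21769, 24520, 24580,
    21953, 24584, 24712, 24768, 24832, 24833, 24900, 24904, 24968, 25024, 25025, 25096, 23237,
    25224, 25280, 25480, 23493, 25608, 23557, 25800, 25221, 25856, 25920, 25988, 25992, 26052,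
    24321, 26056, 26240, 26312, 24581, 26432, 26504, 26568, 24965, 26632, 24901, 26688, 26752,
    26824, 26501, 26944, 27016, 27072, 27272, 27332, 25921, 25933, 27456, 27465, 27528, 26053,
    27584, 27593, 27656, 26249, 27712, 27780, 26445, 27968, 27981, 28036, 26689, 28685, 26945,
    28169, 28166, 27850, 26498, 24774, 24778, 22410, 22338, 19778, 24714, 16966, 16970, 26434,
    19722, 14402, 27782, 16898, 12102, 12106, 28874, 19590, 19594, 14346, 28802, 16842, 22146,
    12034, 28362, 19650, 24458, 9862, 28482, 22214, 21826, 11210, 27398, 24522, 19142, 9922, 25994,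
    26242, 16394, 11722, 27458, 27658, 19202, 13378, 28554, 28738, 21578, 15882, 28098, 28426,
    18882, 18562, 26758, 27266, 16134, 21446, 21450, 27914, 25862, 18826, 24010, 26562, 10946,
    16066, 8834, 24838, 13194, 18698, 6986, 22538, 15618, 5314, 20034, 11074, 5958, 17158, 9034,
    7626, 19978, 7938, 9602, 17090, 6150, 11786, 19846, 14082, 17034, 16646, 19906] = true := by
  decide +kernel

theorem cert_K8 : TC.check [1, 0, 2, 3]
    [([0], 3), ([0, 2], 3), ([0, 3], 3), ([2, 3], 4), ([2, 3, 2, 3, 0], 2), ([0, 2, 3], 8)] [[2, 3]] [0]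
    [8, 3, 0, 4, 1, 64, 68, 136, 140, 200, 204, 264, 69, 268, 73, 328, 325, 332, 329, 388, 396,
    145, 452, 449, 456, 461, 512, 517, 576, 577, 585, 652, 273, 712, 717, 908, 1169, 960, 964, 961,
    1032, 1041, 1224, 1229, 1344, 1353, 1348, 1345, 709, 1412, 905, 1544, 1541, 1685, 1730, 1742,
    1930, 1666, 1674, 1542, 1550, 1794, 1798, 1354, 1218, 1226] = true := by
  decide +kernel

theorem cert_K9 : TC.check [1, 0, 2, 3]
    [([0], 3), ([0, 2], 3), ([0, 3], 3), ([2, 3], 4), ([2, 3, 2, 3, 0], 2), ([0, 2, 3], 9)] [[2, 3]] [0]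
    [8, 3, 0, 4, 1, 64, 68, 136, 140, 200, 204, 264, 69, 268, 73, 328, 325, 332, 329, 388, 396,
    145, 452, 449, 456, 461, 512, 517, 576, 577, 585, 652, 273, 712, 717, 908, 1169, 960, 964, 961,
    1032, 1041, 1224, 1229, 1344, 1353, 1348, 1345, 709, 1412, 905, 1544, 1541, 597, 1730, 1734,
    1742, 1802, 1358, 1542, 1674, 774, 1226] = true := by
  decide +kernel

theorem cert_EN : TC.check [0, 1, 2]
    [([0, 1], 4), ([0, 2], 4), ([1, 2], 4), ([0, 2, 1, 0, 1, 2, 0, 2, 1, 0, 1, 2], 1), ([1, 2, 0, 1, 0, 2, 1, 2, 0, 1, 0, 2], 1), ([2, 1, 0, 2, 0, 1, 2, 1, 0, 2, 0, 1], 1), ([1, 0, 2, 1, 0, 2, 0, 1, 2, 0, 1, 2], 1), ([2, 0, 1, 2, 0, 1, 0, 2, 1, 0, 2, 1], 1), ([2, 1, 0, 2, 1, 0, 1, 2, 0, 1, 2, 0], 1), ([1, 0, 1, 0, 2, 0, 1, 0, 1, 2], 8)] [] [1, 0, 1, 0, 2, 0, 1, 0, 1, 2]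
    [0, 68, 128, 196, 256, 324, 384, 1, 72, 512, 584, 640, 712, 768, 5, 456, 900, 968, 1028, 1096,
    9, 516, 1216, 1284, 1352, 1408, 1480, 1540, 13, 896, 1668, 1728, 1800, 1860, 1928, 1984, 17,
    1608, 2112, 2180, 2248, 2308, 2368, 21, 2436, 2496, 2568, 2624, 25, 2056, 2752, 2820, 2880, 29,
    2628, 33, 136, 3076, 3144, 3204, 73, 1613, 541, 1313, 2946, 2886, 3072, 3332, 3392, 3464, 3524,
    3592, 3648, 81, 737, 1857, 2756, 3784, 3844, 3904, 85, 1809, 264, 201, 1537] = true := by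
  decide +kernel

theorem cert_FY9 : TC.check [1, 0, 3, 2]
    [([0], 4), ([2], 3), ([0, 0, 2], 2), ([2, 1, 2, 0], 9), ([3, 1, 2, 0], 9), ([0, 2], 9)] [[0, 2]] [2]
    [0, 3, 64, 128, 1, 201, 8, 5, 200, 320, 73, 197, 256, 456, 512, 584, 640, 712, 768, 840, 896,
    968, 1024, 85, 521, 1026, 1038, 581, 257, 392, 1152, 1224, 1280, 1352, 1408, 1480, 1536, 1608,
    1664, 1736, 1792, 149, 1861, 1161, 1806, 389, 1088, 513, 1928, 585, 704, 2048, 641, 649, 2053,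
    776, 709, 2120, 2240, 713, 1856, 2376, 2432, 2504, 2560, 2632, 2688, 2760, 2816, 2888, 2944,
    725, 2441, 2506, 1669, 1857, 832, 3072, 769, 777, 3077, 904, 837, 3144, 3264, 841, 960, 3400,
    3456, 3528, 3584, 3656, 3712, 3784, 3840, 3912, 3968, 853, 3465, 3526, 3530, 3470, 3586, 2177,
    2313, 3782, 3786, 2949, 3141, 961, 3200, 4104, 4160, 4232, 4288, 4360, 4416, 4488, 4544, 4616,
    4672, 1109, 1289, 4686, 1349, 4169, 4230, 4234, 3973, 3201, 1472, 4800, 1409, 1544, 1477, 4872,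
    4992, 1481, 1728, 5128, 5184, 5256, 5312, 5193, 5254, 5258, 5314, 4929, 1600, 1537, 5449, 4997,
    5192, 5504, 1609, 4608, 5640, 5696, 5768, 5824, 5896, 5952, 6024, 6080, 6152, 6208, 1621, 2697,
    6210, 6222, 2757, 5705, 5766, 5770, 4421, 2312, 6336, 6408, 6464, 6536, 6592, 6664, 6720, 6792,
    6848, 2069, 6917, 2696, 6272, 2689, 7048, 2761, 2880, 7168, 2817, 2825, 7173, 7240, 7296, 2889,
    7361, 6976, 7432, 7488, 7560, 7616, 7688, 7744, 7816, 7872, 7944, 8000, 2901, 3977, 8002, 8014,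
    4037, 4105, 7937, 6921, 3008, 2945, 8137, 7301, 6144, 8200, 8265, 6145, 7368, 8320, 3913, 8385,
    4297, 8337, 8326, 8330, 8334, 8138, 8142, 7366, 7234, 7238, 7306, 7310, 5826, 4490, 7178, 7182,
    4354, 4418, 4422, 5898, 6146, 6150, 7118, 3722, 3726, 2826, 5706, 5710, 5954, 5958, 8202, 8070,
    3650, 3654, 4546, 4550, 5642, 5646, 6026, 8270, 1354, 4042, 2250, 3394, 3402, 3142, 3146, 3150,
    3266, 3274, 1986, 2178, 2186, 1418] = true := by
  decide +kernel

theorem cert_FY8 : TC.check [1, 0, 3, 2]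
    [([0], 4), ([2], 3), ([0, 0, 2], 2), ([2, 1, 2, 0], 9), ([3, 1, 2, 0], 9), ([0, 2], 8)] [] [3, 1, 3, 0, 2, 1, 2, 0]
    [0, 64, 128, 1, 8, 264, 5, 136, 384, 9, 72, 512, 584, 640, 712, 768, 840, 896, 968, 1024, 1096,
    1152, 21, 520, 69, 200, 1344, 73, 456, 1472, 1544, 1600, 1672, 1728, 1800, 1856, 1928, 1984,
    85, 453, 392, 133, 256, 137, 1416, 2240, 2312, 2368, 2440, 2496, 2568, 2624, 2696, 2752, 149,
    1413, 1352, 197, 521, 2184, 2944, 3016, 3072, 3144, 3200, 3272, 3328, 3400, 3456, 213, 3525,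
    2181, 2112, 257, 320, 321, 3656, 3712, 3784, 3840, 3912, 3968, 4040, 4096, 4168, 4224, 4296,
    4352, 341, 2953, 4354, 4366, 3013, 3721, 3782, 3786, 1157, 2880, 513, 4488, 585, 704, 4608,
    641, 649, 4613, 776, 709, 4680, 4800, 713, 1280, 4936, 4992, 5064, 5120, 5192, 5248, 5320,
    5376, 725, 5001, 5062, 5066, 1989, 1281, 832, 5504, 769, 777, 5509, 904, 837, 5576, 5696, 841,
    3520, 5832, 5888, 5960, 6016, 6088, 6144, 6216, 6272, 853, 5897, 5958, 5962, 3333, 3521, 960,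
    6400, 897, 905, 6405, 1032, 965, 6472, 6592, 969, 4736, 6728, 6784, 6856, 6912, 6984, 7040,
    7112, 7168, 981, 6793, 6854, 6858, 5381, 4737, 1088, 7296, 1025, 1033, 7301, 7368, 7424, 1097,
    7489, 5632, 7560, 7616, 7688, 7744, 7816, 7872, 7944, 8000, 1109, 3977, 8002, 8014, 7625, 7686,
    7690, 6277, 5633, 1216, 1153, 8137, 7429, 3720, 8192, 1225, 8257, 1481, 6528, 8328, 8384, 8456,
    8512, 8584, 8640, 8712, 8768, 1237, 1609, 8770, 8782, 1669, 8393, 8454, 8458, 7173, 6529, 1608,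
    1541, 8264, 8960, 1545, 8261, 3592, 9088, 9160, 9216, 9288, 9344, 9416, 9472, 1557, 9097, 9158,
    9162, 2757, 3589, 8832, 1601, 9608, 1673, 1792, 9728, 1729, 1737, 1864, 1797, 9800, 9920, 1801,
    8896, 10056, 10112, 10184, 10240, 10312, 10368, 10440, 10496, 1813, 10121, 10182, 10186, 9477,
    8897, 1920, 10624, 1857, 1865, 10629, 10696, 10752, 1929, 10817, 8704, 10888, 10944, 11016,
    11072, 11144, 11200, 11272, 11328, 1941, 5257, 11330, 11342, 11270, 7049, 11074, 11086, 11014,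
    2048, 1985, 11465, 10757, 5000, 11520, 2057, 11585, 2249, 9856, 11656, 11712, 11784, 11840,
    11912, 11968, 12040, 12096, 2069, 2377, 12098, 12110, 2437, 11721, 11782, 11786, 10501, 9857,
    2376, 2309, 11592, 12288, 2313, 11589, 3464, 12416, 12488, 12544, 12616, 12672, 2325, 3461,
    12160, 2369, 12808, 2441, 2560, 12928, 2497, 2505, 12933, 2632, 2565, 13000, 13120, 2569,
    12224, 13256, 13312, 13384, 13440, 13512, 13568, 13640, 13696, 2581, 13321, 13382, 13386,
    12677, 12225, 2688, 13824, 2625, 2633, 13829, 13896, 13952, 2697, 14017, 12032, 14088, 14144,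
    14216, 14272, 14344, 14400, 14472, 14528, 2709, 9353, 14530, 14542, 14470, 10377, 14274, 14286,
    14214, 12033, 2816, 2753, 14665, 13957, 4416, 2825, 13056, 14792, 14848, 14920, 14976, 15048,
    15104, 15176, 15232, 2837, 3081, 15234, 15246, 3141, 14857, 14918, 14922, 13701, 13057, 14728,
    3017, 15296, 3073, 3264, 15488, 3201, 3209, 15560, 15616, 3273, 15681, 4288, 15752, 15808,
    15880, 15936, 16008, 16064, 16136, 16192, 3285, 6153, 16194, 16206, 16134, 3392, 3329, 16329,
    15621, 5896, 16384, 3401, 16449, 12425, 15168, 16520, 16576, 16648, 16704, 16776, 16832, 16904,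
    16960, 3413, 12553, 16962, 16974, 16902, 13577, 16706, 16718, 16646, 3976, 3909, 7496, 17152,
    3913, 7493, 9032, 17280, 17352, 17408, 17480, 17536, 3925, 9029, 8064, 17672, 4041, 4232,
    17088, 17864, 17920, 17992, 18048, 17929, 17990, 17994, 17541, 17089, 17792, 18184, 18240,
    18312, 18368, 18440, 18496, 4437, 18565, 4872, 18624, 18696, 18752, 18824, 18880, 18952, 19008,
    4629, 19077, 4869, 5256, 5189, 10824, 19200, 5193, 10821, 12360, 19328, 19400, 19456, 19528,
    19584, 5205, 12357, 11392, 5249, 19720, 5321, 19777, 5440, 5377, 19849, 19781, 6792, 19904,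
    5449, 19969, 18633, 19136, 20040, 20096, 20168, 20224, 20296, 20352, 20424, 20480, 5461, 18761,
    20482, 20494, 18821, 20105, 20166, 20170, 19589, 19137, 5768, 20608, 20680, 20736, 20808,
    20864, 20936, 20992, 5525, 21061, 5765, 6152, 6085, 15688, 21184, 6089, 16456, 21312, 21384,
    21440, 21512, 21568, 21640, 21696, 6101, 21321, 21382, 21386, 19013, 16453, 16256, 6145, 21832,
    6217, 21889, 6336, 6273, 21961, 21893, 7624, 22016, 6345, 22081, 20617, 21120, 22152, 22208,
    22280, 22336, 22408, 22464, 22536, 22592, 6357, 20745, 22594, 22606, 20805, 22217, 22278,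
    22282, 21701, 6664, 22720, 22792, 22848, 22920, 22976, 23048, 23104, 6421, 23173, 6661, 7048,
    6981, 11208, 23296, 6985, 19976, 23424, 23496, 23552, 23624, 23680, 23752, 23808, 6997, 23433,
    23494, 23498, 20997, 19973, 11136, 7041, 23944, 7113, 24001, 7232, 7169, 24073, 24005, 8392,
    24128, 7241, 24193, 22729, 23232, 24264, 24320, 24392, 24448, 24520, 24576, 24648, 24704, 7253,
    22857, 24706, 24718, 22917, 24329, 24394, 23813, 17224, 24832, 24904, 24960, 25032, 25088,
    7317, 25157, 17221, 7880, 25216, 25288, 25344, 25416, 25472, 25544, 25600, 25672, 25728, 8085,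
    25797, 8648, 8581, 10952, 25920, 8585, 24200, 26048, 26120, 26176, 26248, 26304, 26376, 26432,
    8597, 26057, 26122, 25093, 25856, 26568, 26624, 26696, 26752, 26824, 26880, 26952, 27008, 8853,
    27077, 17289, 27022, 17349, 26633, 26698, 26437, 14024, 9289, 14021, 14592, 9345, 27208, 9417,
    27265, 9536, 9473, 27337, 27269, 27072, 9545, 18560, 27464, 27520, 27592, 27648, 27720, 27776,
    27848, 27904, 9557, 17417, 27906, 27918, 27846, 18561, 9992, 28032, 28104, 28160, 9989, 10376,
    10309, 14408, 28352, 10313, 14405, 27400, 28480, 28552, 28608, 28680, 28736, 28808, 28864,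
    10325, 28489, 28550, 28554, 26885, 14336, 10369, 29000, 10441, 29057, 10560, 10497, 29129,
    29061, 11720, 29184, 10569, 29249, 28041, 28288, 29320, 29376, 29448, 29504, 29576, 29632,
    29704, 29760, 10581, 28169, 29774, 29385, 29446, 29450, 28869, 28289, 19272, 29888, 29960,
    30016, 30088, 30144, 10645, 30213, 19269, 23368, 30272, 30344, 30400, 30472, 30528, 30600,
    30656, 11413, 30725, 11976, 11909, 14152, 30848, 11913, 14149, 29256, 30976, 31048, 31104,
    31176, 31232, 31304, 31360, 11925, 30985, 31050, 30149, 30784, 31496, 31552, 31624, 31680,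
    31752, 31808, 31880, 31936, 12181, 32005, 19337, 31950, 19397, 31561, 31626, 31365, 30785,
    17024, 12545, 32072, 12617, 32129, 12736, 12673, 32201, 32133, 32000, 12745, 19072, 32328,
    32384, 32456, 32512, 32584, 32640, 32712, 32768, 12757, 19465, 32770, 32782, 32710, 20361,
    32514, 32526, 32454, 19073, 13192, 32896, 32968, 33024, 33096, 33152, 33224, 33280, 12949,
    13189, 13576, 13509, 16840, 33472, 13513, 16837, 32264, 33600, 33672, 33728, 33800, 33856,
    33928, 33984, 13525, 33609, 33674, 31813, 16768, 13569, 34120, 13641, 34177, 13760, 13697,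
    34249, 34181, 14856, 34304, 13769, 34369, 32905, 33408, 34440, 34496, 34568, 34624, 34696,
    34752, 34824, 34880, 13781, 33033, 34894, 33093, 34505, 34570, 33409, 18504, 35008, 35080,
    35136, 35208, 35264, 13845, 35333, 30920, 35392, 35464, 35520, 35592, 35648, 35720, 35776,
    14357, 35845, 35401, 30917, 28424, 35904, 35976, 36032, 36104, 36160, 36232, 36288, 14613,
    35017, 36302, 35077, 35913, 35974, 35978, 28421, 16584, 36416, 36488, 36544, 36616, 36672,
    36744, 36800, 36872, 36928, 16789, 36997, 33544, 37056, 37128, 37184, 37256, 37312, 37384,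
    37440, 17045, 37509, 21449, 37442, 37454, 37065, 27968, 17409, 37576, 17481, 37633, 17600,
    17537, 37705, 37637, 25792, 17609, 26944, 37832, 37888, 37960, 38016, 38088, 38144, 38216,
    38272, 17621, 24969, 38286, 38214, 26313, 38018, 38030, 37958, 26945, 20544, 18753, 38408,
    18825, 38465, 18944, 18881, 38537, 38469, 37504, 18953, 21056, 38664, 38720, 38792, 38848,
    38920, 38976, 39048, 39104, 18965, 21577, 39106, 39118, 39046, 22473, 38850, 38862, 38790,
    21057, 32832, 19457, 39240, 19529, 39297, 19648, 19585, 39369, 39301, 30720, 19657, 31872,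
    39496, 39552, 39624, 39680, 39752, 39808, 39880, 39936, 19669, 30025, 39950, 39878, 31241,
    39682, 20360, 40064, 40136, 40192, 40264, 40320, 40392, 40448, 40520, 40576, 20565, 40645,
    22656, 20737, 40712, 20809, 40769, 20928, 20865, 40841, 40773, 40640, 20937, 23168, 40968,
    41024, 41096, 41152, 41224, 41280, 41352, 41408, 20949, 23689, 41422, 41350, 24585, 41154,
    41166, 41094, 38600, 21513, 38597, 39168, 41608, 21641, 41665, 21760, 21697, 41737, 41669,
    24768, 22849, 41800, 22921, 41857, 23040, 22977, 41929, 41861, 38080, 26305, 41992, 26377,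
    42049, 37896, 42112, 26825, 42177, 28617, 28813, 35841, 35782, 35786, 35914, 35918, 36034,
    33926, 36106, 33870, 36162, 33798, 36238, 33738, 35138, 31750, 35210, 31690, 31694, 35266,
    31298, 31362, 35342, 39754, 31438, 37506, 39810, 35394, 38606, 31118, 37838, 39170, 39174,
    30146, 42118, 34766, 30222, 33162, 34694, 28162, 34818, 34826, 38982, 28238, 41614, 41670,
    29702, 41730, 29646, 29578, 24134, 29514, 28749, 28738, 22862, 22786, 22218, 8322, 6602] = true := by
  decide +kernel



/-! ### Word lemmas obtained from the certificates -/

section words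
variable {G : Type*} [Group G]

theorem inv_of_sq {a : G} (ha : a ^ 2 = 1) : a⁻¹ = a := by
  rw [inv_eq_iff_mul_eq_one, ← sq, ha]

theorem w_P84_8 {x a : G} (hx : x ^ 3 = 1) (ha : a ^ 2 = 1) (h1 : (x * a) ^ 8 = 1)
    (h2 : (x * a * x⁻¹ * a) ^ 4 = 1) (h3 : (x * a * x⁻¹ * a * x * a) ^ 8 = 1) :
    x ∈ Subgroup.zpowers (x * a) := by
  have := TC.sound (Subgroup.zpowers (x * a)) [x, x⁻¹, a] _ _ _ _ _ cert_P84_8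
    (by intro s hs; interval_cases s <;> simp [inv_of_sq ha])
    (by simp [TC.wd, ← mul_assoc, hx, h1, h2, h3])
    (by simp [TC.wd])
  simpa [TC.wd] using this

theorem w_P84_9 {x a : G} (hx : x ^ 3 = 1) (ha : a ^ 2 = 1) (h1 : (x * a) ^ 8 = 1)
    (h2 : (x * a * x⁻¹ * a) ^ 4 = 1) (h3 : (x * a * x⁻¹ * a * x * a) ^ 9 = 1) :
    x ∈ Subgroup.zpowers (x * a) := by
  have := TC.sound (Subgroup.zpowers (x * a)) [x, x⁻¹, a] _ _ _ _ _ cert_P84_9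
    (by intro s hs; interval_cases s <;> simp [inv_of_sq ha])
    (by simp [TC.wd, ← mul_assoc, hx, h1, h2, h3])
    (by simp [TC.wd])
  simpa [TC.wd] using this

theorem w_P44 {x a : G} (hx : x ^ 3 = 1) (ha : a ^ 2 = 1) (h1 : (x * a) ^ 4 = 1)
    (h2 : (x * a * x⁻¹ * a) ^ 8 = 1) : x ∈ Subgroup.zpowers (x * a) := by
  have := TC.sound (Subgroup.zpowers (x * a)) [x, x⁻¹, a] _ _ _ _ _ cert_P44
    (by intro s hs; interval_cases s <;> simp [inv_of_sq ha])
    (by simp [TC.wd, ← mul_assoc, hx, h1, h2])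
    (by simp [TC.wd])
  simpa [TC.wd] using this

theorem w_P94 {x a : G} (hx : x ^ 3 = 1) (ha : a ^ 2 = 1) (h1 : (x * a) ^ 9 = 1)
    (h2 : (x * a * x⁻¹ * a) ^ 4 = 1) : (x * a) ^ 3 = 1 := by
  have := TC.sound ⊥ [x, x⁻¹, a] _ _ _ _ _ cert_P94
    (by intro s hs; interval_cases s <;> simp [inv_of_sq ha])
    (by simp [TC.wd, ← mul_assoc, hx, h1, h2])
    (by simp)
  simpa [TC.wd, pow_succ, mul_assoc] using this

theorem w_P88c {x a z : G} (hz : z = (x * a) ^ 4) (hx : x ^ 3 = 1) (ha : a ^ 2 = 1)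
    (h1 : (x * a) ^ 8 = 1) (h2 : (x * a * x⁻¹ * a) ^ 8 = 1) (h3 : (x * z) ^ 3 = 1)
    (h4 : (z * a) ^ 4 = 1) : x ∈ Subgroup.zpowers (x * a) := by
  have hz' : z = x * a * x * a * x * a * x * a := by
    rw [hz]; simp only [pow_succ, pow_zero, one_mul, mul_assoc]
  have := TC.sound (Subgroup.zpowers (x * a)) [x, x⁻¹, a] _ _ _ _ _ cert_P88c
    (by intro s hs; interval_cases s <;> simp [inv_of_sq ha])
    (by
      rw [hz'] at h3 h4
      simp only [← mul_assoc] at h3 h4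
      simp [TC.wd, ← mul_assoc, hx, h1, h2, h3, h4])
    (by simp [TC.wd])
  simpa [TC.wd] using this

theorem w_L88_8 {i j z : G} (hi : i ^ 2 = 1) (hj : j ^ 2 = 1) (hz : z ^ 2 = 1)
    (h1 : (i * j) ^ 3 = 1) (h2 : (j * z) ^ 2 = 1) (h3 : (i * z) ^ 8 = 1)
    (h4 : (i * j * z) ^ 8 = 1) (h5 : (i * z * i * z * j) ^ 8 = 1) :
    i * j ∈ Subgroup.zpowers (i * z) := by
  have := TC.sound (Subgroup.zpowers (i * z)) [i, j, z] _ _ _ _ _ cert_L88_8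
    (by intro s hs; interval_cases s <;> simp [inv_of_sq hi, inv_of_sq hj, inv_of_sq hz])
    (by simp [TC.wd, ← mul_assoc, h1, h2, h3, h4, h5])
    (by simp [TC.wd])
  simpa [TC.wd] using this

theorem w_L88_9 {i j z : G} (hi : i ^ 2 = 1) (hj : j ^ 2 = 1) (hz : z ^ 2 = 1)
    (h1 : (i * j) ^ 3 = 1) (h2 : (j * z) ^ 2 = 1) (h3 : (i * z) ^ 8 = 1)
    (h4 : (i * j * z) ^ 8 = 1) (h5 : (i * z * i * z * j) ^ 9 = 1) :
    i * j ∈ Subgroup.zpowers (i * j * z) := by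
  have := TC.sound (Subgroup.zpowers (i * j * z)) [i, j, z] _ _ _ _ _ cert_L88_9
    (by intro s hs; interval_cases s <;> simp [inv_of_sq hi, inv_of_sq hj, inv_of_sq hz])
    (by simp [TC.wd, ← mul_assoc, h1, h2, h3, h4, h5])
    (by simp [TC.wd, ← mul_assoc])
  simpa [TC.wd] using this

theorem w_L99_8 {i j z : G} (hi : i ^ 2 = 1) (hj : j ^ 2 = 1) (hz : z ^ 2 = 1)
    (h1 : (i * j) ^ 3 = 1) (h2 : (j * z) ^ 2 = 1) (h3 : (i * z) ^ 9 = 1)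
    (h4 : (i * j * z) ^ 9 = 1) (h5 : (i * z * i * z * j) ^ 8 = 1) :
    i * j * i ∈ Subgroup.zpowers (i * z) := by
  have := TC.sound (Subgroup.zpowers (i * z)) [i, j, z] _ _ _ _ _ cert_L99_8
    (by intro s hs; interval_cases s <;> simp [inv_of_sq hi, inv_of_sq hj, inv_of_sq hz])
    (by simp [TC.wd, ← mul_assoc, h1, h2, h3, h4, h5])
    (by simp [TC.wd])
  simpa [TC.wd, ← mul_assoc] using this

theorem w_L99_9 {i j z : G} (hi : i ^ 2 = 1) (hj : j ^ 2 = 1) (hz : z ^ 2 = 1)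
    (h1 : (i * j) ^ 3 = 1) (h2 : (j * z) ^ 2 = 1) (h3 : (i * z) ^ 9 = 1)
    (h4 : (i * j * z) ^ 9 = 1) (h5 : (i * z * i * z * j) ^ 9 = 1) :
    i * j * i ∈ Subgroup.zpowers (i * z) := by
  have := TC.sound (Subgroup.zpowers (i * z)) [i, j, z] _ _ _ _ _ cert_L99_9
    (by intro s hs; interval_cases s <;> simp [inv_of_sq hi, inv_of_sq hj, inv_of_sq hz])
    (by simp [TC.wd, ← mul_assoc, h1, h2, h3, h4, h5])
    (by simp [TC.wd])
  simpa [TC.wd, ← mul_assoc] using this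

theorem w_L89 {i j z : G} (hi : i ^ 2 = 1) (hj : j ^ 2 = 1) (hz : z ^ 2 = 1)
    (h1 : (i * j) ^ 3 = 1) (h2 : (j * z) ^ 2 = 1) (h3 : (i * z) ^ 8 = 1)
    (h4 : (i * j * z) ^ 9 = 1) : (i * j * z) ^ 3 = 1 := by
  have := TC.sound ⊥ [i, j, z] _ _ _ _ _ cert_L89
    (by intro s hs; interval_cases s <;> simp [inv_of_sq hi, inv_of_sq hj, inv_of_sq hz])
    (by simp [TC.wd, ← mul_assoc, h1, h2, h3, h4])
    (by simp)
  simpa [TC.wd, pow_succ, mul_assoc] using this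

theorem w_K8 {h f g : G} (hh : h ^ 3 = 1) (hf : f ^ 2 = 1) (hg : g ^ 2 = 1)
    (h1 : (h * f) ^ 3 = 1) (h2 : (h * g) ^ 3 = 1) (h3 : (f * g) ^ 4 = 1)
    (h4 : (f * g * f * g * h) ^ 2 = 1) (h5 : (h * f * g) ^ 8 = 1) :
    h ∈ Subgroup.zpowers (f * g) := by
  have := TC.sound (Subgroup.zpowers (f * g)) [h, h⁻¹, f, g] _ _ _ _ _ cert_K8
    (by intro s hs; interval_cases s <;> simp [inv_of_sq hf, inv_of_sq hg])
    (by simp [TC.wd, ← mul_assoc, hh, h1, h2, h3, h4, h5])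
    (by simp [TC.wd])
  simpa [TC.wd] using this

theorem w_K9 {h f g : G} (hh : h ^ 3 = 1) (hf : f ^ 2 = 1) (hg : g ^ 2 = 1)
    (h1 : (h * f) ^ 3 = 1) (h2 : (h * g) ^ 3 = 1) (h3 : (f * g) ^ 4 = 1)
    (h4 : (f * g * f * g * h) ^ 2 = 1) (h5 : (h * f * g) ^ 9 = 1) :
    h ∈ Subgroup.zpowers (f * g) := by
  have := TC.sound (Subgroup.zpowers (f * g)) [h, h⁻¹, f, g] _ _ _ _ _ cert_K9
    (by intro s hs; interval_cases s <;> simp [inv_of_sq hf, inv_of_sq hg])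
    (by simp [TC.wd, ← mul_assoc, hh, h1, h2, h3, h4, h5])
    (by simp [TC.wd])
  simpa [TC.wd] using this

/-- If involutions `e, h, k` satisfy enough 2-Engel relations and the triple commutator has
order dividing `8`, then it is trivial. -/
theorem w_EN {e h k : G} (he : e ^ 2 = 1) (hh : h ^ 2 = 1) (hk : k ^ 2 = 1)
    (hE : ∀ u ∈ Subgroup.closure {e, h, k}, ∀ v ∈ Subgroup.closure {e, h, k},
      Commute u (v⁻¹ * u * v))
    (h8 : ∀ u ∈ Subgroup.closure {e, h, k}, u ^ 8 = 1) :
    Commute ((e * h) ^ 2) k := by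
  have ie := inv_of_sq he
  have ih := inv_of_sq hh
  have ik := inv_of_sq hk
  have me : e ∈ Subgroup.closure {e, h, k} := Subgroup.subset_closure (by simp)
  have mh : h ∈ Subgroup.closure {e, h, k} := Subgroup.subset_closure (by simp)
  have mk : k ∈ Subgroup.closure {e, h, k} := Subgroup.subset_closure (by simp)
  have key : ∀ u ∈ Subgroup.closure {e, h, k}, ∀ v ∈ Subgroup.closure {e, h, k},
      u⁻¹ * (v⁻¹ * u * v)⁻¹ * u * (v⁻¹ * u * v) = 1 := by
    intro u hu v hv
    have := hE u hu v hv
    rw [mul_assoc (_ * _), this.eq]; group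
  have key2 : ∀ u ∈ Subgroup.closure {e, h, k}, ∀ v ∈ Subgroup.closure {e, h, k},
      u ^ 2 = 1 → v ^ 2 = 1 → (u * v) ^ 4 = 1 := by
    intro u hu v hv hu2 hv2
    have := key u hu v hv
    simp only [mul_inv_rev, inv_of_sq hu2, inv_of_sq hv2] at this
    rw [← this]; simp only [pow_succ, pow_zero, one_mul, mul_assoc]
  have := TC.sound ⊥ [e, h, k] _ _ _ _ _ cert_EN
    (by intro s hs; interval_cases s <;> simp [ie, ih, ik])
    (by
      have r1 := key2 e me h mh he hh
      have r2 := key2 e me k mk he hk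
      have r3 := key2 h mh k mk hh hk
      have r4 := key e me (h * k) (mul_mem mh mk)
      have r5 := key h mh (e * k) (mul_mem me mk)
      have r6 := key k mk (e * h) (mul_mem me mh)
      have r7 := key (e * h) (mul_mem me mh) k mk
      have r8 := key (e * k) (mul_mem me mk) h mh
      have r9 := key (h * k) (mul_mem mh mk) e me
      have r10 := h8 (h * e * h * e * k * e * h * e * h * k) (by
        repeat' apply mul_mem
        all_goals assumption)
      simp only [mul_inv_rev, ie, ih, ik, ← mul_assoc] at r1 r2 r3 r4 r5 r6 r7 r8 r9 r10
      simp [TC.wd, ← mul_assoc, r1, r2, r3, r4, r5, r6, r7, r8, r9, r10])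
    (by simp)
  simp only [TC.wd, Subgroup.mem_bot] at this
  simp at this
  have h2 : ((e * h) ^ 2)⁻¹ * k * (e * h) ^ 2 * k = 1 := by
    rw [← this]
    simp only [pow_succ, pow_zero, one_mul, mul_inv_rev, ie, ih, mul_assoc]
  have h3 : k * (e * h) ^ 2 * k = (e * h) ^ 2 := by
    have := eq_inv_of_mul_eq_one_right (by simpa only [mul_assoc] using h2 :
      ((e * h) ^ 2)⁻¹ * (k * (e * h) ^ 2 * k) = 1)
    simpa using this
  have h4 : (e * h) ^ 2 * k = k * (e * h) ^ 2 := by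
    calc (e * h) ^ 2 * k = k * k * ((e * h) ^ 2 * k) := by rw [← sq, hk, one_mul]
      _ = k * (k * (e * h) ^ 2 * k) := by group
      _ = _ := by rw [h3]
  exact h4

theorem w_FY9 {f y : G} (hf : f ^ 4 = 1) (hy : y ^ 3 = 1) (h1 : (f * f * y) ^ 2 = 1)
    (h2 : (y * f⁻¹ * y * f) ^ 9 = 1) (h3 : (y⁻¹ * f⁻¹ * y * f) ^ 9 = 1)
    (h4 : (f * y) ^ 9 = 1) : y ∈ Subgroup.zpowers (f * y) := by
  have := TC.sound (Subgroup.zpowers (f * y)) [f, f⁻¹, y, y⁻¹] _ _ _ _ _ cert_FY9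
    (by intro s hs; interval_cases s <;> simp)
    (by simp [TC.wd, ← mul_assoc, hf, hy, h1, h2, h3, h4])
    (by simp [TC.wd])
  simpa [TC.wd] using this

theorem w_FY8 {f y : G} (hf : f ^ 4 = 1) (hy : y ^ 3 = 1) (h1 : (f * f * y) ^ 2 = 1)
    (h2 : (y * f⁻¹ * y * f) ^ 9 = 1) (h3 : (y⁻¹ * f⁻¹ * y * f) ^ 9 = 1)
    (h4 : (f * y) ^ 8 = 1) : Commute y (f⁻¹ * y * f) := by
  have := TC.sound ⊥ [f, f⁻¹, y, y⁻¹] _ _ _ _ _ cert_FY8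
    (by intro s hs; interval_cases s <;> simp)
    (by simp [TC.wd, ← mul_assoc, hf, hy, h1, h2, h3, h4])
    (by simp)
  simp only [TC.wd, Subgroup.mem_bot] at this
  simp at this
  have h5 : (f⁻¹ * y * f * y)⁻¹ * (y * (f⁻¹ * y * f)) = 1 := by
    rw [← this]
    simp only [mul_inv_rev, inv_inv, mul_assoc]
  exact (inv_mul_eq_one.mp h5).symm
end words


/-! ### Basic consequences of the hypotheses -/

/-- The working form of hypothesis (H) without elements of order 6. -/
structure HH (G : Type*) [Group G] : Prop where
  pe : ∀ g : G, (∃ n : ℕ, g ^ (2 ^ n) = 1) ∨ ∃ n : ℕ, g ^ (3 ^ n) = 1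
  mul : ∀ u v : G, (u ^ 4 = 1 ∨ u ^ 3 = 1) → (v ^ 4 = 1 ∨ v ^ 3 = 1) →
    (u * v) ^ 8 = 1 ∨ (u * v) ^ 9 = 1

section basics
variable {G : Type*} [Group G]

theorem eq_one_of_coprime {g : G} {m n : ℕ} (h : Nat.Coprime m n) (hm : g ^ m = 1)
    (hn : g ^ n = 1) : g = 1 := by
  have := pow_gcd_eq_one.mpr ⟨hm, hn⟩
  rwa [h, pow_one] at this

theorem pow_mul_comm_one {g h : G} {n : ℕ} (e : (g * h) ^ n = 1) : (h * g) ^ n = 1 := by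
  have : h * g = h * (g * h) * h⁻¹ := by group
  rw [this, conj_pow, e]; group

theorem pow_four_of_sq {g : G} (h : g ^ 2 = 1) : g ^ 4 = 1 := by
  rw [show 4 = 2 * 2 by norm_num, pow_mul, h, one_pow]

theorem conj_ne_one {g h : G} (e : g ≠ 1) : h * g * h⁻¹ ≠ 1 := by
  intro hh; exact e (by simpa using hh)

theorem conj_pow_one {g h : G} {n : ℕ} (e : g ^ n = 1) : (h * g * h⁻¹) ^ n = 1 := by
  rw [conj_pow, e]; group

theorem commute_of_mem_zpowers {x g : G} (h : x ∈ Subgroup.zpowers g) : Commute x g := by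
  obtain ⟨k, rfl⟩ := Subgroup.mem_zpowers_iff.mp h
  exact (Commute.refl g).zpow_left k

theorem pow_of_mem_zpowers {x g : G} {n : ℕ} (h : x ∈ Subgroup.zpowers g) (e : g ^ n = 1) :
    x ^ n = 1 := by
  obtain ⟨k, rfl⟩ := Subgroup.mem_zpowers_iff.mp h
  rw [← zpow_natCast, zpow_comm, zpow_natCast, e, one_zpow]

theorem sq_cancel {a : G} (ha : a ^ 2 = 1) (t : G) : a * (a * t) = t := by
  rw [← mul_assoc, ← sq, ha, one_mul]

theorem sq_self {a : G} (ha : a ^ 2 = 1) : a * a = 1 := by rw [← sq, ha]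

theorem cube_sq {x : G} (hx : x ^ 3 = 1) : x * x = x⁻¹ := by
  rw [eq_inv_iff_mul_eq_one, ← hx]; simp [pow_succ]

theorem cube_sq_inv {x : G} (hx : x ^ 3 = 1) : x⁻¹ * x⁻¹ = x := by
  rw [← mul_inv_rev, cube_sq hx, inv_inv]

theorem cube_cancel {x : G} (hx : x ^ 3 = 1) (t : G) : x * (x * t) = x⁻¹ * t := by
  rw [← mul_assoc, cube_sq hx]

theorem cube_cancel_inv {x : G} (hx : x ^ 3 = 1) (t : G) : x⁻¹ * (x⁻¹ * t) = x * t := by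
  rw [← mul_assoc, cube_sq_inv hx]

/-- The four-group inside `A4`. -/
theorem a4_left {t e : G} (ht : t ^ 3 = 1) (he : e ^ 2 = 1) (h : (t * e) ^ 3 = 1) :
    e * (t⁻¹ * e * t) = t * e * t⁻¹ ∧ (t⁻¹ * e * t) * e = t * e * t⁻¹ := by
  have ie := inv_of_sq he
  have h1 : e * t * e = t⁻¹ * e * t⁻¹ := by
    have : t * (e * t * e) * (t * e) = 1 := by
      rw [← h]; simp only [pow_succ, pow_zero, one_mul, mul_assoc]
    have := eq_inv_of_mul_eq_one_left this
    rw [← eq_inv_mul_iff_mul_eq] at this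
    rw [this, mul_inv_rev, ie, mul_assoc]
  have h2 : e * t⁻¹ * e = t * e * t := by
    have := congrArg (·⁻¹) h1
    simpa [ie, mul_assoc] using this
  constructor
  · rw [show e * (t⁻¹ * e * t) = e * t⁻¹ * e * t by group, h2]
    simp only [mul_assoc, cube_sq ht]
  · rw [show (t⁻¹ * e * t) * e = t⁻¹ * (e * t * e) by group, h1]
    simp only [mul_assoc, cube_cancel_inv ht]

theorem a4_inv {t e : G} (he : e ^ 2 = 1) (h : (t * e) ^ 3 = 1) : (t⁻¹ * e) ^ 3 = 1 := by
  apply pow_mul_comm_one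
  have : e * t⁻¹ = (t * e)⁻¹ := by rw [mul_inv_rev, inv_of_sq he]
  rw [this, inv_pow, h, inv_one]

theorem inverts_pow {a y : G} (ha : a ^ 2 = 1) (h : a * y * a = y⁻¹) (n : ℕ) :
    a * y ^ n * a = (y ^ n)⁻¹ := by
  have : a * y * a = a * y * a⁻¹ := by rw [inv_of_sq ha]
  rw [this] at h
  have h2 := conj_pow (a := a) (b := y) (i := n)
  rw [h, inv_pow, inv_of_sq ha] at h2
  exact h2.symm

theorem exists_inverted {a u : G} (ha : a ^ 2 = 1) (h : a * u * a = u⁻¹) (h9 : u ^ 9 = 1)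
    (h1 : u ≠ 1) : ∃ y : G, y ^ 3 = 1 ∧ y ≠ 1 ∧ a * y * a = y⁻¹ := by
  by_cases h3 : u ^ 3 = 1
  · exact ⟨u, h3, h1, h⟩
  · exact ⟨u ^ 3, by rw [← pow_mul, h9], h3, inverts_pow ha h 3⟩

theorem inverts_mul {a u : G} (ha : a ^ 2 = 1) (hu : u ^ 2 = 1) :
    a * (u * a) * a = (u * a)⁻¹ := by
  rw [mul_inv_rev, inv_of_sq ha, inv_of_sq hu, mul_assoc, mul_assoc, ← sq, ha, mul_one]

namespace HH
variable (H : HH G)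
include H

theorem comm_cases {g h : G} {n m : ℕ} (c : Commute g h) (hg : g ^ (2 ^ n) = 1)
    (hh : h ^ (3 ^ m) = 1) : g = 1 ∨ h = 1 := by
  rcases H.pe (g * h) with ⟨k, hk⟩ | ⟨k, hk⟩
  · right
    have h1 : h ^ (2 ^ (k + n)) = 1 := by
      have : (g * h) ^ (2 ^ (k + n)) = 1 := by rw [pow_add, pow_mul, hk, one_pow]
      rw [c.mul_pow, pow_add, mul_comm, pow_mul, hg, one_pow, one_mul] at this
      rw [pow_add, mul_comm]; exact this
    exact eq_one_of_coprime (Nat.Coprime.pow _ _ (by norm_num)) h1 hh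
  · left
    have h1 : g ^ (3 ^ (k + m)) = 1 := by
      have : (g * h) ^ (3 ^ (k + m)) = 1 := by rw [pow_add, pow_mul, hk, one_pow]
      rw [c.mul_pow, show h ^ 3 ^ (k + m) = 1 by rw [pow_add, mul_comm, pow_mul, hh, one_pow],
        mul_one] at this
      exact this
    exact eq_one_of_coprime (Nat.Coprime.pow _ _ (by norm_num)) hg h1

theorem comm_absurd {a x : G} (ha : a ^ 2 = 1) (ha1 : a ≠ 1) (hx : x ^ 3 = 1) (hx1 : x ≠ 1)
    (c : Commute a x) : False := by
  rcases H.comm_cases (n := 1) (m := 1) c (by simpa using ha) (by simpa using hx) with h | h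
  · exact ha1 h
  · exact hx1 h

theorem invol_mul {a b : G} (ha : a ^ 2 = 1) (hb : b ^ 2 = 1) :
    (a * b) ^ 8 = 1 ∨ (a * b) ^ 9 = 1 :=
  H.mul a b (Or.inl (pow_four_of_sq ha)) (Or.inl (pow_four_of_sq hb))

theorem zp_absurd {x a : G} (hx : x ^ 3 = 1) (hx1 : x ≠ 1) (ha : a ^ 2 = 1) (ha1 : a ≠ 1)
    (h : x ∈ Subgroup.zpowers (x * a)) : False := by
  have c := commute_of_mem_zpowers h
  have c2 : Commute x a := by
    have := (Commute.refl x).inv_right.mul_right c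
    simpa using this
  exact H.comm_absurd ha ha1 hx hx1 c2.symm

theorem pair8 {x a : G} (hx : x ^ 3 = 1) (hx1 : x ≠ 1) (ha : a ^ 2 = 1) (ha1 : a ≠ 1)
    (h8 : (x * a) ^ 8 = 1) : ∃ y : G, y ^ 3 = 1 ∧ y ≠ 1 ∧ a * y * a = y⁻¹ := by
  have ia := inv_of_sq ha
  have hxi : (x * a * x⁻¹) ^ 2 = 1 := conj_pow_one ha
  by_contra hno
  have nocomm : ¬ Commute a x := fun c => H.comm_absurd ha ha1 hx hx1 c
  have hc : (x * a * x⁻¹ * a) ^ 8 = 1 := by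
    rcases H.invol_mul hxi ha with h | h
    · exact h
    · exfalso
      refine hno (exists_inverted ha (inverts_mul ha hxi) h ?_)
      intro h1
      have := eq_inv_of_mul_eq_one_left h1
      rw [ia] at this
      apply nocomm
      change a * x = x * a
      calc a * x = x * a * x⁻¹ * x := by rw [this]
        _ = x * a := by group
  obtain ⟨z, hz⟩ : ∃ z, z = (x * a) ^ 4 := ⟨_, rfl⟩
  have hz2 : z ^ 2 = 1 := by rw [hz, ← pow_mul, h8]
  have iz := inv_of_sq hz2
  have hz1 : z ≠ 1 := by
    intro h; rw [hz] at h
    exact H.zp_absurd hx hx1 ha ha1 (w_P44 hx ha h hc)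
  have aza : a * z * a = x⁻¹ * z * x := by
    rw [hz]; simp [pow_succ, mul_assoc, sq_self ha]
  have za : z ≠ a := by
    intro h
    have c : Commute z (x * a) := by rw [hz]; exact (Commute.refl _).pow_left 4
    rw [h] at c
    apply nocomm
    have := c.mul_right (Commute.refl a).inv_right
    simpa using this
  rcases H.invol_mul hz2 ha with h | h
  · have e1 : (z * a) ^ 2 = z * x⁻¹ * z * x := by
      rw [sq, show z * a * (z * a) = z * (a * z * a) by group, aza]; group
    have e2 : (x * z * x⁻¹ * z) ^ 4 = 1 := by
      have : (z * x⁻¹ * z * x) ^ 4 = 1 := by rw [← e1, ← pow_mul, h]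
      have := pow_mul_comm_one this
      simpa only [mul_assoc] using this
    rcases H.mul x z (Or.inr hx) (Or.inl (pow_four_of_sq hz2)) with h8' | h9'
    · have e3 : x * z * x⁻¹ * z * x * z = (x * z * x⁻¹) * (z * x * z⁻¹) := by
        rw [iz]; group
      rcases H.mul (x * z * x⁻¹) (z * x * z⁻¹)
        (Or.inl (conj_pow_one (pow_four_of_sq hz2))) (Or.inr (conj_pow_one hx)) with h' | h'
      · rw [← e3] at h'
        exact H.zp_absurd hx hx1 hz2 hz1 (w_P84_8 hx hz2 h8' e2 h')
      · rw [← e3] at h'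
        exact H.zp_absurd hx hx1 hz2 hz1 (w_P84_9 hx hz2 h8' e2 h')
    · have e4 := w_P94 hx hz2 h9' e2
      obtain ⟨f1, f2⟩ := a4_left hx hz2 e4
      have e5 : (z * a) ^ 4 = 1 := by
        rw [show 4 = 2 * 2 by norm_num, pow_mul, e1]
        have : z * x⁻¹ * z * x = x * z * x⁻¹ := by
          rw [← f1]; group
        rw [this]; exact conj_pow_one hz2
      exact H.zp_absurd hx hx1 ha ha1 (w_P88c hz hx ha h8 hc e4 e5)
  · refine hno (exists_inverted ha (inverts_mul ha hz2) h ?_)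
    intro h1
    have := eq_inv_of_mul_eq_one_left h1
    rw [ia] at this
    exact za this

/-- The Pair Lemma. -/
theorem pair {x a : G} (hx : x ^ 3 = 1) (hx1 : x ≠ 1) (ha : a ^ 2 = 1) (ha1 : a ≠ 1) :
    (x * a) ^ 3 = 1 ∨ ∃ y : G, y ^ 3 = 1 ∧ y ≠ 1 ∧ a * y * a = y⁻¹ := by
  have ia := inv_of_sq ha
  rcases H.mul x a (Or.inr hx) (Or.inl (pow_four_of_sq ha)) with h | h
  · right; exact H.pair8 hx hx1 ha ha1 h
  · by_cases h1 : (x * a) ^ 3 = 1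
    · left; exact h1
    right
    have hxi : (x * a * x⁻¹) ^ 2 = 1 := conj_pow_one ha
    rcases H.invol_mul hxi ha with hc | hc
    · have hu : ((x * a) ^ 3 * a) ^ 8 = 1 := by
        have : (x * a) ^ 3 * a = x * (x * a * x⁻¹ * a)⁻¹ * x⁻¹ := by
          simp [pow_succ, mul_assoc, sq_self ha, ia, cube_sq_inv hx]
        rw [this, conj_pow, inv_pow, hc]; group
      exact H.pair8 (by rw [← pow_mul, h]) h1 ha ha1 hu
    · refine exists_inverted ha (inverts_mul ha hxi) hc ?_
      intro h1
      have := eq_inv_of_mul_eq_one_left h1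
      rw [ia] at this
      refine H.comm_absurd ha ha1 hx hx1 ?_
      change a * x = x * a
      calc a * x = x * a * x⁻¹ * x := by rw [this]
        _ = x * a := by group

/-- Lemma L. -/
theorem lemL {y j z : G} (hy : y ^ 3 = 1) (hy1 : y ≠ 1) (hj : j ^ 2 = 1) (hj1 : j ≠ 1)
    (hjy : j * y * j = y⁻¹) (hz : z ^ 2 = 1) (c : Commute j z) :
    (y * z) ^ 3 = 1 ∨ (y * j * z) ^ 3 = 1 := by
  obtain ⟨i, hi⟩ : ∃ i, i = y * j := ⟨_, rfl⟩
  have hi2 : i ^ 2 = 1 := by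
    rw [hi, sq, show y * j * (y * j) = y * (j * y * j) by group, hjy]; group
  have hij : i * j = y := by rw [hi, mul_assoc, ← sq, hj, mul_one]
  have h1 : (i * j) ^ 3 = 1 := by rw [hij, hy]
  have hjz : (j * z) ^ 2 = 1 := by rw [c.mul_pow, hj, hz, one_mul]
  have hzj : (z * j) ^ 2 = 1 := by rw [c.symm.mul_pow, hj, hz, one_mul]
  have e : i * z * i * z * j = (i * z * i⁻¹) * (z * j) := by
    rw [inv_of_sq hi2]; group
  have h5 : (i * z * i * z * j) ^ 8 = 1 ∨ (i * z * i * z * j) ^ 9 = 1 := by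
    rw [e]; exact H.invol_mul (conj_pow_one hz) hzj
  rw [← hi, show y * z = i * j * z by rw [hij]]
  have hm : (i * j * z) ^ 8 = 1 ∨ (i * j * z) ^ 9 = 1 :=
    H.mul _ _ (Or.inr h1) (Or.inl (pow_four_of_sq hz))
  have fin3 : ∀ g : G, i * j ∈ Subgroup.zpowers g → g ^ 8 = 1 → False := by
    intro g hg h8
    have := pow_of_mem_zpowers hg h8
    rw [hij] at this
    exact hy1 (eq_one_of_coprime (by norm_num) this hy)
  have fin2 : ∀ g : G, i * j * i ∈ Subgroup.zpowers g → g ^ 9 = 1 → False := by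
    intro g hg h9
    have := pow_of_mem_zpowers hg h9
    have h2 : (i * j * i) ^ 2 = 1 := by
      have := conj_pow_one (h := i) hj
      rwa [inv_of_sq hi2] at this
    have := eq_one_of_coprime (by norm_num) this h2
    apply hj1
    have h3 : i * j * i⁻¹ = 1 := by rw [inv_of_sq hi2, this]
    simpa using h3
  rcases H.invol_mul hi2 hz with hn | hn <;> rcases hm with hm | hm
  · exfalso
    rcases h5 with h5 | h5
    · exact fin3 _ (w_L88_8 hi2 hj hz h1 hjz hn hm h5) hn
    · exact fin3 _ (w_L88_9 hi2 hj hz h1 hjz hn hm h5) hm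
  · left; exact w_L89 hi2 hj hz h1 hjz hn hm
  · right
    have e2 : i * j * (j * z) = i * z := by rw [mul_assoc, sq_cancel hj]
    have := w_L89 (z := j * z) hi2 hj hjz h1 (by rw [sq_cancel hj, hz])
      (by rw [← mul_assoc]; exact hm) (by rw [e2]; exact hn)
    rwa [e2] at this
  · exfalso
    rcases h5 with h5 | h5
    · exact fin2 _ (w_L99_8 hi2 hj hz h1 hjz hn hm h5) hn
    · exact fin2 _ (w_L99_9 hi2 hj hz h1 hjz hn hm h5) hn

theorem kill {h f g : G} (hh : h ^ 3 = 1) (hh1 : h ≠ 1) (hf : f ^ 2 = 1) (hg : g ^ 2 = 1)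
    (h1 : (h * f) ^ 3 = 1) (h2 : (h * g) ^ 3 = 1) (h3 : (f * g) ^ 4 = 1)
    (h4 : (f * g * f * g * h) ^ 2 = 1) : False := by
  have hm : h ∈ Subgroup.zpowers (f * g) := by
    rcases H.mul (h * f) g (Or.inr h1) (Or.inl (pow_four_of_sq hg)) with h5 | h5
    · exact w_K8 hh hf hg h1 h2 h3 h4 h5
    · exact w_K9 hh hf hg h1 h2 h3 h4 h5
  exact hh1 (eq_one_of_coprime (by norm_num) (pow_of_mem_zpowers hm h3) hh)

theorem f3a {e t y : G} (he : e ^ 2 = 1) (he1 : e ≠ 1) (ht : t ^ 3 = 1)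
    (hte : (t * e) ^ 3 = 1) (hy : y ^ 3 = 1) (hy1 : y ≠ 1) (hey : e * y * e = y⁻¹)
    (hye : (y * (t⁻¹ * e * t)) ^ 3 = 1) : False := by
  have ie := inv_of_sq he
  obtain ⟨A1, A2⟩ := a4_left ht he hte
  obtain ⟨e1, de1⟩ : ∃ e1, e1 = t⁻¹ * e * t := ⟨_, rfl⟩
  obtain ⟨f, df⟩ : ∃ f, f = t * e * t⁻¹ := ⟨_, rfl⟩
  rw [← de1, ← df] at A1 A2
  rw [← de1] at hye
  have he12 : e1 ^ 2 = 1 := by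
    rw [de1]; simpa using conj_pow_one (h := t⁻¹) he
  have he11 : e1 ≠ 1 := by
    rw [de1]; simpa using conj_ne_one (h := t⁻¹) he1
  have hf2 : f ^ 2 = 1 := by rw [df]; exact conj_pow_one he
  obtain ⟨h, dh⟩ : ∃ h, h = t⁻¹ * y * t := ⟨_, rfl⟩
  have hh3 : h ^ 3 = 1 := by rw [dh]; simpa using conj_pow_one (h := t⁻¹) hy
  have hh1 : h ≠ 1 := by rw [dh]; simpa using conj_ne_one (h := t⁻¹) hy1
  have he1h : e1 * h * e1 = h⁻¹ := by
    rw [de1, dh, show t⁻¹ * e * t * (t⁻¹ * y * t) * (t⁻¹ * e * t) = t⁻¹ * (e * y * e) * t by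
      group, hey]; group
  have hhf : (h * f) ^ 3 = 1 := by
    have : h * f = t⁻¹ * (y * e1) * t⁻¹⁻¹ := by
      rw [dh, df, de1]; simp [mul_assoc, cube_cancel ht, cube_sq ht]
    rw [this, conj_pow, hye]; group
  obtain ⟨B1, B2⟩ := a4_left hy he12 hye
  obtain ⟨w, dw⟩ : ∃ w, w = y⁻¹ * e1 * y := ⟨_, rfl⟩
  rw [← dw] at B1 B2
  have hw2 : w ^ 2 = 1 := by rw [dw]; simpa using conj_pow_one (h := y⁻¹) he12
  have cw : Commute e1 w := by rw [commute_iff_eq, B1, B2]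
  have ce : Commute e e1 := by rw [commute_iff_eq, A1, A2]
  have hyi : e * y⁻¹ * e = y := by
    have := congrArg (·⁻¹) hey
    simpa [ie, mul_assoc] using this
  have ewe : e * w * e = w * e1 := by
    rw [B2, dw]
    calc e * (y⁻¹ * e1 * y) * e = (e * y⁻¹ * e) * (e * e1 * e) * (e * y * e) := by
          simp only [mul_assoc, sq_cancel he]
      _ = _ := by rw [hyi, hey, ce.eq]; simp only [mul_assoc, ← sq, he, mul_one]
  have fwfw : f * w * f * w = e1 := by
    calc f * w * f * w = (e1 * e) * w * (e * e1) * w := by rw [A1, A2]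
      _ = e1 * (e * w * e) * e1 * w := by group
      _ = e1 * (w * e1) * e1 * w := by rw [ewe]
      _ = e1 := by
        simp only [mul_assoc, sq_cancel he12]; rw [← sq, hw2, mul_one]
  have cf : Commute f e1 := by rw [← A1]; exact ce.mul_left (Commute.refl _)
  have main : ∀ g : G, g ^ 2 = 1 → f * g * f * g = e1 → (h * g) ^ 3 = 1 → False := by
    intro g hg hfg hhg
    have e4 : (f * g) ^ 4 = 1 := by
      rw [show 4 = 2 * 2 by norm_num, pow_mul, sq (f * g), ← mul_assoc, hfg, he12]
    refine H.kill hh3 hh1 hf2 hg hhf hhg e4 ?_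
    rw [hfg, sq, show e1 * h * (e1 * h) = (e1 * h * e1) * h by group, he1h]; group
  rcases H.lemL hh3 hh1 he12 he11 he1h hw2 cw with h' | h'
  · exact main w hw2 fwfw h'
  · refine main (e1 * w) (by rw [cw.mul_pow, he12, hw2, one_mul]) ?_ (by
      rw [← mul_assoc]; exact h')
    calc f * (e1 * w) * f * (e1 * w) = (f * e1) * (w * f) * (e1 * w) := by group
      _ = e1 * f * (w * f) * (w * e1) := by rw [cf.eq, cw.eq]
      _ = e1 * (f * w * f * w) * e1 := by group
      _ = e1 := by rw [fwfw, mul_assoc, ← sq, he12, mul_one]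

/-- An involution `e` with `(t e)^3 = 1` inverts no element of order 3. -/
theorem f3 {e t y : G} (he : e ^ 2 = 1) (he1 : e ≠ 1) (ht : t ^ 3 = 1)
    (hte : (t * e) ^ 3 = 1) (hy : y ^ 3 = 1) (hy1 : y ≠ 1) (hey : e * y * e = y⁻¹) :
    False := by
  obtain ⟨A1, A2⟩ := a4_left ht he hte
  have he12 : (t⁻¹ * e * t) ^ 2 = 1 := by simpa using conj_pow_one (h := t⁻¹) he
  rcases H.lemL hy hy1 he he1 hey he12 (by rw [commute_iff_eq, A1, A2]) with h | h
  · exact H.f3a he he1 ht hte hy hy1 hey h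
  · rw [mul_assoc, A1] at h
    refine H.f3a (t := t⁻¹) he he1 (by rw [inv_pow, ht, inv_one]) (a4_inv he hte) hy hy1 hey ?_
    rwa [inv_inv]

theorem f3' {e t y : G} (he : e ^ 2 = 1) (he1 : e ≠ 1) (ht : t ^ 3 = 1)
    (hte : (t * e) ^ 3 = 1) (hy : y ^ 3 = 1) : (y * e) ^ 3 = 1 ∧ y * e ≠ 1 ∨ y = 1 := by
  by_cases hy1 : y = 1
  · exact Or.inr hy1
  left
  constructor
  · rcases H.pair hy hy1 he he1 with h | ⟨z, hz, hz1, hez⟩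
    · exact h
    · exact (H.f3 he he1 ht hte hz hz1 hez).elim
  · intro h
    have : y = e := by rw [eq_inv_of_mul_eq_one_left h, inv_of_sq he]
    rw [this] at hy hy1
    exact hy1 (eq_one_of_coprime (by norm_num) he hy)

end HH
end basics


/-! ### Case B: no involution acts on an element of order 3 as in `A4` -/

/-- Case B hypotheses. -/
structure HB (G : Type*) [Group G] : Prop extends HH G where
  nE : ∀ e t : G, e ^ 2 = 1 → e ≠ 1 → t ^ 3 = 1 → t ≠ 1 → (t * e) ^ 3 ≠ 1
  exX : ∃ x : G, x ^ 3 = 1 ∧ x ≠ 1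

theorem exists_sq_power {G : Type*} [Group G] {m : G} : ∀ n : ℕ, m ^ (2 ^ n) = 1 →
    m ^ 2 ≠ 1 → ∃ k : ℕ, (m ^ k) ^ 4 = 1 ∧ (m ^ k) ^ 2 ≠ 1 := by
  intro n
  induction n with
  | zero => intro h h2; simp at h; simp [h] at h2
  | succ n ih =>
    intro h h2
    by_cases h3 : m ^ (2 ^ n) = 1
    · exact ih h3 h2
    · rcases n with _ | n
      · simp at h; exact (h2 h).elim
      · refine ⟨2 ^ n, ?_, ?_⟩
        · rw [← pow_mul, ← h]; congr 1; ring
        · rw [← pow_mul]; intro h4; exact h3 (by rw [← h4]; congr 1)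

theorem exists_invol_power {G : Type*} [Group G] {m : G} : ∀ n : ℕ, m ^ (2 ^ n) = 1 →
    m ≠ 1 → ∃ k : ℕ, (m ^ k) ^ 2 = 1 ∧ m ^ k ≠ 1 := by
  intro n
  induction n with
  | zero => intro h h2; simp at h; exact (h2 h).elim
  | succ n ih =>
    intro h h2
    by_cases h3 : m ^ (2 ^ n) = 1
    · exact ih h3 h2
    · refine ⟨2 ^ n, ?_, h3⟩
      rw [← pow_mul, ← h]; congr 1

theorem exists_three_power {G : Type*} [Group G] {k : G} (h9 : k ^ 9 = 1) (h1 : k ≠ 1) :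
    ∃ m : ℕ, (k ^ m) ^ 3 = 1 ∧ k ^ m ≠ 1 := by
  by_cases h3 : k ^ 3 = 1
  · exact ⟨1, by simpa using h3, by simpa using h1⟩
  · exact ⟨3, by rw [← pow_mul, h9], h3⟩

namespace HB
variable {G : Type*} [Group G] (H : HB G)
include H

theorem exInv {a : G} (ha : a ^ 2 = 1) (ha1 : a ≠ 1) :
    ∃ y : G, y ^ 3 = 1 ∧ y ≠ 1 ∧ a * y * a = y⁻¹ := by
  obtain ⟨x, hx, hx1⟩ := H.exX
  rcases H.toHH.pair hx hx1 ha ha1 with h | h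
  · exact (H.nE a x ha ha1 hx hx1 h).elim
  · exact h

theorem comm_eq {a b : G} (ha : a ^ 2 = 1) (ha1 : a ≠ 1) (hb : b ^ 2 = 1) (hb1 : b ≠ 1)
    (c : Commute a b) : a = b := by
  obtain ⟨y, hy, hy1, hay⟩ := H.exInv ha ha1
  rcases H.toHH.lemL hy hy1 ha ha1 hay hb c with h | h
  · exact (H.nE b y hb hb1 hy hy1 h).elim
  · by_contra hne
    refine H.nE (a * b) y (by rw [c.mul_pow, ha, hb, one_mul]) ?_ hy hy1 (by
      rw [← mul_assoc]; exact h)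
    intro h1
    exact hne (by rw [eq_inv_of_mul_eq_one_left h1, inv_of_sq hb])

theorem mul_nine {a b : G} (ha : a ^ 2 = 1) (ha1 : a ≠ 1) (hb : b ^ 2 = 1) (hb1 : b ≠ 1) :
    (a * b) ^ 9 = 1 := by
  rcases H.toHH.invol_mul ha hb with h | h
  · by_cases hd : a * b = 1
    · rw [hd, one_pow]
    exfalso
    have hinv : a * (a * b) * a = (a * b)⁻¹ := by
      rw [mul_inv_rev, inv_of_sq ha, inv_of_sq hb, sq_cancel ha]
    obtain ⟨k, hk2, hk1⟩ := exists_invol_power (m := a * b) 3 (by simpa using h) hd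
    have hki := inverts_pow ha hinv k
    rw [inv_of_sq hk2] at hki
    have c : Commute a ((a * b) ^ k) := by
      rw [commute_iff_eq]
      nth_rewrite 2 [← hki]
      rw [mul_assoc, ← sq, ha, mul_one]
    have e := H.comm_eq ha ha1 hk2 hk1 c
    have c2 : Commute a (a * b) := by
      nth_rewrite 1 [e]; exact (Commute.refl _).pow_left k
    have c3 : Commute a b := by
      have := (Commute.refl a).inv_right.mul_right c2
      simpa using this
    have := H.comm_eq ha ha1 hb hb1 c3
    rw [← this, ← sq] at hd
    exact hd ha
  · exact h

/-- The Lemma `Inv`. -/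
theorem inv_dec {a : G} (ha : a ^ 2 = 1) (ha1 : a ≠ 1) (c : G) :
    ∃ s, s = (c * a * c⁻¹ * a) ^ 5 ∧ s ^ 9 = 1 ∧ a * s * a = s⁻¹ ∧ Commute (s⁻¹ * c) a := by
  have hca : (c * a * c⁻¹) ^ 2 = 1 := conj_pow_one ha
  have h9 := H.mul_nine hca (conj_ne_one ha1) ha ha1
  obtain ⟨d, hd⟩ : ∃ d, d = c * a * c⁻¹ * a := ⟨_, rfl⟩
  rw [← hd] at h9 ⊢
  have hs := inverts_pow ha (by rw [hd]; exact inverts_mul ha hca : a * d * a = d⁻¹) 5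
  refine ⟨_, rfl, ?_, hs, ?_⟩
  · rw [← pow_mul, mul_comm, pow_mul, h9, one_pow]
  · have e1 : d ^ 5 * a * (d ^ 5)⁻¹ = c * a * c⁻¹ := by
      rw [← hs, show d ^ 5 * a * (a * d ^ 5 * a) = d ^ 5 * (a * (a * (d ^ 5 * a))) by group,
        sq_cancel ha, ← mul_assoc, ← pow_add, show 5 + 5 = 9 + 1 by norm_num, pow_succ, h9,
        one_mul, hd, mul_assoc, ← sq, ha, mul_one]
    rw [commute_iff_eq]
    have e2 : (d ^ 5)⁻¹ * (c * a * c⁻¹) * (d ^ 5) = a := by rw [← e1]; group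
    calc (d ^ 5)⁻¹ * c * a = (d ^ 5)⁻¹ * (c * a * c⁻¹) * (d ^ 5) * ((d ^ 5)⁻¹ * c) := by group
      _ = _ := by rw [e2]

theorem cent_inv {a y c : G} (ha : a ^ 2 = 1) (ha1 : a ≠ 1) (hy : y ^ 3 = 1) (hy1 : y ≠ 1)
    (hay : a * y * a = y⁻¹) (hc : Commute c y) : a * c * a = c⁻¹ := by
  obtain ⟨s, hs, _, hs2, hs3⟩ := H.inv_dec ha ha1 c
  have ia := inv_of_sq ha
  have ay : ∀ t : G, t * y * t⁻¹ = y⁻¹ → t * y⁻¹ * t⁻¹ = y := by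
    intro t ht
    have := congrArg (·⁻¹) ht
    simpa [mul_assoc] using this
  have hay' : a * y * a⁻¹ = y⁻¹ := by rw [ia, hay]
  have hd : Commute (c * a * c⁻¹ * a) y := by
    rw [commute_iff_eq, ← mul_inv_eq_iff_eq_mul]
    calc c * a * c⁻¹ * a * y * (c * a * c⁻¹ * a)⁻¹
        = c * a * (c⁻¹ * (a * y * a⁻¹) * c) * a⁻¹ * c⁻¹ := by group
      _ = c * (a * y⁻¹ * a⁻¹) * c⁻¹ := by
        rw [hay', mul_assoc c⁻¹, ← (hc.inv_right).eq]; group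
      _ = y := by rw [ay a hay', hc.eq]; group
  have hsy : Commute s y := by rw [hs]; exact hd.pow_left 5
  have hv : Commute (s⁻¹ * c) y := hsy.inv_left.mul_left hc
  have : s⁻¹ * c = 1 := by
    rcases H.pe (s⁻¹ * c) with ⟨n, hn⟩ | ⟨n, hn⟩
    · rcases H.toHH.comm_cases (m := 1) hv hn (by simpa using hy) with h | h
      · exact h
      · exact (hy1 h).elim
    · rcases H.toHH.comm_cases (n := 1) hs3.symm (by simpa using ha) hn with h | h
      · exact (ha1 h).elim
      · exact h
  have e : s = c := inv_mul_eq_one.mp this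
  rw [← e]; exact hs2

theorem cent_comm {a y c d : G} (ha : a ^ 2 = 1) (ha1 : a ≠ 1) (hy : y ^ 3 = 1) (hy1 : y ≠ 1)
    (hay : a * y * a = y⁻¹) (hc : Commute c y) (hd : Commute d y) : Commute c d := by
  have h1 := H.cent_inv ha ha1 hy hy1 hay hc
  have h2 := H.cent_inv ha ha1 hy hy1 hay hd
  have h3 := H.cent_inv ha ha1 hy hy1 hay (hc.mul_left hd)
  have h4 : a * (c * d) * a = (a * c * a) * (a * d * a) := by
    simp only [mul_assoc, sq_cancel ha]
  rw [h1, h2, h3, ← mul_inv_rev, inv_inj] at h4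
  exact h4

theorem mul_inv_nine {a y w : G} (ha : a ^ 2 = 1) (ha1 : a ≠ 1) (hy : y ^ 9 = 1)
    (hay : a * y * a = y⁻¹) (hw : w ^ 9 = 1) (haw : a * w * a = w⁻¹) : (y * w) ^ 9 = 1 := by
  have e : y * w = (y * a) * (a * w) := by simp only [mul_assoc, sq_cancel ha]
  have n1 : ∀ u : G, u ^ 9 = 1 → u ≠ a := by
    rintro u hu rfl
    exact ha1 (eq_one_of_coprime (by norm_num) ha hu)
  rw [e]
  apply H.mul_nine
  · rw [sq, show y * a * (y * a) = y * (a * y * a) by group, hay]; group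
  · intro h; exact n1 y hy (by rw [eq_inv_of_mul_eq_one_left h, inv_of_sq ha])
  · rw [sq, show a * w * (a * w) = a * w * a * w by group, haw]; group
  · intro h; exact n1 w hw (by rw [eq_inv_of_mul_eq_one_right h, inv_of_sq ha])

theorem four_comm {f y : G} (hf : f ^ 4 = 1) (hf2 : f ^ 2 ≠ 1) (hy : y ^ 3 = 1) (hy1 : y ≠ 1)
    (hay : f ^ 2 * y * f ^ 2 = y⁻¹) : Commute y (f⁻¹ * y * f) := by
  have ha : (f ^ 2) ^ 2 = 1 := by rw [← pow_mul, hf]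
  have nine : ∀ u : G, u ^ 3 = 1 → u ^ 9 = 1 := by
    intro u hu; rw [show 9 = 3 * 3 by norm_num, pow_mul, hu, one_pow]
  have hyi : f ^ 2 * y⁻¹ * f ^ 2 = y⁻¹⁻¹ := by
    have := congrArg (·⁻¹) hay
    simpa only [mul_inv_rev, inv_of_sq ha, ← mul_assoc] using this
  have hw3 : (f⁻¹ * y * f) ^ 3 = 1 := by simpa using conj_pow_one (h := f⁻¹) hy
  have hw : f ^ 2 * (f⁻¹ * y * f) * f ^ 2 = (f⁻¹ * y * f)⁻¹ := by
    rw [show f ^ 2 * (f⁻¹ * y * f) * f ^ 2 = f⁻¹ * (f ^ 2 * y * f ^ 2) * f by group, hay]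
    group
  have h1 : (f * f * y) ^ 2 = 1 := by
    rw [← sq f, sq (f ^ 2 * y), ← mul_assoc, hay]; group
  have h2 : (y * f⁻¹ * y * f) ^ 9 = 1 := by
    have := H.mul_inv_nine ha hf2 (nine _ hy) hay (nine _ hw3) hw
    simpa only [mul_assoc] using this
  have h3 : (y⁻¹ * f⁻¹ * y * f) ^ 9 = 1 := by
    have := H.mul_inv_nine ha hf2 (nine _ (by rw [inv_pow, hy, inv_one])) hyi (nine _ hw3) hw
    simpa only [mul_assoc] using this
  rcases H.mul f y (Or.inl hf) (Or.inr hy) with h | h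
  · exact w_FY8 hf hy h1 h2 h3 h
  · exfalso
    have c := commute_of_mem_zpowers (w_FY9 hf hy h1 h2 h3 h)
    have c2 : Commute y f := by
      have := c.mul_right (Commute.refl y).inv_right
      simpa using this
    exact H.toHH.comm_absurd ha hf2 hy hy1 (c2.pow_right 2).symm

theorem four_mul {f b : G} (hf : f ^ 4 = 1) (hf2 : f ^ 2 ≠ 1) (hb : b ^ 2 = 1) (hb1 : b ≠ 1) :
    (f * b) ^ 4 = 1 ∧ (f * b) ^ 2 ≠ 1 := by
  have ha : (f ^ 2) ^ 2 = 1 := by rw [← pow_mul, hf]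
  obtain ⟨a, da⟩ : ∃ a, a = f ^ 2 := ⟨_, rfl⟩
  rw [← da] at ha
  have ha1 : a ≠ 1 := by rwa [da]
  obtain ⟨k, dk⟩ : ∃ k, k = a * b := ⟨_, rfl⟩
  have k9 : k ^ 9 = 1 := by rw [dk]; exact H.mul_nine ha ha1 hb hb1
  have ak : a * k * a = k⁻¹ := by
    rw [dk, mul_inv_rev, inv_of_sq ha, inv_of_sq hb, sq_cancel ha]
  have hk9 : (f⁻¹ * k * f) ^ 9 = 1 := by simpa using conj_pow_one (h := f⁻¹) k9
  have cfa : Commute f a := by rw [da]; exact (Commute.refl f).pow_right 2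
  have hak : a * (f⁻¹ * k * f) * a = (f⁻¹ * k * f)⁻¹ := by
    calc a * (f⁻¹ * k * f) * a = (a * f⁻¹) * k * (f * a) := by group
      _ = (f⁻¹ * a) * k * (a * f) := by rw [cfa.eq, cfa.inv_left.eq]
      _ = f⁻¹ * (a * k * a) * f := by group
      _ = _ := by rw [ak]; group
  have hcomm : Commute k (f⁻¹ * k * f) := by
    by_cases hk1 : k = 1
    · rw [hk1]; exact Commute.one_left _
    obtain ⟨m, hm3, hm1⟩ := exists_three_power k9 hk1
    obtain ⟨y, dy⟩ : ∃ y, y = k ^ m := ⟨_, rfl⟩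
    rw [← dy] at hm3 hm1
    have ay : a * y * a = y⁻¹ := by rw [dy]; exact inverts_pow ha ak m
    have c1 : Commute y (f⁻¹ * y * f) := H.four_comm hf hf2 hm3 hm1 (by rw [← da]; exact ay)
    have c2 : Commute k y := by rw [dy]; exact (Commute.refl k).pow_right m
    have c3 : Commute k (f⁻¹ * y * f) := H.cent_comm ha ha1 hm3 hm1 ay c2 c1.symm
    have c4 : Commute (f⁻¹ * k * f) (f⁻¹ * y * f) := by
      rw [commute_iff_eq]
      calc f⁻¹ * k * f * (f⁻¹ * y * f) = f⁻¹ * (k * y) * f := by group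
        _ = f⁻¹ * (y * k) * f := by rw [c2.eq]
        _ = _ := by group
    refine H.cent_comm ha ha1 (y := f⁻¹ * y * f) (by simpa using conj_pow_one (h := f⁻¹) hm3)
      (by simpa using conj_ne_one (h := f⁻¹) hm1) ?_ c3 c4
    calc a * (f⁻¹ * y * f) * a = (a * f⁻¹) * y * (f * a) := by group
      _ = (f⁻¹ * a) * y * (a * f) := by rw [cfa.eq, cfa.inv_left.eq]
      _ = f⁻¹ * (a * y * a) * f := by group
      _ = _ := by rw [ay]; group
  have e : (f * b) ^ 2 = a * ((f⁻¹ * k * f)⁻¹ * k) := by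
    have hb' : b = a * k := by rw [dk, sq_cancel ha]
    have hfa : f * a = f⁻¹ := by
      rw [eq_inv_iff_mul_eq_one, da, ← hf]; group
    calc (f * b) ^ 2 = (f * a) * k * (f * a) * k := by rw [hb', sq]; group
      _ = (f⁻¹ * k * f) * (f ^ 2)⁻¹ * k := by rw [hfa]; group
      _ = (a * a) * (f⁻¹ * k * f) * a * k := by rw [← da, inv_of_sq ha, ← sq, ha, one_mul]
      _ = a * (a * (f⁻¹ * k * f) * a) * k := by group
      _ = _ := by rw [hak]; group
  have hm9 : ((f⁻¹ * k * f)⁻¹ * k) ^ 9 = 1 := by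
    rw [(hcomm.symm.inv_left).mul_pow, inv_pow, hk9, k9, inv_one, one_mul]
  have hminv : a * ((f⁻¹ * k * f)⁻¹ * k) * a = ((f⁻¹ * k * f)⁻¹ * k)⁻¹ := by
    have h1 : a * (f⁻¹ * k * f)⁻¹ * a = (f⁻¹ * k * f) := by
      have := congrArg (·⁻¹) hak
      simpa only [mul_inv_rev, inv_of_sq ha, ← mul_assoc, inv_inv] using this
    calc a * ((f⁻¹ * k * f)⁻¹ * k) * a = (a * (f⁻¹ * k * f)⁻¹ * a) * (a * k * a) := by
          simp only [mul_assoc, sq_cancel ha]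
      _ = (f⁻¹ * k * f) * k⁻¹ := by rw [h1, ak]
      _ = k⁻¹ * (f⁻¹ * k * f) := by rw [hcomm.symm.inv_right.eq]
      _ = _ := by group
  constructor
  · rw [show 4 = 2 * 2 by norm_num, pow_mul, e, sq, ← mul_assoc, hminv]; group
  · rw [e]
    intro h
    have := eq_inv_of_mul_eq_one_right h
    rw [inv_of_sq ha] at this
    rw [this] at hm9
    exact ha1 (eq_one_of_coprime (by norm_num) ha hm9)

end HB


/-! ### Locally finite groups -/

def LFG (G : Type*) [Group G] : Prop := ∀ S : Subgroup G, S.FG → Finite S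

section LF
variable {G Q : Type*} [Group G] [Group Q]

theorem LFG.of_comm (hc : ∀ x y : G, x * y = y * x) (ht : ∀ x : G, ∃ n : ℕ, 0 < n ∧ x ^ n = 1) :
    LFG G := by
  intro S hS
  have : Group.FG S := (Group.fg_iff_subgroup_fg S).mpr hS
  let _ : CommGroup S := { (inferInstance : Group S) with
    mul_comm := fun x y => Subtype.ext (hc x y) }
  apply CommGroup.finite_of_fg_torsion
  intro x
  obtain ⟨n, hn, h⟩ := ht x
  exact isOfFinOrder_iff_pow_eq_one.mpr ⟨n, hn, Subtype.ext (by simpa using h)⟩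

theorem LFG.of_finite [Finite G] : LFG G := fun S _ => inferInstance

theorem fg_map' (f : G →* Q) {S : Subgroup G} (hS : S.FG) : (S.map f).FG := by
  classical
  obtain ⟨t, rfl⟩ := hS
  exact ⟨t.image f, by rw [MonoidHom.map_closure]; simp⟩

theorem LFG.of_injective (f : G →* Q) (hf : Function.Injective f) (h : LFG Q) : LFG G := by
  intro S hS
  have := h _ (fg_map' f hS)
  exact Finite.of_equiv _ (S.equivMapOfInjective f hf).symm.toEquiv

theorem LFG.of_surjective (f : G →* Q) (hf : Function.Surjective f) (h : LFG G) : LFG Q := by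
  classical
  intro S hS
  obtain ⟨t, rfl⟩ := hS
  have e : (Subgroup.closure ((t.image (Function.surjInv hf) : Finset G) : Set G)).map f
      = Subgroup.closure (t : Set Q) := by
    rw [MonoidHom.map_closure]
    congr 1
    ext q
    simp [Function.surjInv_eq]
  rw [← e]
  have := h (Subgroup.closure ((t.image (Function.surjInv hf) : Finset G) : Set G)) ⟨_, rfl⟩
  exact Finite.of_surjective _ (f.subgroupMap_surjective
    (Subgroup.closure ((t.image (Function.surjInv hf) : Finset G) : Set G)))

theorem LFG.ext (f : G →* Q) (hk : LFG f.ker) (hq : LFG Q) : LFG G := by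
  intro S hS
  have hfin : Finite (S.map f) := hq _ (fg_map' f hS)
  have : Group.FG S := (Group.fg_iff_subgroup_fg S).mpr hS
  let g : S →* S.map f := f.subgroupMap S
  have hg : Function.Surjective g := f.subgroupMap_surjective S
  have hq' : Finite (S ⧸ g.ker) :=
    Finite.of_equiv _ (QuotientGroup.quotientKerEquivOfSurjective g hg).symm.toEquiv
  have hfi : g.ker.FiniteIndex := Subgroup.finiteIndex_of_finite_quotient
  have hkg : Group.FG g.ker := Subgroup.fg_of_index_ne_zero g.ker
  let i : g.ker →* f.ker :=
    { toFun := fun x => ⟨x.1.1, by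
        have := x.2
        rw [MonoidHom.mem_ker] at this ⊢
        exact congrArg Subtype.val this⟩
      map_one' := rfl
      map_mul' := fun _ _ => rfl }
  have hi : Function.Injective i := by
    intro x y hxy
    have h := congrArg (fun q : f.ker => (q : G)) hxy
    exact Subtype.ext (Subtype.ext h)
  have hkf : Finite g.ker := by
    have h1 : LFG g.ker := LFG.of_injective i hi hk
    have := h1 ⊤ (Group.fg_def.mp hkg)
    exact Finite.of_equiv _ Subgroup.topEquiv.toEquiv
  exact Finite.of_equiv _ (Subgroup.groupEquivQuotientProdSubgroup (s := g.ker)).symm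

theorem LFG.mono {A B : Subgroup G} (hAB : A ≤ B) (h : LFG B) : LFG A :=
  LFG.of_injective (Subgroup.inclusion hAB) (Subgroup.inclusion_injective hAB) h

/-- extension in terms of a subgroup and a map whose kernel meets it in an LF subgroup -/
theorem LFG.sub_ext (f : G →* Q) (A : Subgroup G) (hk : LFG f.ker) (hq : LFG (A.map f)) :
    LFG A := by
  refine LFG.ext (f.subgroupMap A) ?_ hq
  let i : (f.subgroupMap A).ker →* f.ker :=
    { toFun := fun x => ⟨x.1.1, by
        have := x.2
        rw [MonoidHom.mem_ker] at this ⊢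
        exact congrArg Subtype.val this⟩
      map_one' := rfl
      map_mul' := fun _ _ => rfl }
  exact LFG.of_injective i (fun x y hxy =>
    Subtype.ext (Subtype.ext (congrArg (fun q : f.ker => (q : G)) hxy))) hk

theorem LFG.map (f : G →* Q) {A : Subgroup G} (h : LFG A) : LFG (A.map f) :=
  LFG.of_surjective (f.subgroupMap A) (f.subgroupMap_surjective A) h

theorem LFG.sup {A B : Subgroup G} [A.Normal] (hA : LFG A) (hB : LFG B) :
    LFG (A ⊔ B : Subgroup G) := by
  refine LFG.sub_ext (QuotientGroup.mk' A) _ (by rwa [QuotientGroup.ker_mk']) ?_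
  rw [Subgroup.map_sup, QuotientGroup.map_mk'_self, bot_sup_eq]
  exact hB.map _

/-- If every element lies in a normal LF subgroup then the group is LF. -/
theorem LFG.of_cover (h : ∀ g : G, ∃ A : Subgroup G, A.Normal ∧ g ∈ A ∧ LFG A) : LFG G := by
  classical
  have key : ∀ t : Finset G, ∃ A : Subgroup G, A.Normal ∧ (t : Set G) ⊆ A ∧ LFG A := by
    intro t
    induction t using Finset.induction_on with
    | empty => exact ⟨⊥, inferInstance, by simp, LFG.of_finite⟩
    | insert a s _ ih =>
      obtain ⟨A, hA1, hA2, hA3⟩ := ih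
      obtain ⟨B, hB1, hB2, hB3⟩ := h a
      refine ⟨A ⊔ B, inferInstance, ?_, hA3.sup hB3⟩
      rw [Finset.coe_insert, Set.insert_subset_iff]
      exact ⟨(le_sup_right : B ≤ A ⊔ B) hB2, fun x hx => (le_sup_left : A ≤ A ⊔ B) (hA2 hx)⟩
  intro S hS
  obtain ⟨t, rfl⟩ := hS
  obtain ⟨A, _, hA2, hA3⟩ := key t
  have hle : Subgroup.closure (t : Set G) ≤ A := (Subgroup.closure_le A).mpr hA2
  have h1 : LFG (Subgroup.closure (t : Set G)) := hA3.mono hle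
  have := h1 ⊤ (Group.fg_def.mp ((Group.fg_iff_subgroup_fg _).mpr ⟨t, rfl⟩))
  exact Finite.of_equiv _ Subgroup.topEquiv.toEquiv

end LF


/-! ### Structure of `2`-groups with a unique involution -/

theorem zpow_zmod_iff {P : Type*} [Group P] {n : ℕ} {r : P} (hr : orderOf r = n) (a b : ℤ) :
    r ^ a = r ^ b ↔ (a : ZMod n) = (b : ZMod n) := by
  rw [zpow_eq_zpow_iff_modEq, hr, ZMod.intCast_eq_intCast_iff]

theorem inv_conj_zpow {P : Type*} [Group P] {r s : P} (hs : s * s = 1) (h : s * r * s = r⁻¹)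
    (a : ℤ) : r ^ a * s = s * r ^ (-a) := by
  have hs' : s⁻¹ = s := inv_eq_of_mul_eq_one_left hs
  have h1 : s * r ^ (-a) * s⁻¹ = r ^ a := by
    rw [← conj_zpow, hs', h, inv_zpow, zpow_neg, inv_inv]
  rw [← h1]; group

/-- Recognition of dihedral groups. -/
theorem dihedral_of {P : Type*} [Group P] (n : ℕ) [NeZero n] {r s : P} (hr : orderOf r = n)
    (hs : s * s = 1) (h : s * r * s = r⁻¹) (hn : ∀ k : ℤ, s ≠ r ^ k)
    (hall : ∀ p : P, ∃ k : ℤ, p = r ^ k ∨ p = s * r ^ k) :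
    Nonempty (P ≃* DihedralGroup n) := by
  have key := zpow_zmod_iff hr
  let F : DihedralGroup n → P := fun d => match d with
    | DihedralGroup.r i => r ^ (i.cast : ℤ)
    | DihedralGroup.sr i => s * r ^ (i.cast : ℤ)
  have Fr : ∀ i, F (DihedralGroup.r i) = r ^ (i.cast : ℤ) := fun _ => rfl
  have Fs : ∀ i, F (DihedralGroup.sr i) = s * r ^ (i.cast : ℤ) := fun _ => rfl
  have hadd : ∀ i j : ZMod n, r ^ ((i + j).cast : ℤ) = r ^ (i.cast : ℤ) * r ^ (j.cast : ℤ) := by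
    intro i j
    rw [← zpow_add, key]; simp
  have hsub : ∀ i j : ZMod n, r ^ ((j - i).cast : ℤ) = r ^ (-(i.cast : ℤ)) * r ^ (j.cast : ℤ) := by
    intro i j
    rw [← zpow_add, key]; push_cast; ring
  have hc := inv_conj_zpow hs h
  let f : DihedralGroup n →* P := MonoidHom.mk' F (by
    rintro (i | i) (j | j)
    · simp only [DihedralGroup.r_mul_r, Fr, hadd]
    · rw [DihedralGroup.r_mul_sr, Fs, Fr, Fs, hsub, ← mul_assoc, ← mul_assoc, hc]
    · rw [DihedralGroup.sr_mul_r, Fs, Fr, Fs, hadd, mul_assoc]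
    · rw [DihedralGroup.sr_mul_sr, Fs, Fr, Fs, hsub, mul_assoc, ← mul_assoc _ s, hc, mul_assoc,
        ← mul_assoc s, hs, one_mul])
  have hbij : Function.Bijective f := by
    constructor
    · rw [injective_iff_map_eq_one]
      rintro (i | i) hi
      · have h1 : r ^ (i.cast : ℤ) = r ^ (0 : ℤ) := by rw [zpow_zero]; exact hi
        rw [key] at h1
        simp at h1
        rw [h1, DihedralGroup.r_zero]
      · have h1 : s * r ^ (i.cast : ℤ) = 1 := hi
        exact (hn (-(i.cast : ℤ)) (by rw [zpow_neg]; exact eq_inv_of_mul_eq_one_left h1)).elim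
    · intro p
      obtain ⟨k, hk | hk⟩ := hall p
      · refine ⟨DihedralGroup.r k, ?_⟩
        change r ^ (((k : ZMod n)).cast : ℤ) = p
        rw [hk, key]; simp
      · refine ⟨DihedralGroup.sr k, ?_⟩
        change s * r ^ (((k : ZMod n)).cast : ℤ) = p
        rw [hk, mul_right_inj, key]; simp
  exact ⟨(MulEquiv.ofBijective f hbij).symm⟩

theorem locCyc_of_chain {P : Type*} [Group P]
    (h : ∀ p q : P, p ∈ Subgroup.zpowers q ∨ q ∈ Subgroup.zpowers p) (S : Subgroup P)
    (hS : S.FG) : IsCyclic S := by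
  classical
  have key : ∀ t : Finset P, ∃ g : P, Subgroup.closure (t : Set P) = Subgroup.zpowers g := by
    intro t
    induction t using Finset.induction_on with
    | empty => exact ⟨1, by simp⟩
    | insert a s _ ih =>
      obtain ⟨g, hg⟩ := ih
      rw [Finset.coe_insert, Set.insert_eq, Subgroup.closure_union, hg,
        ← Subgroup.zpowers_eq_closure]
      rcases h a g with h1 | h1
      · exact ⟨g, sup_eq_right.mpr (by rwa [Subgroup.zpowers_le])⟩
      · exact ⟨a, sup_eq_left.mpr (by rwa [Subgroup.zpowers_le])⟩
  obtain ⟨t, rfl⟩ := hS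
  obtain ⟨g, hg⟩ := key t
  rw [hg]; infer_instance

/-- `2`-group with a unique involution `z`. -/
structure TS (T : Type*) [Group T] (z : T) : Prop where
  h2 : ∀ t : T, ∃ n : ℕ, t ^ (2 ^ n) = 1
  z1 : z ≠ 1
  z2 : z ^ 2 = 1
  uniq : ∀ t : T, t ^ 2 = 1 → t = 1 ∨ t = z
  mul : ∀ u v : T, u ^ 4 = 1 → v ^ 4 = 1 → (u * v) ^ 8 = 1

namespace TS
variable {T : Type*} [Group T] {z : T} (H : TS T z)
include H

theorem central (t : T) : Commute t z := by
  rcases H.uniq (t * z * t⁻¹) (conj_pow_one H.z2) with h | h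
  · exact (conj_ne_one H.z1 h).elim
  · rw [commute_iff_eq, ← mul_inv_eq_iff_eq_mul]; exact h

theorem zz : z * z = 1 := by rw [← sq, H.z2]

theorem zinv : z⁻¹ = z := inv_of_sq H.z2

theorem level (t : T) (ht : t ≠ 1) : ∃ n : ℕ, t ^ (2 ^ n) = z := by
  obtain ⟨n, hn⟩ := H.h2 t
  induction n with
  | zero => exact (ht (by simpa using hn)).elim
  | succ n ih =>
    by_cases h : t ^ (2 ^ n) = 1
    · exact ih h
    · refine ⟨n, (H.uniq _ ?_).resolve_left h⟩
      rw [← pow_mul, ← pow_succ, hn]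

/-- inverse of an element of order 4 -/
theorem inv4 {u : T} (hu : u ^ 2 = z) : u⁻¹ = z * u := by
  rw [inv_eq_iff_mul_eq_one, (H.central u).symm.eq, ← mul_assoc, ← sq, hu, H.zz]

theorem pow4 {u : T} (hu : u ^ 2 = z) : u ^ 4 = 1 := by
  rw [show 4 = 2 * 2 by norm_num, pow_mul, hu, H.z2]

theorem inv_sq {u : T} (hu : u ^ 2 = z) : u⁻¹ ^ 2 = z := by rw [inv_pow, hu, H.zinv]

theorem ne_inv {u : T} (hu : u ^ 2 = z) : u ≠ u⁻¹ := by
  intro h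
  apply H.z1
  rw [← hu, sq]; nth_rewrite 2 [h]; group

theorem exists_four {d : T} (h1 : d ^ 2 ≠ 1) : ∃ k : ℕ, (d ^ k) ^ 2 = z := by
  obtain ⟨n, hn⟩ := H.h2 d
  obtain ⟨k, hk, hk2⟩ := exists_sq_power n hn h1
  exact ⟨k, (H.uniq _ (by rw [← pow_mul, hk])).resolve_left hk2⟩

/-- Case I induction. -/
theorem chain_level (S : Subgroup T)
    (h : ∀ u ∈ S, ∀ v ∈ S, u ^ 2 = z → v ^ 2 = z → v = u ∨ v = u⁻¹) (n : ℕ) :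
    ∀ u ∈ S, ∀ v ∈ S, u ^ (2 ^ n) = z → v ^ (2 ^ n) = z → u ∈ Subgroup.zpowers v := by
  induction n with
  | zero =>
    intro u _ v _ h1 h2
    have : u = v := by simpa using h1.trans h2.symm
    rw [this]; exact Subgroup.mem_zpowers v
  | succ n ih =>
    intro u hu v hv h1 h2
    have h1' : (u ^ 2) ^ (2 ^ n) = z := by rw [← pow_mul, ← h1, pow_succ, mul_comm]
    have h2' : (v ^ 2) ^ (2 ^ n) = z := by rw [← pow_mul, ← h2, pow_succ, mul_comm]
    obtain ⟨k, hk⟩ := ih _ (S.pow_mem hu 2) _ (S.pow_mem hv 2) h1' h2'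
    have hk : (v ^ 2) ^ k = u ^ 2 := hk
    obtain ⟨w, dw⟩ : ∃ w, w = v ^ k := ⟨_, rfl⟩
    have hw2 : w ^ 2 = u ^ 2 := by
      rw [← hk, dw, ← zpow_natCast, ← zpow_natCast, ← zpow_mul, ← zpow_mul, mul_comm]
    have hwS : w ∈ S := by rw [dw]; exact S.zpow_mem hv k
    have hwv : w ∈ Subgroup.zpowers v := ⟨k, dw.symm⟩
    have hzv : z ∈ Subgroup.zpowers v := by
      rw [← h2]; exact Subgroup.npow_mem_zpowers v _
    obtain ⟨d, dd⟩ : ∃ d, d = u * w⁻¹ := ⟨_, rfl⟩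
    have hud : u = d * w := by rw [dd]; group
    have hdS : d ∈ S := by rw [dd]; exact S.mul_mem hu (S.inv_mem hwS)
    have hwd : w * d * w⁻¹ = d⁻¹ := by
      calc w * d * w⁻¹ = w * u * (w ^ 2)⁻¹ := by rw [dd]; group
        _ = d⁻¹ := by rw [hw2, dd]; group
    have hd : d ^ 2 = 1 := by
      by_contra hd
      obtain ⟨m, hm⟩ := H.exists_four hd
      have hwm : w * d ^ m * w⁻¹ = (d ^ m)⁻¹ := by rw [← conj_pow, hwd, inv_pow]
      have hwz : (w ^ (2 ^ n)) ^ 2 = z := by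
        rw [← pow_mul, mul_comm, pow_mul, hw2, h1']
      have hcomm : Commute w (d ^ m) := by
        have h3 : Commute w (w ^ (2 ^ n)) := (Commute.refl w).pow_right _
        rcases h _ (S.pow_mem hdS m) _ (S.pow_mem hwS _) hm hwz with h4 | h4
        · rw [← h4]; exact h3
        · rw [h4] at h3; simpa using h3.inv_right
      rw [hcomm.eq, mul_inv_cancel_right] at hwm
      exact H.ne_inv hm hwm
    rw [hud]
    refine Subgroup.mul_mem _ ?_ hwv
    rcases H.uniq d hd with h | h
    · rw [h]; exact Subgroup.one_mem _
    · rw [h]; exact hzv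

theorem chain (S : Subgroup T)
    (h : ∀ u ∈ S, ∀ v ∈ S, u ^ 2 = z → v ^ 2 = z → v = u ∨ v = u⁻¹) {n m : ℕ} (hnm : n ≤ m)
    {u v : T} (hu : u ∈ S) (hv : v ∈ S) (h1 : u ^ (2 ^ n) = z) (h2 : v ^ (2 ^ m) = z) :
    u ∈ Subgroup.zpowers v := by
  have h3 := H.chain_level S h n u hu (v ^ (2 ^ (m - n))) (S.pow_mem hv _) h1 (by
    rw [← pow_mul, ← pow_add, Nat.sub_add_cancel hnm, h2])
  have : Subgroup.zpowers (v ^ (2 ^ (m - n))) ≤ Subgroup.zpowers v := by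
    rw [Subgroup.zpowers_le]; exact Subgroup.npow_mem_zpowers v _
  exact this h3

theorem chain_all (h : ∀ u v : T, u ^ 2 = z → v ^ 2 = z → v = u ∨ v = u⁻¹) (u v : T) :
    u ∈ Subgroup.zpowers v ∨ v ∈ Subgroup.zpowers u := by
  by_cases hu : u = 1
  · left; rw [hu]; exact Subgroup.one_mem _
  by_cases hv : v = 1
  · right; rw [hv]; exact Subgroup.one_mem _
  obtain ⟨n, hn⟩ := H.level u hu
  obtain ⟨m, hm⟩ := H.level v hv
  have h' : ∀ u ∈ (⊤ : Subgroup T), ∀ v ∈ (⊤ : Subgroup T), u ^ 2 = z → v ^ 2 = z →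
      v = u ∨ v = u⁻¹ := fun u _ v _ => h u v
  rcases le_total n m with hnm | hnm
  · left; exact H.chain ⊤ h' hnm trivial trivial hn hm
  · right; exact H.chain ⊤ h' hnm trivial trivial hm hn

/-- inverting relation is symmetric-ish: if `i` inverts `v` then `v i v⁻¹ = i (v²)⁻¹`. -/
theorem conj_of_inverts {i v : T} (h : i * v * i⁻¹ = v⁻¹) : v * i * v⁻¹ = i * (v ^ 2)⁻¹ := by
  have : v * i = i * v⁻¹ := by
    have h1 : i * v = v⁻¹ * i := by rw [← h]; group
    calc v * i = v * (i * v) * v⁻¹ := by group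
      _ = _ := by rw [h1]; group
  rw [this]; group

theorem inverts_symm {i j : T} (hj : j ^ 2 = z) (hi : i ^ 2 = z) (h : i * j * i⁻¹ = j⁻¹) :
    j * i * j⁻¹ = i⁻¹ := by
  rw [H.conj_of_inverts h, hj, H.zinv, H.inv4 hi, (H.central i).eq]

/-- for `i, k` of order 4 not generating the same subgroup -/
theorem pair_cases {i k : T} (hi : i ^ 2 = z) (hk : k ^ 2 = z) (h1 : k ≠ i) (h2 : k ≠ i⁻¹) :
    k * i * k⁻¹ = i⁻¹ ∨
      ((i * k) ^ 4 = z ∧ i * (i * k) * i⁻¹ = (i * k)⁻¹) := by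
  have hne : (i * k) ^ 2 ≠ 1 := by
    intro h
    rcases H.uniq _ h with h | h
    · exact h2 (eq_inv_of_mul_eq_one_right h)
    · apply h1
      have : i * k = i * i := by rw [h, ← sq, hi]
      exact mul_left_cancel this
  by_cases h4 : (i * k) ^ 4 = 1
  · left
    have hz : (i * k) ^ 2 = z :=
      (H.uniq _ (by rw [← pow_mul, h4])).resolve_left hne
    have e : k * i * k = i⁻¹ * z := by
      rw [← hz, sq]; group
    calc k * i * k⁻¹ = k * i * k * (k ^ 2)⁻¹ := by group
      _ = i⁻¹ := by rw [e, hk]; group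
  · right
    constructor
    · refine (H.uniq _ ?_).resolve_left h4
      rw [← pow_mul]; exact H.mul i k (H.pow4 hi) (H.pow4 hk)
    · rw [mul_inv_rev, H.inv4 hk, ← hi, sq]; group

theorem exists_inverter (hII : ¬ ∀ u v : T, u ^ 2 = z → v ^ 2 = z → v = u ∨ v = u⁻¹) {i : T}
    (hi : i ^ 2 = z) : ∃ j : T, j ^ 2 = z ∧ j * i * j⁻¹ = i⁻¹ := by
  have : ∃ k : T, k ^ 2 = z ∧ k ≠ i ∧ k ≠ i⁻¹ := by
    by_contra hcon
    push Not at hcon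
    apply hII
    have hc : ∀ k : T, k ^ 2 = z → k = i ∨ k = i⁻¹ := by
      intro k hk
      by_cases h : k = i
      · exact Or.inl h
      · exact Or.inr (hcon k hk h)
    intro u v hu hv
    rcases hc u hu with rfl | rfl <;> rcases hc v hv with rfl | rfl <;> simp
  obtain ⟨k, hk, h1, h2⟩ := this
  rcases H.pair_cases hi hk h1 h2 with h | ⟨h3, h4⟩
  · exact ⟨k, hk, h⟩
  · have hj : ((i * k) ^ 2) ^ 2 = z := by rw [← pow_mul, h3]
    refine ⟨(i * k) ^ 2, hj, H.inverts_symm hj hi ?_⟩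
    rw [← conj_pow, h4, inv_pow]

theorem cent_four {i k : T} (hi : i ^ 2 = z) (hk : k ^ 2 = z) (c : Commute i k) :
    k = i ∨ k = i⁻¹ := by
  have : (i * k) ^ 2 = 1 := by rw [c.mul_pow, hi, hk, H.zz]
  rcases H.uniq _ this with h | h
  · exact Or.inr (eq_inv_of_mul_eq_one_right h)
  · left
    have : i * k = i * i := by rw [h, ← sq, hi]
    exact mul_left_cancel this

theorem inverts_cent {i j c : T} (hi : i ^ 2 = z) (hj : j ^ 2 = z) (hji : j * i * j⁻¹ = i⁻¹)
    (hc : Commute c i) : j * c * j⁻¹ = c⁻¹ := by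
  have hgi : (j * c) * i * (j * c)⁻¹ = i⁻¹ := by
    calc (j * c) * i * (j * c)⁻¹ = j * (c * i) * c⁻¹ * j⁻¹ := by group
      _ = j * i * j⁻¹ := by rw [hc.eq]; group
      _ = _ := hji
  obtain ⟨g, dg⟩ : ∃ g, g = j * c := ⟨_, rfl⟩
  rw [← dg] at hgi
  have hncomm : ¬ Commute g i := by
    intro h
    rw [h.eq, mul_inv_cancel_right] at hgi
    exact H.ne_inv hi hgi
  have hg2 : Commute (g ^ 2) i := by
    rw [commute_iff_eq, ← mul_inv_eq_iff_eq_mul]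
    calc g ^ 2 * i * (g ^ 2)⁻¹ = g * (g * i * g⁻¹) * g⁻¹ := by
          simp only [pow_succ, pow_zero, one_mul]; group
      _ = g * i⁻¹ * g⁻¹ := by rw [hgi]
      _ = (g * i * g⁻¹)⁻¹ := by group
      _ = i := by rw [hgi, inv_inv]
  have hsq : (g ^ 2) ^ 2 = 1 := by
    by_contra h
    obtain ⟨k, hk⟩ := H.exists_four h
    have c1 : Commute g ((g ^ 2) ^ k) := ((Commute.refl g).pow_right 2).pow_right k
    rcases H.cent_four hi hk (hg2.pow_left k).symm with h | h
    · rw [h] at c1; exact hncomm c1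
    · rw [h] at c1; exact hncomm (by simpa using c1.inv_right)
  have hgz : g ^ 2 = z := by
    refine (H.uniq _ hsq).resolve_left ?_
    intro h
    rcases H.uniq _ h with h | h
    · rw [h] at hncomm; exact hncomm (Commute.one_left i)
    · rw [h] at hncomm; exact hncomm (H.central i).symm
  have e : j * c * j * c = j ^ 2 := by
    rw [hj, ← hgz, dg, sq]; group
  calc j * c * j⁻¹ = j * c * j * c * c⁻¹ * (j ^ 2)⁻¹ := by group
    _ = j ^ 2 * c⁻¹ * (j ^ 2)⁻¹ := by rw [e]
    _ = c⁻¹ := by rw [hj, (H.central c⁻¹).symm.eq]; group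

theorem cent_eight {i j c : T} (hi : i ^ 2 = z) (hj : j ^ 2 = z) (hji : j * i * j⁻¹ = i⁻¹)
    (hc : Commute c i) : c ^ 8 = 1 := by
  have h1 := H.inverts_cent hi hj hji hc
  have h2 : (j * c) ^ 4 = 1 := by
    have : (j * c) ^ 2 = z := by
      calc (j * c) ^ 2 = (j * c * j⁻¹) * j ^ 2 * c := by rw [sq, sq]; group
        _ = z := by rw [h1, hj, mul_assoc, (H.central c).symm.eq]; group
    exact H.pow4 this
  have := H.mul j⁻¹ (j * c) (by rw [inv_pow, H.pow4 hj, inv_one]) h2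
  simpa using this

/-- no two elements of order 8 with these relations -/
theorem no_pair {w v : T} (hw : w ^ 4 = z) (hv : v ^ 4 = z) (h1 : w ^ 2 * v * (w ^ 2)⁻¹ = v⁻¹)
    (h2 : v ^ 2 * w * (v ^ 2)⁻¹ = w⁻¹) : False := by
  have hi : (w ^ 2) ^ 2 = z := by rw [← pow_mul, hw]
  have hs : (v ^ 2) ^ 2 = z := by rw [← pow_mul, hv]
  have a1 := H.conj_of_inverts h1
  have a2 := H.conj_of_inverts h2
  have ci : w * w ^ 2 * w⁻¹ = w ^ 2 := by group
  have cs : v * v ^ 2 * v⁻¹ = v ^ 2 := by group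
  have his : w ^ 2 * v ^ 2 * (w ^ 2)⁻¹ = (v ^ 2)⁻¹ := by
    rw [← conj_pow, h1, inv_pow]
  obtain ⟨i, di⟩ : ∃ i, i = w ^ 2 := ⟨_, rfl⟩
  obtain ⟨s, ds⟩ : ∃ s, s = v ^ 2 := ⟨_, rfl⟩
  rw [← di] at hi a1 a2 ci his
  rw [← ds] at hs a1 a2 cs his
  have his' : i * s = s⁻¹ * i := by rw [← his]; group
  have hsi' := H.inverts_symm hs hi his
  obtain ⟨g, dg⟩ : ∃ g, g = w * v := ⟨_, rfl⟩
  have g1 : g * i * g⁻¹ = s := by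
    calc g * i * g⁻¹ = w * (v * i * v⁻¹) * w⁻¹ := by rw [dg]; group
      _ = (w * i * w⁻¹) * (w * s * w⁻¹)⁻¹ := by rw [a1]; group
      _ = i * (s * i⁻¹)⁻¹ := by rw [ci, a2]
      _ = i * i * s⁻¹ := by group
      _ = s := by rw [← sq, hi, H.inv4 hs, ← mul_assoc, H.zz, one_mul]
  have g2 : g * s * g⁻¹ = s * i⁻¹ := by
    calc g * s * g⁻¹ = w * (v * s * v⁻¹) * w⁻¹ := by rw [dg]; group
      _ = _ := by rw [cs, a2]
  have g3 : g * (s * i⁻¹) * g⁻¹ = i := by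
    calc g * (s * i⁻¹) * g⁻¹ = (g * s * g⁻¹) * (g * i * g⁻¹)⁻¹ := by group
      _ = s * i⁻¹ * s⁻¹ := by rw [g1, g2]
      _ = (s * i * s⁻¹)⁻¹ := by group
      _ = i := by rw [hsi', inv_inv]
  have c3 : Commute (g ^ 3) i := by
    rw [commute_iff_eq, ← mul_inv_eq_iff_eq_mul]
    calc g ^ 3 * i * (g ^ 3)⁻¹ = g * (g * (g * i * g⁻¹) * g⁻¹) * g⁻¹ := by
          simp only [pow_succ, pow_zero, one_mul]; group
      _ = i := by rw [g1, g2, g3]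
  obtain ⟨n, hn⟩ := H.h2 g
  have c1 : Commute g i := by
    have hcop : Nat.Coprime (orderOf g) 3 := by
      refine Nat.Coprime.coprime_dvd_left (orderOf_dvd_of_pow_eq_one hn) ?_
      exact Nat.Coprime.pow_left n (by norm_num)
    obtain ⟨m, hm⟩ := exists_pow_eq_self_of_coprime hcop.symm
    rw [← hm]; exact c3.pow_left m
  rw [c1.eq, mul_inv_cancel_right] at g1
  rw [← g1, mul_inv_cancel_right] at hsi'
  exact H.ne_inv hi hsi'

theorem conj_pm {w : T} (hw : w ^ 4 = z) (t : T) :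
    t * w ^ 2 * t⁻¹ = w ^ 2 ∨ t * w ^ 2 * t⁻¹ = (w ^ 2)⁻¹ := by
  by_contra hcon
  push Not at hcon
  obtain ⟨n1, n2⟩ := hcon
  have hi : (w ^ 2) ^ 2 = z := by rw [← pow_mul, hw]
  have hk : (t * w ^ 2 * t⁻¹) ^ 2 = z := by
    rw [conj_pow, hi, (H.central t).eq, mul_inv_cancel_right]
  have cw : Commute w (w ^ 2) := (Commute.refl w).pow_right 2
  rcases H.pair_cases hi hk n1 n2 with h | ⟨h3, h4⟩
  · have e : (t * w * t⁻¹) ^ 2 = t * w ^ 2 * t⁻¹ := conj_pow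
    refine H.no_pair (w := w) (v := t * w * t⁻¹) hw ?_ ?_ ?_
    · rw [conj_pow, hw, (H.central t).eq, mul_inv_cancel_right]
    · refine H.inverts_cent hk hi (H.inverts_symm hi hk h) ?_
      rw [← e]; exact (Commute.refl _).pow_right 2
    · rw [e]; exact H.inverts_cent hi hk h cw
  · obtain ⟨v, dv⟩ : ∃ v, v = w ^ 2 * (t * w ^ 2 * t⁻¹) := ⟨_, rfl⟩
    rw [← dv] at h3 h4
    have hv2 : (v ^ 2) ^ 2 = z := by rw [← pow_mul, h3]
    refine H.no_pair hw h3 h4 ?_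
    refine H.inverts_cent hi hv2 (H.inverts_symm hv2 hi ?_) cw
    rw [← conj_pow, h4, inv_pow]

/-- main structure theorem -/
theorem main {P : Type*} [Group P] (π : T →* P) (hs : Function.Surjective π)
    (hker : ∀ t : T, π t = 1 ↔ t = 1 ∨ t = z) :
    IsLocallyCyclic2Group P ∨
      Nonempty (P ≃* Multiplicative (ZMod 2) × Multiplicative (ZMod 2)) ∨
      Nonempty (P ≃* DihedralGroup 4) := by
  by_cases hI : ∀ u v : T, u ^ 2 = z → v ^ 2 = z → v = u ∨ v = u⁻¹
  · left
    constructor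
    · intro p
      obtain ⟨t, rfl⟩ := hs p
      obtain ⟨n, hn⟩ := H.h2 t
      obtain ⟨k, _, hk⟩ := (Nat.dvd_prime_pow Nat.prime_two).mp
        (orderOf_dvd_of_pow_eq_one (show π t ^ (2 ^ n) = 1 by rw [← map_pow, hn, map_one]))
      exact ⟨k, hk⟩
    · refine locCyc_of_chain ?_
      intro p q
      obtain ⟨t, rfl⟩ := hs p
      obtain ⟨u, rfl⟩ := hs q
      have himp : ∀ t u : T, t ∈ Subgroup.zpowers u → π t ∈ Subgroup.zpowers (π u) := by
        rintro t u ⟨k, rfl⟩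
        exact ⟨k, by simp⟩
      exact (H.chain_all hI t u).imp (himp _ _) (himp _ _)
  right
  have hπz : π z = 1 := (hker z).mpr (Or.inr rfl)
  by_cases h8 : ∃ w : T, w ^ 4 = z
  · right
    obtain ⟨w, hw⟩ := h8
    have hi : (w ^ 2) ^ 2 = z := by rw [← pow_mul, hw]
    have cw : Commute w (w ^ 2) := (Commute.refl w).pow_right 2
    obtain ⟨j, hj, hji⟩ := H.exists_inverter hI hi
    have hjw := H.inverts_cent hi hj hji cw
    have hC : ∀ c : T, Commute c (w ^ 2) → c ∈ Subgroup.zpowers w := by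
      intro c hc
      by_cases hc1 : c = 1
      · rw [hc1]; exact Subgroup.one_mem _
      have h8 := H.cent_eight hi hj hji hc
      obtain ⟨n, hn⟩ := H.level c hc1
      have hn2 : n ≤ 2 := by
        by_contra hlt
        push Not at hlt
        apply H.z1
        rw [← hn, show n = 3 + (n - 3) by omega, pow_add, pow_mul]
        norm_num [h8]
      refine H.chain (Subgroup.centralizer {w ^ 2}) ?_ hn2 ?_ ?_ hn hw
      · intro u hu v hv hu2 hv2
        rw [Subgroup.mem_centralizer_singleton_iff] at hu hv
        have e1 := H.cent_four hi hu2 hu.symm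
        have e2 := H.cent_four hi hv2 hv.symm
        rcases e1 with rfl | rfl <;> rcases e2 with rfl | rfl <;> simp
      · rw [Subgroup.mem_centralizer_singleton_iff]; exact hc
      · rw [Subgroup.mem_centralizer_singleton_iff]; exact cw
    refine dihedral_of 4 (r := π w) (s := π j) ?_ ?_ ?_ ?_ ?_
    · have : orderOf (π w) = 2 ^ (1 + 1) := by
        apply orderOf_eq_prime_pow
        · rw [pow_one, ← map_pow, hker]
          rintro (h | h)
          · apply H.z1; rw [← hi, h, one_pow]
          · apply H.z1; rw [← hi, h, H.z2]
        · rw [← map_pow]; norm_num [hw, hπz]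
      simpa using this
    · rw [← map_mul, ← sq, hj, hπz]
    · rw [← map_mul, ← map_mul, ← map_inv]
      rw [show j * w * j = (j * w * j⁻¹) * j ^ 2 by group, hjw, hj, map_mul, hπz, mul_one]
    · intro k hk
      rw [← map_zpow, ← mul_inv_eq_one, ← map_inv, ← map_mul, hker] at hk
      have cz : Commute j (w ^ 2) := by
        have cwk : Commute (w ^ k) (w ^ 2) := cw.zpow_left k
        have : j = j * (w ^ k)⁻¹ * w ^ k := by group
        rw [this]
        refine Commute.mul_left ?_ cwk
        rcases hk with h | h
        · rw [h]; exact Commute.one_left _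
        · rw [h]; exact (H.central _).symm
      rw [cz.eq, mul_inv_cancel_right] at hji
      exact H.ne_inv hi hji
    · intro p
      obtain ⟨t, rfl⟩ := hs p
      have hjj : j⁻¹ * (w ^ 2)⁻¹ * j = w ^ 2 := by rw [← hji]; group
      rcases H.conj_pm hw t with h | h
      · obtain ⟨k, hk⟩ := hC t (by rw [commute_iff_eq, ← mul_inv_eq_iff_eq_mul]; exact h)
        exact ⟨k, Or.inl (by rw [← hk]; simp)⟩
      · obtain ⟨k, hk⟩ := hC (j⁻¹ * t) (by
          rw [commute_iff_eq, ← mul_inv_eq_iff_eq_mul]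
          calc j⁻¹ * t * w ^ 2 * (j⁻¹ * t)⁻¹ = j⁻¹ * (t * w ^ 2 * t⁻¹) * j := by group
            _ = _ := by rw [h, hjj])
        have hk : w ^ k = j⁻¹ * t := hk
        exact ⟨k, Or.inr (by rw [← map_zpow, hk, ← map_mul]; congr 1; group)⟩
  · left
    push Not at h8
    have h4 : ∀ t : T, (t ^ 2) ^ 2 = 1 := by
      intro t
      by_contra h
      obtain ⟨k, hk⟩ := H.exists_four h
      exact h8 (t ^ k) (by rw [← hk, ← pow_mul, ← pow_mul, ← pow_mul]; congr 1; ring)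
    have hP2 : ∀ p : P, p * p = 1 := by
      intro p
      obtain ⟨t, rfl⟩ := hs p
      rw [← map_mul, ← sq, hker]
      exact H.uniq _ (h4 t)
    have hPc : ∀ p q : P, p * q = q * p := by
      intro p q
      have h1 : ∀ p : P, p⁻¹ = p := fun p => inv_eq_of_mul_eq_one_left (hP2 p)
      calc p * q = (p * q)⁻¹ := (h1 _).symm
        _ = q * p := by rw [mul_inv_rev, h1, h1]
    obtain ⟨i, hi⟩ : ∃ i : T, i ^ 2 = z := by
      by_contra hcon
      push Not at hcon
      exact hI fun u v hu => (hcon u hu).elim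
    obtain ⟨j, hj, hji⟩ := H.exists_inverter hI hi
    have hC : ∀ c : T, Commute c i → ∃ k : ℤ, π c = π i ^ k := by
      intro c hc
      by_cases hc2 : c ^ 2 = 1
      · exact ⟨0, by rw [zpow_zero, hker]; exact H.uniq _ hc2⟩
      · rcases H.cent_four hi ((H.uniq _ (h4 c)).resolve_left hc2) hc.symm with h | h
        · exact ⟨1, by rw [h, zpow_one]⟩
        · exact ⟨-1, by rw [h, map_inv, zpow_neg_one]⟩
    have hd : Nonempty (P ≃* DihedralGroup 2) := by
      refine dihedral_of 2 (r := π i) (s := π j) ?_ (hP2 _) ?_ ?_ ?_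
      · refine orderOf_eq_prime (by rw [sq, hP2]) ?_
        rw [Ne, hker]
        rintro (h | h)
        · apply H.z1; rw [← hi, h, one_pow]
        · apply H.z1; rw [← hi, h, H.z2]
      · rw [hPc, ← mul_assoc, hP2, one_mul]
        exact (inv_eq_of_mul_eq_one_left (hP2 _)).symm
      · intro k hk
        rw [← map_zpow, ← mul_inv_eq_one, ← map_inv, ← map_mul, hker] at hk
        have cz : Commute j i := by
          have cwk : Commute (i ^ k) i := (Commute.refl i).zpow_left k
          have : j = j * (i ^ k)⁻¹ * i ^ k := by group
          rw [this]
          refine Commute.mul_left ?_ cwk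
          rcases hk with h | h
          · rw [h]; exact Commute.one_left _
          · rw [h]; exact (H.central _).symm
        rw [cz.eq, mul_inv_cancel_right] at hji
        exact H.ne_inv hi hji
      · intro p
        obtain ⟨t, rfl⟩ := hs p
        have hcases : t * i * t⁻¹ = i ∨ t * i * t⁻¹ = i⁻¹ := by
          have : π (t * i * t⁻¹ * i⁻¹) = 1 := by
            rw [map_mul, map_mul, map_mul, map_inv, map_inv, hPc (π t)]; group
          rw [hker] at this
          rcases this with h | h
          · left; exact mul_inv_eq_one.mp h
          · right; rw [H.inv4 hi, ← h]; group
        have hjj : j⁻¹ * i⁻¹ * j = i := by rw [← hji]; group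
        rcases hcases with h | h
        · obtain ⟨k, hk⟩ := hC t (by rw [commute_iff_eq, ← mul_inv_eq_iff_eq_mul]; exact h)
          exact ⟨k, Or.inl hk⟩
        · obtain ⟨k, hk⟩ := hC (j⁻¹ * t) (by
            rw [commute_iff_eq, ← mul_inv_eq_iff_eq_mul]
            calc j⁻¹ * t * i * (j⁻¹ * t)⁻¹ = j⁻¹ * (t * i * t⁻¹) * j := by group
              _ = _ := by rw [h, hjj])
          exact ⟨k, Or.inr (by rw [← hk, ← map_mul]; congr 1; group)⟩
    obtain ⟨e⟩ := hd
    have hK : IsKleinFour (Multiplicative (ZMod 2) × Multiplicative (ZMod 2)) := by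
      constructor
      · simp
      · rw [Monoid.exponent_prod]; simp
    obtain ⟨e2⟩ := IsKleinFour.nonempty_mulEquiv (G₁ := DihedralGroup 2)
      (G₂ := Multiplicative (ZMod 2) × Multiplicative (ZMod 2))
    exact ⟨e.trans e2⟩

end TS


/-! ### Case B: conclusion -/

namespace HB
variable {G : Type*} [Group G] (H : HB G)
include H

theorem four_closure {m : G} (hm : m ∈ Subgroup.closure {g : G | g ^ 2 = 1}) :
    ∀ f : G, f ^ 4 = 1 ∧ f ^ 2 ≠ 1 →
      ((f * m) ^ 4 = 1 ∧ (f * m) ^ 2 ≠ 1) ∧ ((f * m⁻¹) ^ 4 = 1 ∧ (f * m⁻¹) ^ 2 ≠ 1) := by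
  induction hm using Subgroup.closure_induction with
  | mem x hx =>
    intro f hf
    have hx : x ^ 2 = 1 := hx
    rw [inv_of_sq hx, and_self_iff]
    by_cases h1 : x = 1
    · rw [h1, mul_one]; exact hf
    · exact H.four_mul hf.1 hf.2 hx h1
  | one => intro f hf; simpa using hf
  | mul x y _ _ hx hy =>
    intro f hf
    constructor
    · rw [← mul_assoc]; exact (hy _ (hx f hf).1).1
    · rw [mul_inv_rev, ← mul_assoc]; exact (hx _ (hy f hf).2).2
  | inv x _ hx => intro f hf; rw [inv_inv]; exact (hx f hf).symm

theorem not_four {m : G} (hm : m ∈ Subgroup.closure {g : G | g ^ 2 = 1}) (h4 : m ^ 4 = 1) :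
    m ^ 2 = 1 := by
  by_contra h
  have := (H.four_closure hm m ⟨h4, h⟩).2.2
  simp at this

theorem comm_M {a m : G} (ha : a ^ 2 = 1) (ha1 : a ≠ 1)
    (hm : m ∈ Subgroup.closure {g : G | g ^ 2 = 1}) (c : Commute m a) : m = 1 ∨ m = a := by
  rcases H.pe m with ⟨n, hn⟩ | ⟨n, hn⟩
  · have h2 : m ^ 2 = 1 := by
      by_contra h2
      obtain ⟨k, hk, hk2⟩ := exists_sq_power n hn h2
      exact hk2 (H.not_four (Subgroup.pow_mem _ hm k) hk)
    by_cases h1 : m = 1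
    · exact Or.inl h1
    · exact Or.inr (H.comm_eq h2 h1 ha ha1 c)
  · rcases H.toHH.comm_cases (n := 1) c.symm (by simpa using ha) hn with h | h
    · exact (ha1 h).elim
    · exact Or.inl h

theorem dec_M {a m : G} (ha : a ^ 2 = 1) (ha1 : a ≠ 1)
    (hm : m ∈ Subgroup.closure {g : G | g ^ 2 = 1}) :
    ∃ s ∈ Subgroup.closure {g : G | g ^ 2 = 1}, s ^ 9 = 1 ∧ a * s * a = s⁻¹ ∧
      (m = s ∨ m = s * a) := by
  obtain ⟨s, hs, hs9, hs2, hc⟩ := H.inv_dec ha ha1 m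
  have haM : a ∈ Subgroup.closure {g : G | g ^ 2 = 1} := Subgroup.subset_closure ha
  have hsM : s ∈ Subgroup.closure {g : G | g ^ 2 = 1} := by
    rw [hs]
    exact Subgroup.pow_mem _ (Subgroup.mul_mem _ (Subgroup.mul_mem _ (Subgroup.mul_mem _ hm haM)
      (Subgroup.inv_mem _ hm)) haM) 5
  refine ⟨s, hsM, hs9, hs2, ?_⟩
  rcases H.comm_M ha ha1 (Subgroup.mul_mem _ (Subgroup.inv_mem _ hsM) hm) hc with h | h
  · left; exact (inv_mul_eq_one.mp h).symm
  · right; rw [← h]; group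

theorem inv_M {a k : G} (ha : a ^ 2 = 1) (ha1 : a ≠ 1)
    (hk : k ∈ Subgroup.closure {g : G | g ^ 2 = 1}) (h9 : k ^ 9 = 1) : a * k * a = k⁻¹ := by
  obtain ⟨s, _, _, hs2, h | h⟩ := H.dec_M ha ha1 hk
  · rw [h, hs2]
  · have h2 : k ^ 2 = 1 := by
      rw [h, sq, show s * a * (s * a) = s * (a * s * a) by group, hs2, mul_inv_cancel]
    rw [eq_one_of_coprime (by norm_num) h2 h9, mul_one, inv_one, ← sq, ha]

theorem final (hex : ∃ a : G, a ^ 2 = 1 ∧ a ≠ 1) :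
    LFG (Omega G) ∧ (∀ w ∈ Omega G, w ^ 72 = 1) ∧
      (IsLocallyCyclic2Group (G ⧸ Omega G) ∨
      Nonempty (G ⧸ Omega G ≃* Multiplicative (ZMod 2) × Multiplicative (ZMod 2)) ∨
      Nonempty (G ⧸ Omega G ≃* DihedralGroup 4)) := by
  obtain ⟨a, ha, ha1⟩ := hex
  obtain ⟨M, dM⟩ : ∃ M, M = Subgroup.closure {g : G | g ^ 2 = 1} := ⟨_, rfl⟩
  have haM : a ∈ M := by rw [dM]; exact Subgroup.subset_closure ha
  have hMconj : ∀ m ∈ M, ∀ g : G, g * m * g⁻¹ ∈ M := by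
    have : M.Normal := by
      rw [dM]
      constructor
      intro n hn g
      induction hn using Subgroup.closure_induction with
      | mem x hx => exact Subgroup.subset_closure (conj_pow_one hx)
      | one => simpa using Subgroup.one_mem _
      | mul x y _ _ hx hy =>
        have h : g * (x * y) * g⁻¹ = (g * x * g⁻¹) * (g * y * g⁻¹) := by group
        rw [h]; exact Subgroup.mul_mem _ hx hy
      | inv x _ hx =>
        have h : g * x⁻¹ * g⁻¹ = (g * x * g⁻¹)⁻¹ := by group
        rw [h]; exact Subgroup.inv_mem _ hx
    exact fun m hm g => this.conj_mem m hm g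
  have hinv : ∀ k ∈ M, k ^ 9 = 1 → a * k * a = k⁻¹ := by
    intro k hk h9; rw [dM] at hk; exact H.inv_M ha ha1 hk h9
  obtain ⟨K, hK⟩ : ∃ K : Subgroup G, ∀ k, k ∈ K ↔ k ∈ M ∧ k ^ 9 = 1 :=
    ⟨{ carrier := {k | k ∈ M ∧ k ^ 9 = 1}
       one_mem' := ⟨M.one_mem, one_pow 9⟩
       mul_mem' := fun {x y} hx hy => ⟨M.mul_mem hx.1 hy.1,
         H.mul_inv_nine ha ha1 hx.2 (hinv x hx.1 hx.2) hy.2 (hinv y hy.1 hy.2)⟩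
       inv_mem' := fun {x} hx => ⟨M.inv_mem hx.1, by rw [inv_pow, hx.2, inv_one]⟩ },
      fun k => Iff.rfl⟩
  have hKinv : ∀ k ∈ K, a * k * a = k⁻¹ := fun k hk => hinv k ((hK k).mp hk).1 ((hK k).mp hk).2
  have hKc : ∀ x ∈ K, ∀ y ∈ K, x * y = y * x := by
    intro x hx y hy
    have h1 := hKinv _ (K.mul_mem hx hy)
    have h2 : a * (x * y) * a = (a * x * a) * (a * y * a) := by
      simp only [mul_assoc, sq_cancel ha]
    rw [h1, hKinv x hx, hKinv y hy, ← mul_inv_rev, inv_inj] at h2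
    exact h2
  have hKn : K.Normal := by
    constructor
    intro k hk g
    rw [hK] at hk ⊢
    exact ⟨hMconj k hk.1 g, conj_pow_one hk.2⟩
  have haK : a ∉ K := fun h => ha1 (eq_one_of_coprime (by norm_num) ha ((hK a).mp h).2)
  have hdec : ∀ m ∈ M, ∃ s ∈ K, m = s ∨ m = s * a := by
    intro m hm
    obtain ⟨s, h1, h2, _, h4⟩ := H.dec_M ha ha1 (by rwa [dM] at hm)
    exact ⟨s, (hK s).mpr ⟨by rwa [dM], h2⟩, h4⟩
  have h3K : ∀ (g : G) (n : ℕ), g ^ (3 ^ n) = 1 → g ∈ K := by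
    intro g n hn
    obtain ⟨s, hs, hs9, hs2, hc⟩ := H.inv_dec ha ha1 g
    have hsK : s ∈ K := by
      rw [hK]
      refine ⟨?_, hs9⟩
      rw [hs]; exact M.pow_mem (M.mul_mem (hMconj a haM g) haM) 5
    have hvK : (s⁻¹ * g) ^ (3 ^ n) ∈ K := by
      rw [← QuotientGroup.eq_one_iff, QuotientGroup.mk_pow, QuotientGroup.mk_mul,
        (QuotientGroup.eq_one_iff s⁻¹).mpr (K.inv_mem hsK), one_mul, ← QuotientGroup.mk_pow, hn,
        QuotientGroup.mk_one]
    have hcv : Commute ((s⁻¹ * g) ^ (3 ^ n)) a := hc.pow_left _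
    have e := hKinv _ hvK
    rw [hcv.symm.eq, mul_assoc, ← sq, ha, mul_one] at e
    have hv1 : (s⁻¹ * g) ^ (3 ^ n) = 1 := by
      refine eq_one_of_coprime (m := 2) (n := 9) (by norm_num) ?_ ((hK _).mp hvK).2
      rw [sq]; nth_rewrite 2 [e]; exact mul_inv_cancel _
    rcases H.toHH.comm_cases (n := 1) hc.symm (by simpa using ha) hv1 with h | h
    · exact (ha1 h).elim
    · rw [← inv_mul_eq_one.mp h]; exact hsK
  have hKM : K ≤ M := fun k hk => ((hK k).mp hk).1
  have hO : Omega G = M := by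
    apply le_antisymm
    · unfold Omega
      rw [Subgroup.closure_le]
      rintro g (h | h)
      · rw [dM]; exact Subgroup.subset_closure h
      · exact hKM (h3K g 1 (by simpa using h))
    · rw [dM]
      exact Subgroup.closure_mono fun g hg => Or.inl hg
  have hKsq : ∀ s ∈ K, (s * a) ^ 2 = 1 := by
    intro s hs
    rw [sq, show s * a * (s * a) = s * (a * s * a) by group, hKinv s hs, mul_inv_cancel]
  -- the elements of `K` of 2-power order
  have hK2 : ∀ k ∈ K, ∀ n : ℕ, k ^ (2 ^ n) = 1 → k = 1 := by
    intro k hk n hn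
    exact eq_one_of_coprime (m := 2 ^ n) (n := 9) (Nat.Coprime.pow_left n (by norm_num)) hn
      ((hK k).mp hk).2
  refine ⟨?_, ?_, ?_⟩
  · rw [hO]
    refine LFG.sub_ext (QuotientGroup.mk' K) M ?_ ?_
    · rw [QuotientGroup.ker_mk']
      refine LFG.of_comm (fun x y => Subtype.ext (hKc x x.2 y y.2)) ?_
      intro x
      exact ⟨9, by norm_num, Subtype.ext (by simpa using ((hK x).mp x.2).2)⟩
    · have : ((M.map (QuotientGroup.mk' K) : Subgroup (G ⧸ K)) : Set (G ⧸ K)) ⊆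
          {1, (QuotientGroup.mk' K) a} := by
        rintro _ ⟨m, hm, rfl⟩
        obtain ⟨s, hs, h | h⟩ := hdec m hm
        · left; rw [h]; exact (QuotientGroup.eq_one_iff s).mpr hs
        · right
          rw [h, map_mul, show (QuotientGroup.mk' K) s = 1 from (QuotientGroup.eq_one_iff s).mpr hs,
            one_mul]; rfl
      have hf : Finite (M.map (QuotientGroup.mk' K)) := (Set.toFinite _).subset this
      exact LFG.of_finite
  · intro w hw
    rw [hO] at hw
    obtain ⟨s, hs, h | h⟩ := hdec w hw
    · rw [h, show 72 = 9 * 8 by norm_num, pow_mul, ((hK s).mp hs).2, one_pow]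
    · rw [h, show 72 = 2 * 36 by norm_num, pow_mul, hKsq s hs, one_pow]
  · have hlift : ∀ t : G ⧸ K, t ≠ 1 → ∃ g : G, (g : G ⧸ K) = t ∧ ∃ n, g ^ (2 ^ n) = 1 := by
      intro t ht
      obtain ⟨g, rfl⟩ := QuotientGroup.mk_surjective t
      rcases H.pe g with h | ⟨n, hn⟩
      · exact ⟨g, rfl, h⟩
      · exact (ht ((QuotientGroup.eq_one_iff g).mpr (h3K g n hn))).elim
    have hlift4 : ∀ t : G ⧸ K, ∀ n : ℕ, t ^ (2 ^ n) = 1 →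
        ∃ g : G, (g : G ⧸ K) = t ∧ g ^ (2 ^ n) = 1 := by
      intro t n hn
      by_cases ht : t = 1
      · exact ⟨1, by rw [ht]; rfl, one_pow _⟩
      obtain ⟨g, rfl, m, hm⟩ := hlift t ht
      refine ⟨g, rfl, ?_⟩
      rw [← QuotientGroup.mk_pow, QuotientGroup.eq_one_iff] at hn
      exact hK2 _ hn m (by rw [← pow_mul, mul_comm, pow_mul, hm, one_pow])
    have hMmk : ∀ m ∈ M, (m : G ⧸ K) = 1 ∨ (m : G ⧸ K) = (a : G ⧸ K) := by
      intro m hm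
      obtain ⟨s, hs, h | h⟩ := hdec m hm
      · left; rw [h]; exact (QuotientGroup.eq_one_iff s).mpr hs
      · right; rw [h, QuotientGroup.mk_mul, (QuotientGroup.eq_one_iff s).mpr hs, one_mul]
    have hTS : TS (G ⧸ K) (a : G ⧸ K) := by
      constructor
      · intro t
        by_cases ht : t = 1
        · exact ⟨0, by rw [ht, one_pow]⟩
        obtain ⟨g, rfl, m, hm⟩ := hlift t ht
        exact ⟨m, by rw [← QuotientGroup.mk_pow, hm, QuotientGroup.mk_one]⟩
      · intro h; exact haK ((QuotientGroup.eq_one_iff a).mp h)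
      · rw [← QuotientGroup.mk_pow, ha, QuotientGroup.mk_one]
      · intro t ht
        obtain ⟨g, rfl, hg⟩ := hlift4 t 1 (by simpa using ht)
        exact hMmk g (by rw [dM]; exact Subgroup.subset_closure (by simpa using hg))
      · intro u v hu hv
        obtain ⟨g, rfl, hg⟩ := hlift4 u 2 (by simpa using hu)
        obtain ⟨h, rfl, hh⟩ := hlift4 v 2 (by simpa using hv)
        rw [← QuotientGroup.mk_mul, ← QuotientGroup.mk_pow]
        rcases H.mul g h (Or.inl (by simpa using hg)) (Or.inl (by simpa using hh)) with e | e
        · rw [e, QuotientGroup.mk_one]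
        · rw [QuotientGroup.eq_one_iff]
          exact K.pow_mem (h3K _ 2 (by simpa using e)) 8
    have hKO : K ≤ (Omega G).comap (MonoidHom.id G) := by rw [hO]; exact hKM
    refine hTS.main (QuotientGroup.map K (Omega G) (MonoidHom.id G) hKO) ?_ ?_
    · intro q
      obtain ⟨g, rfl⟩ := QuotientGroup.mk_surjective q
      exact ⟨(g : G ⧸ K), rfl⟩
    · intro t
      obtain ⟨g, rfl⟩ := QuotientGroup.mk_surjective t
      rw [QuotientGroup.map_mk, MonoidHom.id_apply, QuotientGroup.eq_one_iff, hO]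
      constructor
      · exact hMmk g
      · rintro (h | h)
        · exact hKM ((QuotientGroup.eq_one_iff g).mp h)
        · have := hKM (QuotientGroup.eq.mp h)
          have h2 : g = a * (g⁻¹ * a)⁻¹ := by group
          rw [h2]; exact M.mul_mem haM (M.inv_mem this)

end HB


/-! ### Case A -/

/-- elements of order 3 -/
def X3 {G : Type*} [Group G] (x : G) : Prop := x ^ 3 = 1 ∧ x ≠ 1

section X3
variable {G : Type*} [Group G]

theorem X3.inv {x : G} (h : X3 x) : X3 x⁻¹ :=
  ⟨by rw [inv_pow, h.1, inv_one], by simpa using h.2⟩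

theorem X3.conj {x : G} (h : X3 x) (g : G) : X3 (g * x * g⁻¹) :=
  ⟨conj_pow_one h.1, conj_ne_one h.2⟩

theorem X3.swap {x y : G} (h : X3 (x * y)) : X3 (y * x) := by
  have := h.conj x⁻¹
  simpa [mul_assoc] using this

theorem X3.sq {x : G} (h : X3 x) : X3 (x * x) := by
  rw [cube_sq h.1]; exact h.inv

/-- The normal 2-subgroup of case A. -/
def Nsub (G : Type*) [Group G] : Subgroup G where
  carrier := {n | ∀ x : G, X3 x → X3 (x * n)}
  one_mem' := fun x hx => by simpa using hx
  mul_mem' := fun {a b} ha hb x hx => by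
    rw [← mul_assoc]; exact hb _ (ha x hx)
  inv_mem' := fun {n} hn x hx => by
    have h1 : X3 (n * x⁻¹) := (hn _ hx.inv).swap
    have := h1.inv
    simpa using this

theorem mem_Nsub {n : G} : n ∈ Nsub G ↔ ∀ x : G, X3 x → X3 (x * n) := Iff.rfl

instance Nsub.normal : (Nsub G).Normal := by
  constructor
  intro n hn g x hx
  have h1 := (hn (g⁻¹ * x * g) (by simpa using hx.conj g⁻¹)).conj g
  have e : x * (g * n * g⁻¹) = g * (g⁻¹ * x * g * n) * g⁻¹ := by group
  rw [e]; exact h1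

theorem Nsub_not_X3 {n : G} (hn : n ∈ Nsub G) : ¬ X3 n := by
  intro h
  have := hn _ h.inv
  rw [inv_mul_cancel] at this
  exact this.2 rfl

theorem Nsub_split {n x : G} (hn : n ∈ Nsub G) (hx : X3 x) :
    (x * n * x⁻¹) * (x⁻¹ * n * x) * n = 1 := by
  have h := (hn x hx).1
  calc (x * n * x⁻¹) * (x⁻¹ * n * x) * n = x * n * (x⁻¹ * x⁻¹) * n * x * n := by group
    _ = (x * n) ^ 3 := by rw [cube_sq_inv hx.1]; simp only [pow_succ, pow_zero, one_mul]; group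
    _ = 1 := h

theorem Nsub_comm {n x : G} (hn : n ∈ Nsub G) (hx : X3 x) : Commute n (x * n * x⁻¹) := by
  have h1 := Nsub_split hn hx
  have h2 := Nsub_split hn hx.inv
  rw [inv_inv] at h2
  obtain ⟨b, db⟩ : ∃ b, b = x * n * x⁻¹ := ⟨_, rfl⟩
  obtain ⟨c, dc⟩ : ∃ c, c = x⁻¹ * n * x := ⟨_, rfl⟩
  rw [← db, ← dc] at h1 h2
  rw [← db, commute_iff_eq]
  have h3 : c = b⁻¹ * n⁻¹ := by
    rw [← mul_inv_rev, eq_inv_iff_mul_eq_one, ← mul_assoc]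
    have : c * n * b = b⁻¹ * (b * c * n) * b := by group
    rw [this, h1]
    · group
  rw [h3] at h2
  have h4 : b⁻¹ * n⁻¹ * b = n⁻¹ := by rw [eq_inv_iff_mul_eq_one]; exact h2
  have h5 : b⁻¹ * n * b = n := by
    have := congrArg (·⁻¹) h4
    simpa [mul_assoc] using this
  calc n * b = b * (b⁻¹ * n * b) := by group
    _ = b * n := by rw [h5]

theorem Nsub_comm' {n q x : G} (hn : n ∈ Nsub G) (hq : q ∈ Nsub G) (hx : X3 x) :
    Commute n (q * (x * n * x⁻¹) * q⁻¹) := by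
  have hq' : x⁻¹ * q * x ∈ Nsub G := by simpa using Nsub.normal.conj_mem q hq x⁻¹
  have := Nsub_comm hn (hq' x hx)
  have e : x * (x⁻¹ * q * x) * n * (x * (x⁻¹ * q * x))⁻¹ = q * (x * n * x⁻¹) * q⁻¹ := by group
  rwa [e] at this

/-- 2-Engel property -/
theorem Nsub_engel (hex : ∃ x : G, X3 x) {n q : G} (hn : n ∈ Nsub G) (hq : q ∈ Nsub G) :
    Commute n (q * n * q⁻¹) := by
  obtain ⟨x, hx⟩ := hex
  have h1 := Nsub_split hn hx
  have c1 := Nsub_comm' hn hq hx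
  have c2 := Nsub_comm' hn hq hx.inv
  rw [inv_inv] at c2
  have e : q * n * q⁻¹ = ((q * (x * n * x⁻¹) * q⁻¹) * (q * (x⁻¹ * n * x) * q⁻¹))⁻¹ := by
    rw [eq_inv_iff_mul_eq_one]
    have h2 : n * ((x * n * x⁻¹) * (x⁻¹ * n * x)) = 1 := by
      rw [mul_eq_one_iff_eq_inv] at h1 ⊢
      rw [h1, inv_inv]
    calc q * n * q⁻¹ * (q * (x * n * x⁻¹) * q⁻¹ * (q * (x⁻¹ * n * x) * q⁻¹))
        = q * (n * ((x * n * x⁻¹) * (x⁻¹ * n * x))) * q⁻¹ := by group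
      _ = 1 := by rw [h2]; group
  rw [e]; exact (c1.mul_right c2).inv_right

theorem Nsub_eight (H : HH G) (hex : ∃ x : G, X3 x) {n : G} (hn : n ∈ Nsub G) : n ^ 8 = 1 := by
  obtain ⟨x, hx⟩ := hex
  have h := H.mul x⁻¹ (x * n) (Or.inr hx.inv.1) (Or.inr (hn x hx).1)
  rw [inv_mul_cancel_left] at h
  rcases h with h | h
  · exact h
  · by_cases h1 : n = 1
    · rw [h1, one_pow]
    · obtain ⟨m, hm⟩ := exists_three_power h h1
      exact (Nsub_not_X3 ((Nsub G).pow_mem hn m) hm).elim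

end X3

/-! ### Representation argument -/

section Rep
variable {G : Type*} [Group G] {R : Type*} [Ring R]

theorem char2_add_self (h2 : (2 : R) = 0) (a : R) : a + a = 0 := by
  rw [← two_mul, h2, zero_mul]

theorem char2_eq (h2 : (2 : R) = 0) {a b : R} (h : a + b = 0) : a = b := by
  have h3 := char2_add_self h2 b
  exact add_right_cancel (h.trans h3.symm)

theorem char2_add_cancel (h2 : (2 : R) = 0) (a b : R) : a + (a + b) = b := by
  rw [← add_assoc, char2_add_self h2, zero_add]

theorem char2_sq (h2 : (2 : R) = 0) {a b : R} (c : Commute a b) : (a + b) ^ 2 = a ^ 2 + b ^ 2 := by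
  rw [c.add_sq, h2]; simp

/-- The representation hypotheses. -/
structure RP (G : Type*) [Group G] (R : Type*) [Ring R] (ρ : G →* R) : Prop extends HH G where
  h2 : (2 : R) = 0
  h1 : (1 : R) ≠ 0
  hx : ∀ x : G, X3 x → ρ x * ρ x = ρ x + 1

namespace RP
variable {ρ : G →* R} (H : RP G R ρ)
include H

theorem inv {x : G} (hx : X3 x) : ρ x⁻¹ = ρ x + 1 := by
  rw [← cube_sq hx.1, map_mul, H.hx x hx]

theorem trace {u v : G} (hu : X3 u) (hv : X3 v) :
    ρ (u * v) + ρ (u * v)⁻¹ = (ρ u + ρ v) ^ 2 + 1 := by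
  rw [mul_inv_rev, map_mul, map_mul, H.inv hu, H.inv hv]
  have e : (ρ u + ρ v) ^ 2 = ρ u * ρ u + ρ u * ρ v + ρ v * ρ u + ρ v * ρ v := by noncomm_ring
  rw [e, H.hx u hu, H.hx v hv]
  apply char2_eq H.h2
  have z := char2_add_self H.h2
  calc _ = (ρ u * ρ v + ρ u * ρ v) + (ρ v * ρ u + ρ v * ρ u) + (ρ u + ρ u) + (ρ v + ρ v) + (1 + 1)
        + (1 + 1) := by noncomm_ring
    _ = 0 := by simp only [z, add_zero]

theorem trace_cases (g : G) (hg : g ^ 8 = 1 ∨ g ^ 9 = 1) {t : R} (ht : ρ g + ρ g⁻¹ = t) :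
    t ^ 8 = 0 ∨ (X3 g ∧ t = 1) ∨ t ^ 3 = t + 1 := by
  have h1 : ρ g * ρ g⁻¹ = 1 := by rw [← map_mul, mul_inv_cancel, map_one]
  have h1' : ρ g⁻¹ * ρ g = 1 := by rw [← map_mul, inv_mul_cancel, map_one]
  have sqt : ∀ (n : ℕ), (ρ g ^ n + ρ g⁻¹ ^ n) ^ 2 = ρ g ^ (n * 2) + ρ g⁻¹ ^ (n * 2) := by
    intro n
    rw [char2_sq H.h2, ← pow_mul, ← pow_mul]
    have : Commute (ρ g) (ρ g⁻¹) := by rw [commute_iff_eq, h1, h1']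
    exact (this.pow_left n).pow_right n
  have e1 : (t ^ 2) = ρ g ^ 2 + ρ g⁻¹ ^ 2 := by
    rw [← ht]; simpa using sqt 1
  have e8 : g ^ 8 = 1 → t ^ 8 = 0 := by
    intro h
    have : t ^ 8 = ((t ^ 2) ^ 2) ^ 2 := by rw [← pow_mul, ← pow_mul]
    rw [this, e1, sqt 2, sqt 4, ← map_pow, ← map_pow, inv_pow]
    simp [h, char2_add_self H.h2]
  rcases hg with h | h
  · exact Or.inl (e8 h)
  · by_cases g1 : g = 1
    · exact Or.inl (e8 (by rw [g1, one_pow]))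
    · right
      by_cases g3 : g ^ 3 = 1
      · left
        refine ⟨⟨g3, g1⟩, ?_⟩
        rw [← ht, H.inv ⟨g3, g1⟩, char2_add_cancel H.h2]
      · right
        have hX : X3 (g ^ 3) := ⟨by rw [← pow_mul, h], g3⟩
        have e3 := H.inv hX
        rw [map_pow] at e3
        have e4 : ρ (g ^ 3)⁻¹ = ρ g⁻¹ ^ 3 := by rw [← map_pow, inv_pow]
        rw [e4] at e3
        have e5 : t ^ 3 = ρ g ^ 3 + ρ g⁻¹ ^ 3 + t := by
          rw [pow_succ, e1, ← ht, add_mul, mul_add, mul_add]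
          have a1 : ρ g ^ 2 * ρ g⁻¹ = ρ g := by rw [sq, mul_assoc, h1, mul_one]
          have a2 : ρ g⁻¹ ^ 2 * ρ g = ρ g⁻¹ := by rw [sq, mul_assoc, h1', mul_one]
          rw [a1, a2]; noncomm_ring
        rw [e5, e3, char2_add_cancel H.h2, add_comm]

theorem dich {u v : G} (hu : X3 u) (hv : X3 v) :
    (X3 (u * v) ∧ (ρ u + ρ v) ^ 2 = 0 ∧ ¬ X3 (u * v⁻¹)) ∨
    (X3 (u * v⁻¹) ∧ (ρ u + ρ v) ^ 2 = 1 ∧ ¬ X3 (u * v)) := by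
  obtain ⟨t, dt⟩ : ∃ t, t = (ρ u + ρ v) ^ 2 + 1 := ⟨_, rfl⟩
  have z := char2_add_self H.h2
  have ht := H.trace hu hv
  have ht' := H.trace hu hv.inv
  have e : (ρ u + ρ v⁻¹) ^ 2 + 1 = t + 1 := by
    rw [H.inv hv, dt, ← add_assoc, char2_sq H.h2 (Commute.one_right _), one_pow]
  rw [e] at ht'
  rw [← dt] at ht
  have p8 : (t + 1) ^ 8 = t ^ 8 + 1 := by
    have a : ∀ s : R, (s + 1) ^ 2 = s ^ 2 + 1 := by
      intro s; rw [char2_sq H.h2 (Commute.one_right _), one_pow]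
    rw [show 8 = 2 * 2 * 2 by norm_num, pow_mul, pow_mul, a, a, a, pow_mul, pow_mul]
  have tX : ∀ {g : G} {s : R}, X3 g → ρ g + ρ g⁻¹ = s → s = 1 := by
    intro g s hg hs
    rw [← hs, H.inv hg, char2_add_cancel H.h2]
  have hsq : (ρ u + ρ v) ^ 2 = t + 1 := by rw [dt, add_assoc, z, add_zero]
  have p3 : (t + 1) ^ 3 = t + 1 + 1 → t ^ 3 + t ^ 2 = 1 := by
    intro h
    have : (t + 1) ^ 3 = t ^ 3 + t ^ 2 + t + 1 + (t ^ 2 + t ^ 2) + (t + t) := by noncomm_ring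
    rw [this, z, z, add_zero, add_zero, add_assoc, add_assoc t, z, add_zero] at h
    apply char2_eq H.h2
    have h3 : t ^ 3 + t ^ 2 + (t + 1) + t = 0 := by rw [h, z]
    rw [← h3]
    calc t ^ 3 + t ^ 2 + 1 = t ^ 3 + t ^ 2 + 1 + (t + t) := by rw [z, add_zero]
      _ = _ := by abel
  rcases H.trace_cases _ (H.mul u v (Or.inr hu.1) (Or.inr hv.1)) ht with h | ⟨hX, h⟩ | h <;>
  rcases H.trace_cases _ (H.mul u v⁻¹ (Or.inr hu.1) (Or.inr hv.inv.1)) ht' with h' | ⟨hX', h'⟩ | h'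
  · rw [p8, h, zero_add] at h'; exact (H.h1 h').elim
  · right
    have t0 : t = 0 := by simpa using h'
    refine ⟨hX', by rw [hsq, h'], ?_⟩
    intro hX
    exact H.h1 (by rw [← tX hX ht, t0])
  · exfalso
    have h3 := p3 h'
    have h4 : (t ^ 2 * (t + 1)) ^ 8 = 1 := by
      rw [show t ^ 2 * (t + 1) = t ^ 3 + t ^ 2 by noncomm_ring, h3, one_pow]
    have c : Commute (t ^ 2) (t + 1) := ((Commute.refl t).add_right (Commute.one_right t)).pow_left 2
    rw [c.mul_pow, ← pow_mul, mul_comm 2 8, pow_mul, h] at h4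
    simp at h4
    exact H.h1 h4.symm
  · left
    refine ⟨hX, by rw [hsq, h, z], ?_⟩
    intro hX'
    have := tX hX' ht'
    rw [h, z] at this
    exact H.h1 this.symm
  · rw [h, z] at h'; exact (H.h1 h'.symm).elim
  · exfalso
    rw [h, z] at h'
    simp at h'
    exact H.h1 h'.symm
  · exfalso
    rw [p8] at h'
    have h8 : t ^ 8 = 1 := char2_eq H.h2 h'
    have t6 : t ^ 6 = t ^ 2 + 1 := by
      rw [show 6 = 3 * 2 by norm_num, pow_mul, h, char2_sq H.h2 (Commute.one_right _), one_pow]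
    have t7 : t ^ 7 = 1 := by
      rw [pow_succ, t6, add_mul, one_mul, ← pow_succ, h, add_comm t 1, add_assoc, z, add_zero]
    have t1 : t = 1 := by rw [pow_succ, t7, one_mul] at h8; exact h8
    rw [t1, z, one_pow] at h
    exact H.h1 h
  · exfalso
    have t0 : t = 0 := by simpa using h'
    rw [t0] at h
    simp at h
    exact H.h1 h.symm
  · exfalso
    have h3 := p3 h'
    rw [h] at h3
    have t2 : t ^ 2 = t := by
      symm
      apply char2_eq H.h2
      have : t + t ^ 2 + 1 = 1 := (by abel : t + t ^ 2 + 1 = t + 1 + t ^ 2).trans h3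
      simpa using this
    rw [pow_succ, t2, ← sq, t2] at h
    exact H.h1 (by simpa using h.symm)

/-- the relation `u ≈ v` is `X3 (u * v)` -/
theorem rel_iff {u v : G} (hu : X3 u) (hv : X3 v) : X3 (u * v) ↔ (ρ u + ρ v) ^ 2 = 0 := by
  rcases H.dich hu hv with ⟨h1, h2, _⟩ | ⟨_, h2, h3⟩
  · exact ⟨fun _ => h2, fun _ => h1⟩
  · exact ⟨fun h => (h3 h).elim, fun h => (H.h1 (h2.symm.trans h)).elim⟩

theorem rel_or {u v : G} (hu : X3 u) (hv : X3 v) : X3 (u * v) ∨ X3 (u * v⁻¹) := by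
  rcases H.dich hu hv with ⟨h1, _, _⟩ | ⟨h1, _, _⟩
  · exact Or.inl h1
  · exact Or.inr h1

theorem rel_trans {x y z : G} (hx : X3 x) (hy : X3 y) (hz : X3 z) (hxy : X3 (x * y))
    (hxz : X3 (x * z)) : X3 (y * z) := by
  rcases H.dich hy hz with ⟨h1, _, _⟩ | ⟨_, hyz, _⟩
  · exact h1
  exfalso
  have Z := char2_add_self H.h2
  have ZZ := char2_add_cancel H.h2
  have hm := (H.rel_iff hx hy).mp hxy
  have hm' := (H.rel_iff hx hz).mp hxz
  obtain ⟨X, dX⟩ : ∃ X, X = ρ x := ⟨_, rfl⟩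
  obtain ⟨m, dm⟩ : ∃ m, m = ρ x + ρ y := ⟨_, rfl⟩
  obtain ⟨n, dn⟩ : ∃ n, n = ρ x + ρ z := ⟨_, rfl⟩
  have hY : ρ y = X + m := by rw [dm, dX, ZZ]
  have hZ : ρ z = X + n := by rw [dn, dX, ZZ]
  have hXX : X * X = X + 1 := by rw [dX]; exact H.hx x hx
  have hYY := H.hx y hy
  have hZZ := H.hx z hz
  rw [← dm, sq] at hm
  rw [← dn, sq] at hm'
  rw [hY, hZ, show X + m + (X + n) = m + n + (X + X) by abel, Z, add_zero, sq, add_mul, mul_add,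
    mul_add, hm, hm', zero_add, add_zero] at hyz
  have hmX : m * X = X * m + m := by
    rw [hY, add_mul, mul_add, mul_add, hXX, hm, add_zero] at hYY
    have : X * m + m * X = m := by
      have e : X + 1 + (X * m + m * X) = X + 1 + m := by
        rw [← add_assoc, hYY]; abel
      exact add_left_cancel e
    rw [← ZZ (X * m) (m * X), this]
  have hnX : n * X = X * n + n := by
    rw [hZ, add_mul, mul_add, mul_add, hXX, hm', add_zero] at hZZ
    have : X * n + n * X = n := by
      have e : X + 1 + (X * n + n * X) = X + 1 + n := by
        rw [← add_assoc, hZZ]; abel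
      exact add_left_cancel e
    rw [← ZZ (X * n) (n * X), this]
  have hnm : n * m = m * n + 1 := by
    rw [← hyz, ZZ]
  have hXX' : ∀ t, X * (X * t) = X * t + t := by
    intro t; rw [← mul_assoc, hXX, add_mul, one_mul]
  have hmX' : ∀ t, m * (X * t) = X * (m * t) + m * t := by
    intro t; rw [← mul_assoc, hmX, add_mul, mul_assoc]
  have hnX' : ∀ t, n * (X * t) = X * (n * t) + n * t := by
    intro t; rw [← mul_assoc, hnX, add_mul, mul_assoc]
  have hnm' : ∀ t, n * (m * t) = m * (n * t) + t := by
    intro t; rw [← mul_assoc, hnm, add_mul, mul_assoc, one_mul]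
  have hmm' : ∀ t, m * (m * t) = 0 := by
    intro t; rw [← mul_assoc, hm, zero_mul]
  have hnn' : ∀ t, n * (n * t) = 0 := by
    intro t; rw [← mul_assoc, hm', zero_mul]
  have two : ∀ a : R, (2 : ℤ) • a = 0 := by
    intro a; rw [two_zsmul, Z]
  have hg : ρ (y * z * x) = 1 + n + X * m + X * (m * n) := by
    rw [map_mul, map_mul, hY, hZ, ← dX]
    apply char2_eq H.h2
    simp only [mul_add, add_mul, mul_assoc, mul_one, one_mul, hXX, hXX', hmX, hmX', hnX, hnX',
      hnm, hnm', hm, hm', hmm', hnn', mul_zero, add_zero, zero_add]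
    simp only [add_comm, add_left_comm, add_assoc, Z, ZZ, add_zero]
  have hg2 : ρ (y * z * x) ^ 5 = 1 := by
    rw [hg]
    apply char2_eq H.h2
    simp only [pow_succ, pow_zero, mul_add, add_mul, mul_assoc, mul_one, one_mul, hXX, hXX', hmX, hmX', hnX, hnX',
      hnm, hnm', hm, hm', hmm', hnn', mul_zero, add_zero, zero_add]
    simp only [add_comm, add_left_comm, add_assoc, Z, ZZ, add_zero]
  have hg1 : ρ (y * z * x) = 1 := by
    have key : ∀ N : ℕ, (y * z * x) ^ N = 1 → Nat.Coprime N 5 → ρ (y * z * x) = 1 := by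
      intro N hN hc
      have hcop : Nat.Coprime (orderOf (y * z * x)) 5 :=
        Nat.Coprime.coprime_dvd_left (orderOf_dvd_of_pow_eq_one hN) hc
      obtain ⟨k, hk⟩ := exists_pow_eq_self_of_coprime hcop.symm
      rw [← hk, map_pow, map_pow, hg2, one_pow]
    rcases H.pe (y * z * x) with ⟨k, hk⟩ | ⟨k, hk⟩
    · exact key _ hk (Nat.Coprime.pow_left k (by norm_num))
    · exact key _ hk (Nat.Coprime.pow_left k (by norm_num))
  have h0 : n + X * m + X * (m * n) = 0 := by
    have : 1 + (n + X * m + X * (m * n)) = 1 :=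
      (by abel : 1 + (n + X * m + X * (m * n)) = 1 + n + X * m + X * (m * n)).trans
        (hg.symm.trans hg1)
    simpa using this
  have h3 : m * n = 0 := by
    have h4 := congrArg (· * n) h0
    simp only [add_mul, mul_assoc, hm', mul_zero, zero_mul, add_zero, zero_add] at h4
    have h5 := hXX' (m * n)
    rw [h4, mul_zero, zero_add] at h5
    exact h5.symm
  rw [h3, mul_zero, add_zero] at h0
  have h6 := congrArg (· * m) h0
  simp only [add_mul, mul_assoc, hm, mul_zero, zero_mul, add_zero] at h6
  rw [h3, h6, add_zero] at hyz
  exact H.h1 hyz.symm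

end RP
end Rep


section RepMain
variable {G : Type*} [Group G] {R : Type*} [Ring R]

theorem X3.inv_inv {u v : G} (h : X3 (u * v)) : X3 (u⁻¹ * v⁻¹) := by
  have := h.swap.inv
  rwa [mul_inv_rev] at this

namespace RP
variable {ρ : G →* R} (H : RP G R ρ)
include H

theorem prod {u v z : G} (hu : X3 u) (hv : X3 v) (hz : X3 z) (huv : X3 (u * v))
    (hvz : X3 (v * z)) : X3 (u * v * z⁻¹) := by
  have h1 : X3 (u * z) := H.rel_trans hv hu hz huv.swap hvz
  exact H.rel_trans hu.inv huv hz.inv (by simpa using hv) h1.inv_inv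

theorem mem_N {x y : G} (hx : X3 x) (hy : X3 y) (hxy : X3 (x * y)) : y * x⁻¹ ∈ Nsub G := by
  intro z hz
  rcases H.rel_or hz hx with h | h
  · rw [← mul_assoc]
    exact H.prod hz hy hx (H.rel_trans hx hz hy h.swap hxy) hxy.swap
  · have h1 : X3 (x⁻¹ * z) := h.swap
    have h2 : X3 (y * (x⁻¹ * z)) := H.rel_trans hx hy h1 hxy (by simpa using hz)
    rw [← mul_assoc] at h2
    exact h2.swap

theorem main {x y : G} (hx : X3 x) (hy : X3 y) : y * x⁻¹ ∈ Nsub G ∨ y * x ∈ Nsub G := by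
  rcases H.rel_or hx hy with h | h
  · exact Or.inl (H.mem_N hx hy h)
  · right
    have h1 : X3 (x⁻¹ * y) := by simpa using h.inv_inv
    simpa using H.mem_N hx.inv hy h1

end RP
end RepMain

/-! ### Construction of the representation -/

section RepCon
variable {G : Type*} [Group G]

/-- involutions (and 1) in the normal 2-subgroup -/
def Eset (G : Type*) [Group G] : Set G := {e | e ∈ Nsub G ∧ e ^ 2 = 1}

theorem Eset_conj {e : G} (he : e ∈ Eset G) (g : G) : g * e * g⁻¹ ∈ Eset G :=
  ⟨Nsub.normal.conj_mem e he.1 g, conj_pow_one he.2⟩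

theorem Eset_closure_le : Subgroup.closure (Eset G) ≤ Nsub G :=
  (Subgroup.closure_le _).mpr fun _ he => he.1

theorem comm_closure {z : G} (hz : ∀ e ∈ Eset G, Commute z e) {w : G}
    (hw : w ∈ Subgroup.closure (Eset G)) : Commute z w := by
  have : Subgroup.closure (Eset G) ≤ Subgroup.centralizer {z} := by
    rw [Subgroup.closure_le]
    intro e he
    rw [SetLike.mem_coe, Subgroup.mem_centralizer_singleton_iff]
    exact (hz e he).eq.symm
  have := this hw
  rw [Subgroup.mem_centralizer_singleton_iff] at this
  exact this.symm

/-- the elementary abelian normal subgroup -/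
def Asub (G : Type*) [Group G] : Subgroup G where
  carrier := {z | z ∈ Subgroup.closure (Eset G) ∧ (∀ e ∈ Eset G, Commute z e) ∧ z ^ 2 = 1}
  one_mem' := ⟨Subgroup.one_mem _, fun _ _ => Commute.one_left _, one_pow 2⟩
  mul_mem' := fun {a b} ha hb => ⟨Subgroup.mul_mem _ ha.1 hb.1,
    fun e he => (ha.2.1 e he).mul_left (hb.2.1 e he), by
      rw [(comm_closure ha.2.1 hb.1).mul_pow, ha.2.2, hb.2.2, one_mul]⟩
  inv_mem' := fun {a} ha => ⟨Subgroup.inv_mem _ ha.1, fun e he => (ha.2.1 e he).inv_left, by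
    rw [inv_pow, ha.2.2, inv_one]⟩

theorem mem_Asub {z : G} : z ∈ Asub G ↔
    z ∈ Subgroup.closure (Eset G) ∧ (∀ e ∈ Eset G, Commute z e) ∧ z ^ 2 = 1 := Iff.rfl

instance Asub.normal : (Asub G).Normal := by
  constructor
  intro z hz g
  have hn : (Subgroup.closure (Eset G)).Normal := by
    constructor
    intro w hw g
    induction hw using Subgroup.closure_induction with
    | mem e he => exact Subgroup.subset_closure (Eset_conj he g)
    | one => simpa using Subgroup.one_mem _
    | mul u v _ _ hu hv =>
      have h : g * (u * v) * g⁻¹ = (g * u * g⁻¹) * (g * v * g⁻¹) := by group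
      rw [h]; exact Subgroup.mul_mem _ hu hv
    | inv u _ hu =>
      have h : g * u⁻¹ * g⁻¹ = (g * u * g⁻¹)⁻¹ := by group
      rw [h]; exact Subgroup.inv_mem _ hu
  refine ⟨hn.conj_mem z hz.1 g, ?_, conj_pow_one hz.2.2⟩
  intro e he
  have h1 := hz.2.1 _ (Eset_conj he g⁻¹)
  rw [inv_inv] at h1
  rw [commute_iff_eq] at h1 ⊢
  calc g * z * g⁻¹ * e = g * (z * (g⁻¹ * e * g)) * g⁻¹ := by group
    _ = e * (g * z * g⁻¹) := by rw [h1]; group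

theorem Asub_comm (a b : Asub G) : a * b = b * a :=
  Subtype.ext (comm_closure a.2.2.1 b.2.1).eq

theorem Asub_le : Asub G ≤ Nsub G := fun _ h => Eset_closure_le h.1

theorem Asub_nontrivial (H : HH G) (hex : ∃ x : G, X3 x) {e t : G} (he : e ^ 2 = 1) (he1 : e ≠ 1)
    (ht : t ^ 3 = 1) (hte : (t * e) ^ 3 = 1) : ∃ z ∈ Asub G, z ≠ 1 := by
  have heE : e ∈ Eset G := by
    refine ⟨?_, he⟩
    intro y hy
    rcases H.f3' he he1 ht hte hy.1 with h | h
    · exact h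
    · exact (hy.2 h).elim
  by_cases hc : ∀ h ∈ Eset G, Commute e h
  · exact ⟨e, ⟨Subgroup.subset_closure heE, hc, he⟩, he1⟩
  · push Not at hc
    obtain ⟨h, hh, hne⟩ := hc
    have hz : e * h ∈ Nsub G := Subgroup.mul_mem _ heE.1 hh.1
    have hz1 : (e * h) ^ 2 ≠ 1 := by
      intro h1
      apply hne
      rw [commute_iff_eq]
      have h2 : (e * h)⁻¹ = e * h := inv_of_sq h1
      rw [mul_inv_rev, inv_of_sq he, inv_of_sq hh.2] at h2
      exact h2.symm
    have hz8 : ((e * h) ^ 2) ^ (2 ^ 3) = 1 := by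
      rw [← pow_mul, mul_comm, pow_mul, show 2 ^ 3 = 8 by norm_num, Nsub_eight H hex hz, one_pow]
    obtain ⟨k, hk, hk1⟩ := exists_invol_power 3 hz8 hz1
    refine ⟨((e * h) ^ 2) ^ k, ⟨?_, ?_, hk⟩, hk1⟩
    · exact Subgroup.pow_mem _ (Subgroup.pow_mem _ (Subgroup.mul_mem _
        (Subgroup.subset_closure heE) (Subgroup.subset_closure hh)) _) _
    · intro f hf
      have hle : Subgroup.closure {e, h, f} ≤ Nsub G := by
        rw [Subgroup.closure_le]
        rintro u (rfl | rfl | rfl)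
        · exact heE.1
        · exact hh.1
        · exact hf.1
      refine (w_EN he hh.2 hf.2 ?_ ?_).pow_left k
      · intro u hu v hv
        have := Nsub_engel hex (hle hu) ((Nsub G).inv_mem (hle hv))
        simpa using this
      · intro u hu
        exact Nsub_eight H hex (hle hu)

instance Asub.commGroup : CommGroup (Asub G) := { (inferInstance : Group (Asub G)) with
  mul_comm := Asub_comm }

/-- conjugation representation -/
def conjRep (G : Type*) [Group G] : G →* AddMonoid.End (Additive (Asub G)) where
  toFun g := MonoidHom.toAdditive (MulAut.conjNormal g : MulAut (Asub G)).toMonoidHom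
  map_one' := by
    ext a
    change (((MulAut.conjNormal (1 : G) : MulAut (Asub G)) a.toMul : Asub G) : G)
      = ((a.toMul : Asub G) : G)
    simp
  map_mul' := fun g h => by
    ext a
    change (((MulAut.conjNormal (g * h) : MulAut (Asub G)) a.toMul : Asub G) : G)
      = (((MulAut.conjNormal g : MulAut (Asub G))
        ((MulAut.conjNormal h : MulAut (Asub G)) a.toMul) : Asub G) : G)
    simp

theorem conjRep_apply (g : G) (a : Additive (Asub G)) :
    (((conjRep G g a).toMul : Asub G) : G) = g * (a.toMul : Asub G) * g⁻¹ := by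
  change (((MulAut.conjNormal g : MulAut (Asub G)) a.toMul : Asub G) : G) = _
  simp

theorem conjRep_RP (H : HH G) (hex : ∃ x : G, X3 x) (hne : ∃ z ∈ Asub G, z ≠ 1) :
    RP G _ (conjRep G) where
  pe := H.pe
  mul := H.mul
  h2 := by
    rw [← one_add_one_eq_two]
    ext a
    have h := a.toMul.2.2.2
    rw [sq] at h
    change ((a.toMul : Asub G) : G) * ((a.toMul : Asub G) : G) = 1
    exact h
  h1 := by
    intro h
    obtain ⟨z, hz, hz1⟩ := hne
    have := congrArg (fun f => (((f (Additive.ofMul (⟨z, hz⟩ : Asub G))).toMul : Asub G) : G)) h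
    exact hz1 (by simpa using this)
  hx := by
    intro x hx
    ext a
    have h := Nsub_split (Asub_le a.toMul.2) hx
    have ha := a.toMul.2.2.2
    rw [← map_mul, cube_sq hx.1]
    change (((conjRep G x⁻¹ a).toMul : Asub G) : G)
      = (((conjRep G x a).toMul : Asub G) : G) * ((a.toMul : Asub G) : G)
    rw [conjRep_apply, conjRep_apply, inv_inv]
    have hb : (x * (a.toMul : Asub G) * x⁻¹) ^ 2 = (1 : G) := conj_pow_one ha
    rw [mul_assoc, mul_eq_one_iff_inv_eq, inv_of_sq hb] at h
    rw [h, mul_assoc (x⁻¹ * _ * x), sq_self ha, mul_one]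

theorem caseA_main (H : HH G) (hex : ∃ x : G, X3 x) {e t : G} (he : e ^ 2 = 1) (he1 : e ≠ 1)
    (ht : t ^ 3 = 1) (hte : (t * e) ^ 3 = 1) {x y : G} (hx : X3 x) (hy : X3 y) :
    y * x⁻¹ ∈ Nsub G ∨ y * x ∈ Nsub G :=
  (conjRep_RP H hex (Asub_nontrivial H hex he he1 ht hte)).main hx hy

end RepCon


/-! ### Case A: conclusion -/

/-- Case A data -/
structure CA (G : Type*) [Group G] : Prop extends HH G where
  exX : ∃ x : G, X3 x
  main : ∀ x y : G, X3 x → X3 y → y * x⁻¹ ∈ Nsub G ∨ y * x ∈ Nsub G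

namespace CA
variable {G : Type*} [Group G]

theorem mem_iff {g : G} : QuotientGroup.mk' (Nsub G) g = 1 ↔ g ∈ Nsub G :=
  QuotientGroup.eq_one_iff g

theorem N_le_Omega (hex : ∃ x : G, X3 x) : Nsub G ≤ Omega G := by
  obtain ⟨x, hx⟩ := hex
  intro n hn
  have e : n = x⁻¹ * (x * n) := by group
  rw [e]
  exact Subgroup.mul_mem _ (Subgroup.subset_closure (Or.inr hx.inv.1))
    (Subgroup.subset_closure (Or.inr (hn x hx).1))

/-- conjugacy in `N x` -/
theorem conj_N (H : HH G) {u n : G} (hu : X3 u) (hn : n ∈ Nsub G) :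
    ∃ p ∈ Nsub G, p⁻¹ * u * p = u * n := by
  have h8 := Nsub_eight H ⟨u, hu⟩ hn
  have hs := Nsub_split hn hu
  have c1 := Nsub_comm hn hu
  have c2 := Nsub_comm hn hu.inv
  rw [inv_inv] at c2
  obtain ⟨b, db⟩ : ∃ b, b = u * n * u⁻¹ := ⟨_, rfl⟩
  obtain ⟨c, dc⟩ : ∃ c, c = u⁻¹ * n * u := ⟨_, rfl⟩
  have hb : b ∈ Nsub G := by rw [db]; exact Nsub.normal.conj_mem n hn u
  rw [← db, ← dc] at hs
  rw [← db] at c1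
  rw [← dc] at c2
  refine ⟨(n * b⁻¹) ^ 3, Subgroup.pow_mem _ (Subgroup.mul_mem _ hn (Subgroup.inv_mem _ hb)) 3, ?_⟩
  have e1 : u⁻¹ * ((n * b⁻¹) ^ 3)⁻¹ * u = (n * c⁻¹) ^ 3 := by
    have h1 : u⁻¹ * (n * b⁻¹)⁻¹ * u = n * c⁻¹ := by
      rw [db, dc]
      have : u⁻¹ * (n * (u * n * u⁻¹)⁻¹)⁻¹ * u = n * (u⁻¹ * n * u)⁻¹ := by group
      exact this
    have h2 : u⁻¹ * ((n * b⁻¹)⁻¹) ^ 3 * u = (u⁻¹ * (n * b⁻¹)⁻¹ * u) ^ 3 := by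
      simp only [pow_succ, pow_zero, one_mul]; group
    rw [← inv_pow, h2, h1]
  have e2 : (n * c⁻¹) ^ 3 * (n * b⁻¹) ^ 3 = n := by
    have hbc : b * c = n⁻¹ := by rw [eq_inv_iff_mul_eq_one]; exact hs
    have hc : c = b⁻¹ * n⁻¹ := by rw [← hbc]; group
    have e3 : n * c⁻¹ = n ^ 2 * b := by
      rw [hc, mul_inv_rev, inv_inv, inv_inv, sq, mul_assoc]
    rw [e3, (c1.pow_left 2).mul_pow, c1.inv_right.mul_pow]
    have c3 : Commute (b ^ 3) (n ^ 3) := (c1.symm.pow_left 3).pow_right 3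
    calc (n ^ 2) ^ 3 * b ^ 3 * (n ^ 3 * b⁻¹ ^ 3) = (n ^ 2) ^ 3 * (b ^ 3 * n ^ 3) * b⁻¹ ^ 3 := by group
      _ = (n ^ 2) ^ 3 * (n ^ 3 * b ^ 3) * b⁻¹ ^ 3 := by rw [c3.eq]
      _ = n ^ 8 * n := by group
      _ = n := by rw [h8, one_mul]
  calc ((n * b⁻¹) ^ 3)⁻¹ * u * (n * b⁻¹) ^ 3
      = u * ((u⁻¹ * ((n * b⁻¹) ^ 3)⁻¹ * u) * (n * b⁻¹) ^ 3) := by group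
    _ = u * n := by rw [e1, e2]

theorem LFG_N (H : HH G) (hex : ∃ x : G, X3 x) : LFG (Nsub G) := by
  apply LFG.of_cover
  intro n
  refine ⟨Subgroup.normalClosure {n}, inferInstance,
    Subgroup.subset_normalClosure (Set.mem_singleton n), ?_⟩
  have hS : ∀ u ∈ Group.conjugatesOfSet {n}, ∀ v ∈ Group.conjugatesOfSet {n}, v * u = u * v := by
    intro u hu v hv
    rw [Group.mem_conjugatesOfSet_iff] at hu hv
    obtain ⟨a, ha, hu⟩ := hu
    obtain ⟨b, hb, hv⟩ := hv
    rw [Set.mem_singleton_iff] at ha hb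
    rw [ha, isConj_iff] at hu
    rw [hb, isConj_iff] at hv
    obtain ⟨p, rfl⟩ := hu
    obtain ⟨q, rfl⟩ := hv
    apply Subtype.ext
    have h := Nsub_engel hex (Nsub.normal.conj_mem _ n.2 (q : G))
      ((p * q⁻¹ : Nsub G)).2
    have e := h.eq
    push_cast at e ⊢
    have e2 : (p : G) * (q : G)⁻¹ * ((q : G) * n * (q : G)⁻¹) * ((p : G) * (q : G)⁻¹)⁻¹
      = p * n * (p : G)⁻¹ := by group
    rw [e2] at e
    exact e
  have h1 : Subgroup.closure (Group.conjugatesOfSet {n}) ≤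
      Subgroup.centralizer (Subgroup.closure (Group.conjugatesOfSet {n}) : Set (Nsub G)) := by
    rw [Subgroup.centralizer_closure, Subgroup.closure_le]
    intro u hu
    rw [SetLike.mem_coe, Subgroup.mem_centralizer_iff]
    intro v hv
    exact hS u hu v hv
  apply LFG.of_comm
  · intro a b
    apply Subtype.ext
    exact (Subgroup.mem_centralizer_iff.mp (h1 b.2) a a.2)
  · intro a
    refine ⟨8, by norm_num, ?_⟩
    apply Subtype.ext
    apply Subtype.ext
    have := Nsub_eight H hex (a : Nsub G).2
    push_cast
    exact this

variable (H : CA G)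
include H

theorem f1 {x g : G} (hx : X3 x) {k : ℕ} (hg : g ^ (2 ^ k) = 1)
    (hc : Commute (QuotientGroup.mk' (Nsub G) g) (QuotientGroup.mk' (Nsub G) x)) :
    g ∈ Nsub G := by
  rw [← mem_iff]
  rcases H.pe (x * g) with ⟨n, hn⟩ | ⟨n, hn⟩
  · exfalso
    have h1 := congrArg (QuotientGroup.mk' (Nsub G)) hn
    have h2 := congrArg (QuotientGroup.mk' (Nsub G)) hg
    rw [map_pow, map_one] at h1 h2
    rw [map_mul, hc.symm.mul_pow] at h1
    have h3 := congrArg (fun t => t ^ (2 ^ k)) h1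
    simp only [one_pow] at h3
    rw [((hc.symm.pow_left _).pow_right _).mul_pow, ← pow_mul, ← pow_mul, mul_comm (2 ^ n) (2 ^ k),
      pow_mul (QuotientGroup.mk' (Nsub G) g), h2, one_pow, mul_one, ← pow_add] at h3
    have h4 := congrArg (QuotientGroup.mk' (Nsub G)) hx.1
    rw [map_pow, map_one] at h4
    have h5 := eq_one_of_coprime (Nat.Coprime.pow_left (k + n) (by norm_num : Nat.Coprime 2 3)) h3 h4
    exact Nsub_not_X3 (mem_iff.mp h5) hx
  · have h1 := congrArg (QuotientGroup.mk' (Nsub G)) hn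
    have h2 := congrArg (QuotientGroup.mk' (Nsub G)) hg
    have h4 := congrArg (QuotientGroup.mk' (Nsub G)) hx.1
    rw [map_pow, map_one] at h1 h2 h4
    rw [map_mul, hc.symm.mul_pow] at h1
    have h3 := congrArg (fun t => t ^ 3) h1
    simp only [one_pow] at h3
    rw [((hc.symm.pow_left _).pow_right _).mul_pow, ← pow_mul, mul_comm (3 ^ n) 3,
      pow_mul (QuotientGroup.mk' (Nsub G) x), h4, one_pow, one_mul, ← pow_mul, ← pow_succ] at h3
    exact eq_one_of_coprime (Nat.Coprime.pow k (n + 1) (by norm_num : Nat.Coprime 2 3)) h2 h3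

theorem conj_cases {x : G} (hx : X3 x) (g : G) :
    Commute (QuotientGroup.mk' (Nsub G) g) (QuotientGroup.mk' (Nsub G) x) ∨
      g * x * g⁻¹ * x ∈ Nsub G := by
  rcases H.main x (g * x * g⁻¹) hx (hx.conj g) with h | h
  · left
    rw [← mem_iff, map_mul, map_mul, map_mul, map_inv, map_inv, mul_inv_eq_one,
      mul_inv_eq_iff_eq_mul] at h
    exact h
  · exact Or.inr h

theorem not_comm_three {x g : G} (hx : X3 x) (hg : g * x * g⁻¹ * x ∈ Nsub G) {n : ℕ}
    (h3 : g ^ (3 ^ n) = 1) : False := by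
  rw [← mem_iff, map_mul, map_mul, map_mul, map_inv, mul_eq_one_iff_eq_inv] at hg
  have h1 := congrArg (QuotientGroup.mk' (Nsub G)) h3
  have h4 := congrArg (QuotientGroup.mk' (Nsub G)) hx.1
  rw [map_pow, map_one] at h1 h4
  obtain ⟨γ, dγ⟩ : ∃ γ, γ = QuotientGroup.mk' (Nsub G) g := ⟨_, rfl⟩
  obtain ⟨ξ, dξ⟩ : ∃ ξ, ξ = QuotientGroup.mk' (Nsub G) x := ⟨_, rfl⟩
  rw [← dγ, ← dξ] at hg
  rw [← dγ] at h1
  rw [← dξ] at h4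
  have hinv : γ * ξ⁻¹ * γ⁻¹ = ξ := by
    have := congrArg (·⁻¹) hg
    simpa [mul_assoc] using this
  have hodd : ∀ m : ℕ, γ ^ (2 * m + 1) * ξ * (γ ^ (2 * m + 1))⁻¹ = ξ⁻¹ := by
    intro m
    induction m with
    | zero => simpa using hg
    | succ m ih =>
      have e : γ ^ (2 * (m + 1) + 1) * ξ * (γ ^ (2 * (m + 1) + 1))⁻¹
          = γ * (γ * (γ ^ (2 * m + 1) * ξ * (γ ^ (2 * m + 1))⁻¹) * γ⁻¹) * γ⁻¹ := by
        rw [show 2 * (m + 1) + 1 = (2 * m + 1) + 1 + 1 by ring, pow_succ', pow_succ']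
        simp only [mul_inv_rev, mul_assoc]
      rw [e, ih, hinv, hg]
  obtain ⟨m, hm⟩ := (Odd.pow (n := n) (by decide : Odd 3) : Odd (3 ^ n))
  have h5 := hodd m
  rw [← hm, h1, one_mul, inv_one, mul_one] at h5
  have h6 : ξ ^ 2 = 1 := by rw [sq]; nth_rw 1 [h5]; simp
  have h7 := eq_one_of_coprime (by norm_num : Nat.Coprime 2 3) h6 h4
  rw [dξ] at h7
  exact Nsub_not_X3 (mem_iff.mp h7) hx

/-- elements outside `C` -/
theorem outside {x g : G} (hx : X3 x) (hg : g * x * g⁻¹ * x ∈ Nsub G) :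
    g ^ 8 = 1 ∧ g ^ 2 ∈ Nsub G ∧ ∃ p ∈ Nsub G, (p * g) ^ 2 = 1 := by
  have hn : x⁻¹ * (g * x⁻¹ * g⁻¹) ∈ Nsub G := by
    have := Subgroup.inv_mem _ hg
    have e : (g * x * g⁻¹ * x)⁻¹ = x⁻¹ * (g * x⁻¹ * g⁻¹) := by group
    rwa [e] at this
  obtain ⟨p, hp, hpx⟩ := conj_N H.toHH hx hn
  rw [mul_inv_cancel_left] at hpx
  have hax : (p * g) * x⁻¹ * (p * g)⁻¹ = x := by
    calc (p * g) * x⁻¹ * (p * g)⁻¹ = p * (g * x⁻¹ * g⁻¹) * p⁻¹ := by group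
      _ = x := by rw [← hpx]; group
  have hax' : (p * g) * x * (p * g)⁻¹ = x⁻¹ := by
    have := congrArg (·⁻¹) hax
    simpa [mul_assoc] using this
  have haN : (p * g) * x * (p * g)⁻¹ * x ∈ Nsub G := by
    rw [hax', inv_mul_cancel]; exact Subgroup.one_mem _
  have ha2 : (p * g) ^ 2 = 1 := by
    rcases H.pe (p * g) with ⟨k, hk⟩ | ⟨k, hk⟩
    · have hc : Commute ((p * g) ^ 2) x := by
        rw [commute_iff_eq, ← mul_inv_eq_iff_eq_mul]
        calc (p * g) ^ 2 * x * ((p * g) ^ 2)⁻¹ = (p * g) * ((p * g) * x * (p * g)⁻¹) * (p * g)⁻¹ := by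
              rw [sq]; group
          _ = x := by rw [hax', hax]
      rcases H.toHH.comm_cases (n := k) (m := 1) hc (by rw [← pow_mul, mul_comm, pow_mul, hk, one_pow])
        (by simpa using hx.1) with h | h
      · exact h
      · exact (hx.2 h).elim
    · exact (H.not_comm_three hx haN hk).elim
  refine ⟨?_, ?_, p, hp, ha2⟩
  · have hxa : (x * (p * g)) ^ 2 = 1 := by
      have : (x * (p * g)) ^ 2 = x * ((p * g) * x * (p * g)⁻¹) * (p * g) ^ 2 := by
        rw [sq, sq]; group
      rw [this, hax', ha2]; group
    have h := H.mul (p⁻¹ * x⁻¹) (x * (p * g))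
      (Or.inr (hx.inv |> (Subgroup.inv_mem _ hp : p⁻¹ ∈ Nsub G) x⁻¹).swap.1)
      (Or.inl (pow_four_of_sq hxa))
    have e : p⁻¹ * x⁻¹ * (x * (p * g)) = g := by group
    rw [e] at h
    rcases h with h | h
    · exact h
    · exact (H.not_comm_three (n := 2) hx hg (by simpa using h)).elim
  · have h1 := congrArg (QuotientGroup.mk' (Nsub G)) ha2
    rw [map_pow, map_mul, mem_iff.mpr hp, one_mul, map_one, ← map_pow] at h1
    exact mem_iff.mp h1

theorem final : LFG (Omega G) ∧ (∀ w ∈ Omega G, w ^ 72 = 1) ∧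
    (∀ q : G ⧸ Omega G, ∃ k : ℕ, orderOf q = 3 ^ k) := by
  obtain ⟨x, hx⟩ := H.exX
  have hex : ∃ x : G, X3 x := ⟨x, hx⟩
  have hk : LFG (QuotientGroup.mk' (Nsub G)).ker := by
    rw [QuotientGroup.ker_mk']; exact LFG_N H.toHH hex
  have two_dec : ∀ {w : G} {k : ℕ}, w ^ k ∈ Nsub G → w ^ (k * 8) = 1 := by
    intro w k h
    rw [pow_mul]; exact Nsub_eight H.toHH hex h
  by_cases hC : ∀ g : G, Commute (QuotientGroup.mk' (Nsub G) g) (QuotientGroup.mk' (Nsub G) x)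
  · -- everything centralizes x modulo N
    have hle : Omega G ≤ (Subgroup.zpowers (QuotientGroup.mk' (Nsub G) x)).comap
        (QuotientGroup.mk' (Nsub G)) := by
      unfold Omega
      rw [Subgroup.closure_le]
      intro g hg
      rw [SetLike.mem_coe, Subgroup.mem_comap]
      rcases hg with h | h
      · have := H.f1 hx (k := 1) (by simpa using h) (hC g)
        rw [mem_iff.mpr this]; exact Subgroup.one_mem _
      · by_cases h1 : g = 1
        · rw [h1, map_one]; exact Subgroup.one_mem _
        · rcases H.main x g hx ⟨h, h1⟩ with h2 | h2
          · rw [← mem_iff, map_mul, map_inv, mul_inv_eq_one] at h2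
            rw [h2]; exact Subgroup.mem_zpowers _
          · rw [← mem_iff, map_mul, mul_eq_one_iff_eq_inv] at h2
            rw [h2]; exact Subgroup.inv_mem _ (Subgroup.mem_zpowers _)
    have h3 : ∀ w ∈ Omega G, w ^ 3 ∈ Nsub G := by
      intro w hw
      rw [← mem_iff, map_pow]
      refine pow_of_mem_zpowers (hle hw) ?_
      rw [← map_pow, hx.1, map_one]
    refine ⟨?_, ?_, ?_⟩
    · apply LFG.sub_ext (QuotientGroup.mk' (Nsub G)) _ hk
      apply LFG.of_comm
      · rintro ⟨a, ha⟩ ⟨b, hb⟩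
        apply Subtype.ext
        obtain ⟨a', ha', rfl⟩ := ha
        obtain ⟨b', hb', rfl⟩ := hb
        obtain ⟨i, hi⟩ := Subgroup.mem_zpowers_iff.mp (Subgroup.mem_comap.mp (hle ha'))
        obtain ⟨j, hj⟩ := Subgroup.mem_zpowers_iff.mp (Subgroup.mem_comap.mp (hle hb'))
        simp only [Subgroup.coe_mul]
        rw [← hi, ← hj]
        exact (Commute.zpow_zpow_self _ i j).eq
      · rintro ⟨a, ha⟩
        obtain ⟨a', ha', rfl⟩ := ha
        refine ⟨3, by norm_num, ?_⟩
        apply Subtype.ext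
        simp only [Subgroup.coe_pow]
        rw [← map_pow]
        exact mem_iff.mpr (h3 a' ha')
    · intro w hw
      have := two_dec (h3 w hw)
      rw [show 72 = 3 * 8 * 3 by norm_num, pow_mul, this, one_pow]
    · intro q
      obtain ⟨g, rfl⟩ := QuotientGroup.mk_surjective q
      rcases H.pe g with ⟨n, hn⟩ | ⟨n, hn⟩
      · refine ⟨0, ?_⟩
        have := N_le_Omega hex (H.f1 hx hn (hC g))
        rw [(QuotientGroup.eq_one_iff g).mpr this]; simp
      · have : (g : G ⧸ Omega G) ^ (3 ^ n) = 1 := by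
          rw [← QuotientGroup.mk_pow, hn, QuotientGroup.mk_one]
        obtain ⟨k, _, h⟩ := (Nat.dvd_prime_pow Nat.prime_three).mp (orderOf_dvd_of_pow_eq_one this)
        exact ⟨k, h⟩
  · push Not at hC
    obtain ⟨g, hg⟩ := hC
    have out : ∀ w : G, ¬ Commute (QuotientGroup.mk' (Nsub G) w) (QuotientGroup.mk' (Nsub G) x) →
        w ^ 8 = 1 ∧ w ^ 2 ∈ Nsub G ∧ ∃ p ∈ Nsub G, (p * w) ^ 2 = 1 := by
      intro w hw
      rcases H.conj_cases hx w with h | h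
      · exact (hw h).elim
      · exact H.outside hx h
    have outg : ∀ w : G, Commute (QuotientGroup.mk' (Nsub G) w) (QuotientGroup.mk' (Nsub G) x) →
        ¬ Commute (QuotientGroup.mk' (Nsub G) (g * w)) (QuotientGroup.mk' (Nsub G) x) := by
      intro w hw h
      apply hg
      have := h.mul_left hw.inv_left
      rwa [← map_inv, ← map_mul, mul_inv_cancel_right] at this
    have omem : ∀ w : G, ¬ Commute (QuotientGroup.mk' (Nsub G) w) (QuotientGroup.mk' (Nsub G) x) →
        w ∈ Omega G := by
      intro w hw
      obtain ⟨_, _, p, hp, h2⟩ := out w hw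
      have e : w = p⁻¹ * (p * w) := by group
      rw [e]
      exact Subgroup.mul_mem _ (Subgroup.inv_mem _ (N_le_Omega hex hp))
        (Subgroup.subset_closure (Or.inl h2))
    have oall : ∀ w : G, w ∈ Omega G := by
      intro w
      by_cases hw : Commute (QuotientGroup.mk' (Nsub G) w) (QuotientGroup.mk' (Nsub G) x)
      · have e : w = g⁻¹ * (g * w) := by group
        rw [e]
        exact Subgroup.mul_mem _ (Subgroup.inv_mem _ (omem g hg)) (omem _ (outg w hw))
      · exact omem w hw
    have e72 : ∀ w : G, w ^ 72 = 1 := by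
      intro w
      by_cases hw : Commute (QuotientGroup.mk' (Nsub G) w) (QuotientGroup.mk' (Nsub G) x)
      · obtain ⟨_, _, p, hp, h2⟩ := out g hg
        obtain ⟨_, _, q, hq, h2'⟩ := out _ (outg w hw)
        have hww : QuotientGroup.mk' (Nsub G) w
            = QuotientGroup.mk' (Nsub G) ((p * g) * (q * (g * w))) := by
          have h3 : QuotientGroup.mk' (Nsub G) (p * g) ^ 2 = 1 := by rw [← map_pow, h2, map_one]
          have hp1 := mem_iff.mpr hp
          have hq1 := mem_iff.mpr hq
          rw [map_mul, hp1, one_mul] at h3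
          rw [map_mul, map_mul, map_mul, hp1, hq1, one_mul, one_mul, map_mul, ← mul_assoc, ← sq, h3,
            one_mul]
        have h9 : w ^ 9 ∈ Nsub G := by
          rw [← mem_iff, map_pow]
          rcases H.mul _ _ (Or.inl (pow_four_of_sq h2)) (Or.inl (pow_four_of_sq h2')) with h | h
          · rw [hww] at hw ⊢
            rw [mem_iff.mpr (H.f1 hx (k := 3) (by simpa using h) hw), one_pow]
          · rw [hww, ← map_pow, h, map_one]
        exact two_dec h9
      · rw [show 72 = 8 * 9 by norm_num, pow_mul, (out w hw).1, one_pow]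
    have hmem : ∀ {w : G}, w ∈ (Subgroup.centralizer {QuotientGroup.mk' (Nsub G) x}).comap
        (QuotientGroup.mk' (Nsub G)) ↔
        Commute (QuotientGroup.mk' (Nsub G) w) (QuotientGroup.mk' (Nsub G) x) := by
      intro w
      rw [Subgroup.mem_comap, Subgroup.mem_centralizer_singleton_iff]
      exact Iff.rfl
    have hinv : ∀ w : G, Commute (QuotientGroup.mk' (Nsub G) w) (QuotientGroup.mk' (Nsub G) x) →
        QuotientGroup.mk' (Nsub G) (g * w * g⁻¹) = (QuotientGroup.mk' (Nsub G) w)⁻¹ := by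
      intro w hw
      have h1 := mem_iff.mpr (out _ (outg w hw)).2.1
      have h2 := mem_iff.mpr (out g hg).2.1
      rw [map_pow, sq] at h2
      have h3 : (QuotientGroup.mk' (Nsub G) g)⁻¹ = QuotientGroup.mk' (Nsub G) g :=
        inv_eq_of_mul_eq_one_left h2
      rw [map_pow, sq, map_mul] at h1
      rw [map_mul, map_mul, map_inv, h3, eq_inv_iff_mul_eq_one]
      rw [mul_assoc]; exact h1
    have hCL : LFG ((Subgroup.centralizer {QuotientGroup.mk' (Nsub G) x}).comap
        (QuotientGroup.mk' (Nsub G))) := by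
      apply LFG.sub_ext (QuotientGroup.mk' (Nsub G)) _ hk
      apply LFG.of_comm
      · rintro ⟨a, ha⟩ ⟨b, hb⟩
        apply Subtype.ext
        obtain ⟨a', ha', rfl⟩ := ha
        obtain ⟨b', hb', rfl⟩ := hb
        have ha := hmem.mp ha'
        have hb := hmem.mp hb'
        have h1 := hinv (a' * b') (by rw [map_mul]; exact ha.mul_left hb)
        have e : g * (a' * b') * g⁻¹ = (g * a' * g⁻¹) * (g * b' * g⁻¹) := by group
        rw [e, map_mul, hinv a' ha, hinv b' hb, map_mul, ← mul_inv_rev, inv_inj] at h1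
        exact h1.symm
      · rintro ⟨a, ha⟩
        obtain ⟨a', ha', rfl⟩ := ha
        refine ⟨72, by norm_num, ?_⟩
        apply Subtype.ext
        simp only [Subgroup.coe_pow]
        rw [← map_pow, e72, map_one]; rfl
    have hnor : ((Subgroup.centralizer {QuotientGroup.mk' (Nsub G) x}).comap
        (QuotientGroup.mk' (Nsub G))).Normal := by
      constructor
      intro c hc h
      rw [hmem] at hc ⊢
      rw [map_mul, map_mul, map_inv]
      rcases H.conj_cases hx h⁻¹ with h1 | h1
      · rw [map_inv] at h1
        have h2 := h1.inv_left
        rw [inv_inv] at h2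
        exact (h2.mul_left hc).mul_left h1
      · rw [← mem_iff, map_mul, map_mul, map_mul, map_inv, inv_inv, mul_eq_one_iff_eq_inv] at h1
        obtain ⟨γ, dγ⟩ : ∃ γ, γ = QuotientGroup.mk' (Nsub G) h := ⟨_, rfl⟩
        obtain ⟨ξ, dξ⟩ : ∃ ξ, ξ = QuotientGroup.mk' (Nsub G) x := ⟨_, rfl⟩
        obtain ⟨κ, dκ⟩ : ∃ κ, κ = QuotientGroup.mk' (Nsub G) c := ⟨_, rfl⟩
        rw [← dγ, ← dξ] at h1
        rw [← dκ, ← dξ] at hc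
        rw [← dγ, ← dξ, ← dκ]
        have h2 : κ * ξ⁻¹ = ξ⁻¹ * κ := hc.inv_right.eq
        rw [commute_iff_eq]
        calc γ * κ * γ⁻¹ * ξ = γ * (κ * (γ⁻¹ * ξ * γ)) * γ⁻¹ := by group
          _ = γ * (γ⁻¹ * ξ * γ) * κ * γ⁻¹ := by rw [h1, h2]; group
          _ = ξ * (γ * κ * γ⁻¹) := by group
    have hz : LFG (Subgroup.zpowers g) := by
      apply LFG.of_comm
      · rintro ⟨a, ha⟩ ⟨b, hb⟩
        apply Subtype.ext
        obtain ⟨i, rfl⟩ := Subgroup.mem_zpowers_iff.mp ha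
        obtain ⟨j, rfl⟩ := Subgroup.mem_zpowers_iff.mp hb
        exact (Commute.zpow_zpow_self g i j).eq
      · rintro ⟨a, ha⟩
        exact ⟨72, by norm_num, Subtype.ext (by simpa using e72 a)⟩
    have hG := LFG.sup hCL hz
    have hT : ∀ w : G, w ∈ (Subgroup.centralizer {QuotientGroup.mk' (Nsub G) x}).comap
        (QuotientGroup.mk' (Nsub G)) ⊔ Subgroup.zpowers g := by
      intro w
      by_cases hw : Commute (QuotientGroup.mk' (Nsub G) w) (QuotientGroup.mk' (Nsub G) x)
      · exact Subgroup.mem_sup_left (hmem.mpr hw)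
      · have h1 : w * g⁻¹ ∈ (Subgroup.centralizer {QuotientGroup.mk' (Nsub G) x}).comap
            (QuotientGroup.mk' (Nsub G)) := by
          rw [hmem]
          rcases H.conj_cases hx w with h | h
          · exact (hw h).elim
          rcases H.conj_cases hx g with h' | h'
          · exact (hg h').elim
          rw [← mem_iff, map_mul, map_mul, map_mul, map_inv, mul_eq_one_iff_eq_inv] at h h'
          rw [map_mul, map_inv]
          obtain ⟨γ, dγ⟩ : ∃ γ, γ = QuotientGroup.mk' (Nsub G) g := ⟨_, rfl⟩
          obtain ⟨ξ, dξ⟩ : ∃ ξ, ξ = QuotientGroup.mk' (Nsub G) x := ⟨_, rfl⟩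
          obtain ⟨κ, dκ⟩ : ∃ κ, κ = QuotientGroup.mk' (Nsub G) w := ⟨_, rfl⟩
          rw [← dγ, ← dξ] at h'
          rw [← dκ, ← dξ] at h
          rw [← dγ, ← dξ, ← dκ]
          have h2 : γ⁻¹ * ξ * γ = ξ⁻¹ := by
            have h3 : ξ = γ * ξ⁻¹ * γ⁻¹ := by
              have := congrArg (·⁻¹) h'
              simpa [mul_assoc] using this.symm
            nth_rw 1 [h3]; group
          have h4 : κ * ξ⁻¹ * κ⁻¹ = ξ := by
            have := congrArg (·⁻¹) h
            simpa [mul_assoc] using this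
          rw [commute_iff_eq]
          calc κ * γ⁻¹ * ξ = κ * (γ⁻¹ * ξ * γ) * κ⁻¹ * (κ * γ⁻¹) := by group
            _ = ξ * (κ * γ⁻¹) := by rw [h2, h4]
        have e : w = (w * g⁻¹) * g := by group
        rw [e]
        exact Subgroup.mul_mem _ (Subgroup.mem_sup_left h1)
          (Subgroup.mem_sup_right (Subgroup.mem_zpowers g))
    refine ⟨LFG.mono (fun w _ => hT w) hG, fun w _ => e72 w, ?_⟩
    intro q
    obtain ⟨w, rfl⟩ := QuotientGroup.mk_surjective q
    refine ⟨0, ?_⟩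
    rw [(QuotientGroup.eq_one_iff w).mpr (oall w)]; simp

end CA


/-! ### Deriving the working hypotheses -/

theorem HH.of_hyp {G : Type*} [Group G] (hG : HypH G) (h6 : ∀ g : G, orderOf g ≠ 6) : HH G := by
  obtain ⟨hf, hp, hm⟩ := hG
  have pe : ∀ g : G, (∃ n : ℕ, g ^ (2 ^ n) = 1) ∨ ∃ n : ℕ, g ^ (3 ^ n) = 1 := by
    intro g
    have hpos : orderOf g ≠ 0 := (hf g).orderOf_pos.ne'
    have hpr : ∀ p : ℕ, p.Prime → p ∣ orderOf g → p = 2 ∨ p = 3 :=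
      fun p hpp hd => (hp p hpp).mp ⟨g, hd⟩
    by_cases h2 : 2 ∣ orderOf g
    · by_cases h3 : 3 ∣ orderOf g
      · exfalso
        have h6' : 6 ∣ orderOf g := by
          have := Nat.Coprime.mul_dvd_of_dvd_of_dvd (by norm_num : Nat.Coprime 2 3) h2 h3
          simpa using this
        exact h6 (g ^ (orderOf g / 6)) (orderOf_pow_orderOf_div hpos h6')
      · left
        have := Nat.eq_prime_pow_of_unique_prime_dvd (p := 2) hpos (fun {d} hd hdd => by
          rcases hpr d hd hdd with rfl | rfl
          · rfl
          · exact (h3 hdd).elim)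
        exact ⟨_, by rw [← this]; exact pow_orderOf_eq_one g⟩
    · right
      have := Nat.eq_prime_pow_of_unique_prime_dvd (p := 3) hpos (fun {d} hd hdd => by
        rcases hpr d hd hdd with rfl | rfl
        · exact (h2 hdd).elim
        · rfl)
      exact ⟨_, by rw [← this]; exact pow_orderOf_eq_one g⟩
  refine ⟨pe, ?_⟩
  intro u v hu hv
  have hle : ∀ w : G, (w ^ 4 = 1 ∨ w ^ 3 = 1) → orderOf w ≤ 4 := by
    rintro w (h | h)
    · exact orderOf_le_of_pow_eq_one (by norm_num) h
    · exact (orderOf_le_of_pow_eq_one (by norm_num) h).trans (by norm_num)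
  have h9 := hm u v (hle u hu) (hle v hv)
  rcases pe (u * v) with ⟨n, hn⟩ | ⟨n, hn⟩
  · left
    obtain ⟨k, _, hk⟩ := (Nat.dvd_prime_pow Nat.prime_two).mp (orderOf_dvd_of_pow_eq_one hn)
    rw [hk] at h9
    have hk3 : k ≤ 3 := by
      by_contra hlt
      have : 2 ^ 4 ≤ 2 ^ k := Nat.pow_le_pow_right (by norm_num) (by omega)
      omega
    rw [← orderOf_dvd_iff_pow_eq_one, hk]
    exact pow_dvd_pow 2 hk3
  · right
    obtain ⟨k, _, hk⟩ := (Nat.dvd_prime_pow Nat.prime_three).mp (orderOf_dvd_of_pow_eq_one hn)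
    rw [hk] at h9
    have hk3 : k ≤ 2 := by
      by_contra hlt
      have : 3 ^ 3 ≤ 3 ^ k := Nat.pow_le_pow_right (by norm_num) (by omega)
      omega
    rw [← orderOf_dvd_iff_pow_eq_one, hk]
    exact pow_dvd_pow 3 hk3

theorem HypH.exists_prime {G : Type*} [Group G] (hG : HypH G) {p : ℕ} (hp : p.Prime)
    (h : p = 2 ∨ p = 3) : ∃ a : G, a ^ p = 1 ∧ a ≠ 1 := by
  obtain ⟨g, hg⟩ := (hG.2.1 p hp).mpr h
  have ho := orderOf_pow_orderOf_div (hG.1 g).orderOf_pos.ne' hg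
  refine ⟨g ^ (orderOf g / p), ?_, ?_⟩
  · rw [← orderOf_dvd_iff_pow_eq_one, ho]
  · intro h1
    rw [h1, orderOf_one] at ho
    exact hp.one_lt.ne ho


/-- Corollary 1: if `G` satisfies (H) and has no element of order 6, then `Ω(G)` is
locally finite of exponent dividing 72, and `G/Ω(G)` is a 3-group, a locally cyclic
2-group, the Klein four-group, the dihedral group of order 8, or the symmetric group
on three letters. -/
theorem statement_3 (G : Type*) [Group G] (hG : HypH G) (h6 : ∀ g : G, orderOf g ≠ 6) :
    (∀ S : Subgroup (Omega G), S.FG → Finite S) ∧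
    (∀ w ∈ Omega G, w ^ 72 = 1) ∧
    ((∀ q : G ⧸ Omega G, ∃ k : ℕ, orderOf q = 3 ^ k) ∨
      IsLocallyCyclic2Group (G ⧸ Omega G) ∨
      Nonempty (G ⧸ Omega G ≃* Multiplicative (ZMod 2) × Multiplicative (ZMod 2)) ∨
      Nonempty (G ⧸ Omega G ≃* DihedralGroup 4) ∨
      Nonempty (G ⧸ Omega G ≃* Equiv.Perm (Fin 3))) := by
  have H := HH.of_hyp hG h6
  have hexX : ∃ x : G, X3 x := hG.exists_prime Nat.prime_three (Or.inr rfl)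
  have hexI : ∃ a : G, a ^ 2 = 1 ∧ a ≠ 1 := hG.exists_prime Nat.prime_two (Or.inl rfl)
  by_cases hA : ∃ e t : G, e ^ 2 = 1 ∧ e ≠ 1 ∧ t ^ 3 = 1 ∧ t ≠ 1 ∧ (t * e) ^ 3 = 1
  · obtain ⟨e, t, he, he1, ht, _, hte⟩ := hA
    have HA : CA G := ⟨H, hexX, fun x y hx hy => caseA_main H hexX he he1 ht hte hx hy⟩
    obtain ⟨h1, h2, h3⟩ := HA.final
    exact ⟨h1, h2, Or.inl h3⟩
  · have HBG : HB G := ⟨H, fun e t he he1 ht ht1 hte => hA ⟨e, t, he, he1, ht, ht1, hte⟩, hexX⟩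
    obtain ⟨h1, h2, h3⟩ := HBG.final hexI
    refine ⟨h1, h2, Or.inr ?_⟩
    rcases h3 with h | h | h
    · exact Or.inl h
    · exact Or.inr (Or.inl h)
    · exact Or.inr (Or.inr (Or.inl h))
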